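/- Let G be a finitely presented group that contains no subgroup isomorphic to the free group of rank 2, and let N be a normal subgroup of G with G' ≤ N. Then the untwisted N-fibre product H = {(g₁,g₂) ∈ G × G : g₁N = g₂N} is finitely presented. -/

import Mathlib

/-- A group is finitely presented if it is the quotient of a finitely generated free group
by the normal closure of finitely many relators. -/
def FinitelyPresentedGroup (G : Type*) [Group G] : Prop :=
  ∃ (n : ℕ) (f : FreeGroup (Fin n) →* G) (S : Finset (FreeGroup (Fin n))),
    Function.Surjective f ∧ f.ker = Subgroup.normalClosure (S : Set (FreeGroup (Fin n)))

/-- The fibre product associated to an isomorphism `μ : G₁⧸N₁ ≃* G₂⧸N₂`. -/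
def fibreProduct {G₁ G₂ : Type*} [Group G₁] [Group G₂]
    (N₁ : Subgroup G₁) (N₂ : Subgroup G₂) [N₁.Normal] [N₂.Normal]
    (μ : (G₁ ⧸ N₁) ≃* (G₂ ⧸ N₂)) : Subgroup (G₁ × G₂) where
  carrier := {p | μ (QuotientGroup.mk p.1) = QuotientGroup.mk p.2}
  one_mem' := by simp
  mul_mem' := by
    intro a b ha hb
    simp only [Set.mem_setOf_eq] at *
    rw [Prod.fst_mul, Prod.snd_mul, QuotientGroup.mk_mul, QuotientGroup.mk_mul, map_mul, ha, hb]
  inv_mem' := by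
    intro a ha
    simp only [Set.mem_setOf_eq] at *
    rw [Prod.fst_inv, Prod.snd_inv, QuotientGroup.mk_inv, QuotientGroup.mk_inv, map_inv, ha]

section partB

namespace FPF

/-! ### Words in letters `t_i^{±1}` and displacement -/

abbrev Ltr (n : ℕ) := Fin n × Bool

def vec {n : ℕ} (x : Ltr n) : Fin n → ℤ := Pi.single x.1 (if x.2 then 1 else -1)

def xinv {n : ℕ} (x : Ltr n) : Ltr n := (x.1, !x.2)

@[simp] theorem xinv_xinv {n : ℕ} (x : Ltr n) : xinv (xinv x) = x := by
  simp [xinv]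

@[simp] theorem xinv_fst {n : ℕ} (x : Ltr n) : (xinv x).1 = x.1 := rfl

@[simp] theorem vec_xinv {n : ℕ} (x : Ltr n) : vec (xinv x) = - vec x := by
  rcases x with ⟨i, b⟩
  cases b <;> simp [vec, xinv, Pi.single_neg]

def disp {n : ℕ} (l : List (Ltr n)) : Fin n → ℤ := (l.map vec).sum

@[simp] theorem disp_nil {n : ℕ} : disp ([] : List (Ltr n)) = 0 := rfl
@[simp] theorem disp_cons {n : ℕ} (x : Ltr n) (l : List (Ltr n)) :
    disp (x :: l) = vec x + disp l := by simp [disp]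
@[simp] theorem disp_append {n : ℕ} (l l' : List (Ltr n)) :
    disp (l ++ l') = disp l + disp l' := by simp [disp]

def winv {n : ℕ} (l : List (Ltr n)) : List (Ltr n) := (l.map xinv).reverse

@[simp] theorem winv_nil {n : ℕ} : winv ([] : List (Ltr n)) = [] := rfl
@[simp] theorem winv_cons {n : ℕ} (x : Ltr n) (l : List (Ltr n)) :
    winv (x :: l) = winv l ++ [xinv x] := by simp [winv]
@[simp] theorem winv_append {n : ℕ} (l l' : List (Ltr n)) :
    winv (l ++ l') = winv l' ++ winv l := by simp [winv]
@[simp] theorem winv_winv {n : ℕ} (l : List (Ltr n)) : winv (winv l) = l := by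
  induction l with
  | nil => rfl
  | cons x l ih => simp [ih]
@[simp] theorem disp_winv {n : ℕ} (l : List (Ltr n)) : disp (winv l) = - disp l := by
  induction l with
  | nil => simp
  | cons x l ih => simp [ih]
@[simp] theorem length_winv {n : ℕ} (l : List (Ltr n)) : (winv l).length = l.length := by
  simp [winv]

def nsq {n : ℕ} (p : Fin n → ℤ) : ℤ := ∑ i, p i ^ 2

theorem nsq_nonneg {n : ℕ} (p : Fin n → ℤ) : 0 ≤ nsq p :=
  Finset.sum_nonneg fun _ _ => sq_nonneg _

theorem nsq_neg {n : ℕ} (p : Fin n → ℤ) : nsq (-p) = nsq p := by simp [nsq]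

theorem nsq_le {n : ℕ} {p q : Fin n → ℤ} (h : ∀ i, |p i| ≤ |q i|) : nsq p ≤ nsq q :=
  Finset.sum_le_sum fun i _ => sq_le_sq.2 (h i)

def Diam {n : ℕ} (ρ : ℤ) (u : List (Ltr n)) : Prop :=
  ∀ r s, r <+: u → s <+: u → nsq (disp r - disp s) ≤ ρ

theorem Diam.mono {n : ℕ} {ρ ρ' : ℤ} {u : List (Ltr n)} (h : Diam ρ u) (hh : ρ ≤ ρ') :
    Diam ρ' u := fun r s hr hs => (h r s hr hs).trans hh

theorem Diam.of_pre {n : ℕ} {ρ : ℤ} {u v : List (Ltr n)} (h : Diam ρ u) (hv : v <+: u) :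
    Diam ρ v := fun r s hr hs => h r s (hr.trans hv) (hs.trans hv)

theorem Diam.suffix {n : ℕ} {ρ : ℤ} {u v : List (Ltr n)} (h : Diam ρ u) (hv : v <:+ u) :
    Diam ρ v := by
  obtain ⟨p, rfl⟩ := hv
  intro r s hr hs
  have := h (p ++ r) (p ++ s) ((List.prefix_append_right_inj p).2 hr)
    ((List.prefix_append_right_inj p).2 hs)
  simpa using this

theorem Diam.disp_le {n : ℕ} {ρ : ℤ} {u : List (Ltr n)} (h : Diam ρ u) : nsq (disp u) ≤ ρ := by
  simpa using h u [] (List.prefix_refl _) (List.nil_prefix)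

theorem Diam.winv {n : ℕ} {ρ : ℤ} {u : List (Ltr n)} (h : Diam ρ u) : Diam ρ (winv u) := by
  have key : ∀ r, r <+: FPF.winv u → ∃ r', r' <+: u ∧ disp r = disp r' - disp u := by
    rintro r ⟨s, hs⟩
    have : u = FPF.winv s ++ FPF.winv r := by
      rw [← winv_append, hs, winv_winv]
    refine ⟨FPF.winv s, ⟨_, this.symm⟩, ?_⟩
    rw [this]; simp
  intro r s hr hs
  obtain ⟨r', hr', er⟩ := key r hr
  obtain ⟨s', hs', es⟩ := key s hs
  rw [er, es]
  have := h r' s' hr' hs'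
  simpa using this

/-! ### Commutation configurations -/

def ev {n : ℕ} {E : Type*} [Group E] (t : Ltr n → E) (l : List (Ltr n)) : E := (l.map t).prod

section ev
variable {n : ℕ} {E : Type*} [Group E] (t : Ltr n → E)

@[simp] theorem ev_nil : ev t [] = 1 := rfl
@[simp] theorem ev_cons (x : Ltr n) (l : List (Ltr n)) : ev t (x :: l) = t x * ev t l := by
  simp [ev]
@[simp] theorem ev_append (l l' : List (Ltr n)) : ev t (l ++ l') = ev t l * ev t l' := by
  simp [ev]
theorem ev_winv (ht : ∀ x, t (xinv x) = (t x)⁻¹) (l : List (Ltr n)) :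
    ev t (winv l) = (ev t l)⁻¹ := by
  induction l with
  | nil => simp
  | cons x l ih => simp [ih, ht]
theorem map_ev {E' : Type*} [Group E'] (f : E →* E') (l : List (Ltr n)) :
    f (ev t l) = ev (fun x => f (t x)) l := by
  induction l with
  | nil => simp
  | cons x l ih => simp [ih]
end ev

/-- every `A`-element conjugated by `g` commutes with every `B`-element -/
def CC {E : Type*} [Group E] (A B : Set E) (g : E) : Prop :=
  ∀ α ∈ A, ∀ β ∈ B, Commute (g * α * g⁻¹) β

theorem CC.symm {E : Type*} [Group E] {A B : Set E} {g : E} (h : CC A B g) : CC B A g⁻¹ := by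
  intro β hβ α hα
  have := h α hα β hβ
  have h2 := (SemiconjBy.conj_iff (x := β) (y := β) (a := g * α * g⁻¹) (b := g⁻¹)).2 this
  have : Commute α (g⁻¹ * β * g⁻¹⁻¹) := by
    unfold Commute
    convert h2 using 1
    group
  exact this.symm

structure Cfg {n : ℕ} {E : Type*} [Group E] (t : Ltr n → E) (A B : Set E)
    (a b : Ltr n → Ltr n → E) : Prop where
  tinv : ∀ x, t (xinv x) = (t x)⁻¹
  amem : ∀ x y, a x y ∈ A
  bmem : ∀ x y, b x y ∈ B
  aconj : ∀ x y, (t x)⁻¹ * a x y * t x ∈ A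
  bconj : ∀ x y, (t x)⁻¹ * b x y * t x ∈ B
  comm : ∀ x y, t x * t y = a x y * b x y * (t y * t x)
  base : CC A B 1

section cfg
variable {n : ℕ} {E : Type*} [Group E] {t : Ltr n → E} {A B : Set E} {a b : Ltr n → Ltr n → E}

theorem Cfg.swap (h : Cfg t A B a b) : Cfg t B A b a where
  tinv := h.tinv
  amem := h.bmem
  bmem := h.amem
  aconj := h.bconj
  bconj := h.aconj
  comm x y := by
    rw [h.comm x y]
    have : Commute (a x y) (b x y) := by
      simpa using h.base _ (h.amem x y) _ (h.bmem x y)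
    rw [this.eq]
  base := by simpa using h.base.symm

/-- Swapping two adjacent letters. -/
theorem Cfg.swap_letters (h : Cfg t A B a b) (x y : Ltr n) {g k : E} (hg : CC A B g)
    (hk : CC A B (t y * k)) :
    CC A B (g * (t x * (t y * k))) ↔ CC A B (g * (t y * (t x * k))) := by
  have hab : Commute (a x y) (b x y) := by
    simpa using h.base _ (h.amem x y) _ (h.bmem x y)
  set b' := (t x)⁻¹ * b x y * t x with hb'
  have key : ∀ α ∈ A, (g * (t y * (t x * k))) * α * (g * (t y * (t x * k)))⁻¹ =
      (g * a x y * g⁻¹)⁻¹ * ((g * (t x * (t y * k))) * α * (g * (t x * (t y * k)))⁻¹) *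
      (g * a x y * g⁻¹) := by
    intro α hα
    have h1 : Commute ((t y * k) * α * (t y * k)⁻¹) b' := hk α hα _ (h.bconj x y)
    have h2 : t y * t x = (a x y)⁻¹ * t x * b'⁻¹ * t y := by
      have := h.comm x y
      have e : t y * t x = (b x y)⁻¹ * ((a x y)⁻¹ * (t x * t y)) := by rw [this]; group
      rw [e, hb']
      have := hab.inv_inv.eq
      calc (b x y)⁻¹ * ((a x y)⁻¹ * (t x * t y)) = ((b x y)⁻¹ * (a x y)⁻¹) * (t x * t y) := by group
        _ = ((a x y)⁻¹ * (b x y)⁻¹) * (t x * t y) := by rw [this]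
        _ = _ := by group
    have h3 : g * (t y * (t x * k)) = g * (a x y)⁻¹ * t x * b'⁻¹ * (t y * k) := by
      calc g * (t y * (t x * k)) = g * (t y * t x) * k := by group
        _ = _ := by rw [h2]; group
    rw [h3]
    have h4 : b'⁻¹ * ((t y * k) * α * (t y * k)⁻¹) * b' = ((t y * k) * α * (t y * k)⁻¹) := by
      rw [mul_assoc, h1.eq]; group
    calc _ = g * (a x y)⁻¹ * t x * (b'⁻¹ * ((t y * k) * α * (t y * k)⁻¹) * b') *
          (g * (a x y)⁻¹ * t x)⁻¹ := by group
      _ = _ := by rw [h4]; group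
  have hc : ∀ β ∈ B, Commute (g * a x y * g⁻¹) β := hg _ (h.amem x y)
  constructor
  · intro H α hα β hβ
    rw [key α hα]
    exact (((hc β hβ).inv_left).mul_left (H α hα β hβ)).mul_left (hc β hβ)
  · intro H α hα β hβ
    have e : (g * (t x * (t y * k))) * α * (g * (t x * (t y * k)))⁻¹ =
      (g * a x y * g⁻¹) * ((g * (t y * (t x * k))) * α * (g * (t y * (t x * k)))⁻¹) *
      (g * a x y * g⁻¹)⁻¹ := by
      rw [key α hα]; group
    rw [e]
    exact ((hc β hβ).mul_left (H α hα β hβ)).mul_left (hc β hβ).inv_left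

/-- Pushing part of a path in direction of the letter `e`. -/
inductive Push (e : Ltr n) : Bool → List (Ltr n) → List (Ltr n) → Prop
  | nil : Push e false [] []
  | keep (f x l l') : Push e f l l' → Push e f (x :: l) (x :: l')
  | up (l l') : Push e true l l' → Push e false (e :: l) l'
  | down (l l') : Push e false l l' → Push e true (xinv e :: l) l'

theorem Cfg.push (h : Cfg t A B a b) {e : Ltr n} {f : Bool} {l l' : List (Ltr n)}
    (hp : Push e f l l') : ∀ (g : E),
    (∀ p, p <+: l' → p ≠ l' → CC A B (g * ev t p)) →
    (∀ s, s <:+ l → (s ≠ l ∨ f = true) → CC A B (ev t s)) →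
    CC A B (g * ev t l') → CC A B (g * ((if f then t e else 1) * ev t l)) := by
  induction hp with
  | nil => intro g _ _ h; simpa using h
  | keep f x l l' hp ih =>
    intro g h1 h2 h3
    have ih' := ih (g * t x) (fun p hp hne => by
        have := h1 (x :: p) (by simpa using hp) (by simpa using hne)
        simpa [mul_assoc] using this) (fun s hs _ => by
        refine h2 s (hs.trans (List.suffix_cons _ _)) (Or.inl ?_)
        rintro rfl
        have := hs.length_le
        simp at this) (by simpa [mul_assoc] using h3)
    cases f with
    | false => simpa [mul_assoc] using ih'
    | true =>
      have hg : CC A B g := by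
        simpa using h1 [] List.nil_prefix (by simp)
      have hk : CC A B (t x * ev t l) := by
        simpa using h2 (x :: l) List.suffix_rfl (Or.inr rfl)
      have := (h.swap_letters e x hg hk).2 (by simpa [mul_assoc] using ih')
      simpa using this
  | up l l' hp ih =>
    intro g h1 h2 h3
    have := ih g h1 (fun s hs _ => by
        refine h2 s (hs.trans (List.suffix_cons _ _)) (Or.inl ?_)
        rintro rfl
        have := hs.length_le
        simp at this) h3
    simpa using this
  | down l l' hp ih =>
    intro g h1 h2 h3
    have := ih g h1 (fun s hs _ => by
        refine h2 s (hs.trans (List.suffix_cons _ _)) (Or.inl ?_)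
        rintro rfl
        have := hs.length_le
        simp at this) h3
    simpa [h.tinv] using this

end cfg

end FPF

end partB

section partC

namespace FPF

section geo
variable {n : ℕ}

def Geo (u : List (Ltr n)) : Prop := ∀ x ∈ u, xinv x ∉ u

theorem eq_or_eq_xinv {x y : Ltr n} (h : x.1 = y.1) : x = y ∨ x = xinv y := by
  rcases x with ⟨i, b⟩
  rcases y with ⟨j, c⟩
  simp only at h
  subst h
  cases b <;> cases c <;> simp [xinv]

theorem vec_apply_of_ne {x : Ltr n} {i : Fin n} (h : x.1 ≠ i) : vec x i = 0 := by
  simp [vec, Pi.single_apply, Ne.symm h]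

theorem abs_vec_le (x : Ltr n) (i : Fin n) : |vec x i| ≤ if x.1 = i then 1 else 0 := by
  by_cases h : x.1 = i
  · subst h
    rcases x with ⟨j, b⟩
    cases b <;> simp [vec]
  · simp [vec_apply_of_ne h, h]

theorem abs_disp_le (u : List (Ltr n)) (i : Fin n) :
    |disp u i| ≤ (u.countP (fun x => x.1 = i) : ℕ) := by
  induction u with
  | nil => simp
  | cons x u ih =>
    rw [disp_cons, Pi.add_apply, List.countP_cons]
    have := abs_vec_le x i
    have h2 := abs_add_le (vec x i) (disp u i)
    by_cases h : x.1 = i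
    · rw [if_pos h] at this
      simp only [h, decide_true, if_true]
      push_cast; linarith
    · rw [if_neg h] at this
      simp only [h, decide_false, Bool.false_eq_true, if_false]
      push_cast; linarith

theorem Geo.mono {u v : List (Ltr n)} (h : Geo u) (hv : v ⊆ u) : Geo v :=
  fun x hx hx' => h x (hv hx) (hv hx')

theorem Geo.disp_eq {u : List (Ltr n)} (h : Geo u) (x : Ltr n) (hx : x ∈ u) :
    disp u x.1 = vec x x.1 * (u.countP (fun z => z.1 = x.1) : ℕ) := by
  have key : ∀ v : List (Ltr n), v ⊆ u →
      disp v x.1 = vec x x.1 * (v.countP (fun z => z.1 = x.1) : ℕ) := by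
    intro v
    induction v with
    | nil => simp
    | cons y v ih =>
      intro hv
      rw [List.cons_subset] at hv
      rw [disp_cons, Pi.add_apply, List.countP_cons, ih hv.2]
      by_cases hy : y.1 = x.1
      · rcases eq_or_eq_xinv hy with rfl | rfl
        · simp; ring
        · exact absurd hv.1 (h x hx)
      · simp [vec_apply_of_ne hy, hy]
  exact key u (List.Subset.refl _)

theorem abs_vec_self (x : Ltr n) : |vec x x.1| = 1 := by
  rcases x with ⟨j, b⟩
  cases b <;> simp [vec]

theorem Geo.abs_disp {u : List (Ltr n)} (h : Geo u) (i : Fin n) :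
    |disp u i| = (u.countP (fun x => x.1 = i) : ℕ) := by
  by_cases hx : ∃ x ∈ u, x.1 = i
  · obtain ⟨x, hx, rfl⟩ := hx
    rw [h.disp_eq x hx, abs_mul, abs_vec_self]; simp
  · push Not at hx
    have : u.countP (fun x => x.1 = i) = 0 := by
      rw [List.countP_eq_zero]; simpa using hx
    have h2 := abs_disp_le u i
    rw [this] at h2 ⊢
    have := abs_nonneg (disp u i)
    omega

theorem Geo.abs_disp_le_of_infix {u v : List (Ltr n)} (h : Geo u) (hv : v.Sublist u) (i : Fin n) :
    |disp v i| ≤ |disp u i| := by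
  rw [h.abs_disp]
  refine (abs_disp_le v i).trans ?_
  exact_mod_cast hv.countP_le

theorem Geo.diam {u : List (Ltr n)} (h : Geo u) : Diam (nsq (disp u)) u := by
  have key : ∀ r s : List (Ltr n), r <+: s → s <+: u → nsq (disp s - disp r) ≤ nsq (disp u) := by
    rintro r s ⟨w, rfl⟩ hs
    have : disp (r ++ w) - disp r = disp w := by simp
    rw [this]
    exact nsq_le fun i => h.abs_disp_le_of_infix
      (((List.suffix_append r w).sublist).trans hs.sublist) i
  intro r s hr hs
  rcases List.prefix_or_prefix_of_prefix hr hs with h1 | h1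
  · rw [← nsq_neg, neg_sub]; exact key r s h1 hs
  · exact key s r h1 hr

theorem disp_perm {u v : List (Ltr n)} (h : u.Perm v) : disp u = disp v :=
  (h.map vec).sum_eq

theorem Geo.perm {u v : List (Ltr n)} (h : Geo u) (hp : u.Perm v) : Geo v :=
  h.mono hp.symm.subset

theorem Geo.count_eq {u : List (Ltr n)} (h : Geo u) (x : Ltr n) :
    (u.count x : ℤ) = max 0 (vec x x.1 * disp u x.1) := by
  by_cases hx : x ∈ u
  · rw [h.disp_eq x hx, ← mul_assoc]
    have : vec x x.1 * vec x x.1 = 1 := by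
      rcases x with ⟨j, b⟩
      cases b <;> simp [vec]
    rw [this, one_mul, max_eq_right (by positivity)]
    norm_cast
    rw [List.count]
    apply List.countP_congr
    intro z hz
    simp only [beq_iff_eq, decide_eq_true_eq]
    constructor
    · rintro rfl; rfl
    · intro hzx
      rcases eq_or_eq_xinv hzx with rfl | rfl
      · rfl
      · exact absurd hz (h x hx)
  · rw [List.count_eq_zero_of_not_mem hx]
    by_cases hx' : xinv x ∈ u
    · have := h.disp_eq _ hx'
      simp only [xinv_fst] at this
      rw [this, vec_xinv]
      have : vec x x.1 * vec x x.1 = 1 := by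
        rcases x with ⟨j, b⟩
        cases b <;> simp [vec]
      symm
      rw [Nat.cast_zero, max_eq_left]
      simp only [Pi.neg_apply]
      have h3 : ∀ c : ℕ, vec x x.1 * (-vec x x.1 * (c : ℤ)) ≤ 0 := by
        intro c
        have h4 : vec x x.1 * (-vec x x.1 * (c : ℤ)) = - (c : ℤ) := by
          linear_combination (-(c : ℤ)) * this
        rw [h4]; simp
      exact h3 _
    · have : u.countP (fun z => z.1 = x.1) = 0 := by
        rw [List.countP_eq_zero]
        intro z hz
        simp only [decide_eq_true_eq]
        intro hzx
        rcases eq_or_eq_xinv hzx with rfl | rfl <;> contradiction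
      have h2 := h.abs_disp x.1
      rw [this] at h2
      have : disp u x.1 = 0 := by simpa using h2
      rw [this]; simp

theorem Geo.perm_of_disp {u v : List (Ltr n)} (hu : Geo u) (hv : Geo v) (h : disp u = disp v) :
    u.Perm v := by
  rw [List.perm_iff_count]
  intro x
  have := hu.count_eq x
  rw [h, ← hv.count_eq x] at this
  exact_mod_cast this

end geo

section reduce
variable {n : ℕ}

theorem Push.refl (e : Ltr n) (l : List (Ltr n)) : Push e false l l := by
  induction l with
  | nil => exact Push.nil
  | cons x l ih => exact Push.keep _ _ _ _ ih

theorem Push.keeps {e : Ltr n} {f : Bool} {l l' : List (Ltr n)} (h : Push e f l l')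
    (p : List (Ltr n)) : Push e f (p ++ l) (p ++ l') := by
  induction p with
  | nil => exact h
  | cons x p ih => exact Push.keep _ _ _ _ ih

def lev (e : Ltr n) (p : Fin n → ℤ) : ℤ := p e.1 * (if e.2 then 1 else -1)

@[simp] theorem lev_add (e : Ltr n) (p q : Fin n → ℤ) : lev e (p + q) = lev e p + lev e q := by
  unfold lev; split_ifs <;> simp <;> ring
@[simp] theorem lev_zero (e : Ltr n) : lev e 0 = 0 := by simp [lev]
@[simp] theorem lev_vec (e : Ltr n) : lev e (vec e) = 1 := by
  rcases e with ⟨i, b⟩; cases b <;> simp [lev, vec]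
@[simp] theorem lev_neg (e : Ltr n) (p : Fin n → ℤ) : lev e (-p) = - lev e p := by
  unfold lev; split_ifs <;> simp

theorem lev_cases (e x : Ltr n) : (x.1 ≠ e.1 ∧ lev e (vec x) = 0) ∨ x = e ∨ x = xinv e := by
  by_cases h : x.1 = e.1
  · right; exact eq_or_eq_xinv h
  · left; refine ⟨h, ?_⟩
    simp [lev, vec_apply_of_ne h]

def kap (e : Ltr n) (m : ℤ) (z : Fin n → ℤ) : Fin n → ℤ := if lev e z = m then z - vec e else z

theorem clip (e : Ltr n) (m : ℤ) : ∀ (l : List (Ltr n)) (p : Fin n → ℤ),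
    (∀ r, r <+: l → lev e (p + disp r) ≤ m) → lev e (p + disp l) < m →
    ∃ l', Push e (decide (lev e p = m)) l l' ∧
      (∀ r', r' <+: l' → ∃ r, r <+: l ∧ kap e m p + disp r' = kap e m (p + disp r)) ∧
      l'.length ≤ l.length ∧ ((∃ r, r <+: l ∧ lev e (p + disp r) = m) → l'.length < l.length) := by
  intro l
  induction l with
  | nil =>
    intro p h1 h2
    have hp : lev e p ≠ m := by simp at h2; omega
    refine ⟨[], ?_, ?_, le_rfl, ?_⟩
    · simpa [hp] using Push.nil
    · intro r' hr'
      have : r' = [] := by simpa using hr'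
      subst this
      exact ⟨[], List.prefix_rfl, by simp⟩
    · rintro ⟨r, hr, hr2⟩
      have : r = [] := by simpa using hr
      subst this
      simp at hr2; exact absurd hr2 hp
  | cons x l ih =>
    intro p h1 h2
    obtain ⟨l', hP, hpre, hlen, hlt⟩ := ih (p + vec x) (fun r hr => by
      have := h1 (x :: r) (by simpa using hr)
      simpa [add_assoc] using this) (by simpa [add_assoc] using h2)
    have hcons : ∀ r, r <+: l → ∃ r1, r1 <+: x :: l ∧ p + vec x + disp r = p + disp r1 := by
      intro r hr
      exact ⟨x :: r, by simpa using hr, by simp [add_assoc]⟩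
    have hlift : ∀ r', r' <+: l' → ∃ r, r <+: x :: l ∧
        kap e m (p + vec x) + disp r' = kap e m (p + disp r) := by
      intro r' hr'
      obtain ⟨r, hr, e1⟩ := hpre r' hr'
      obtain ⟨r1, hr1, e2⟩ := hcons r hr
      exact ⟨r1, hr1, by rw [e1, e2]⟩
    have hpm : lev e p ≤ m := by simpa using h1 [] List.nil_prefix
    have hpxm : lev e (p + vec x) ≤ m := by simpa using h1 [x] (by simp)
    -- the common treatment of kept letters
    have keepcase : (lev e p = m ↔ lev e (p + vec x) = m) →
      ∃ l', Push e (decide (lev e p = m)) (x :: l) l' ∧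
      (∀ r', r' <+: l' → ∃ r, r <+: x :: l ∧ kap e m p + disp r' = kap e m (p + disp r)) ∧
      l'.length ≤ (x :: l).length ∧
      ((∃ r, r <+: x :: l ∧ lev e (p + disp r) = m) → l'.length < (x :: l).length) := by
      intro hiff
      have hd : decide (lev e p = m) = decide (lev e (p + vec x) = m) := by
        simp only [hiff]
      have hk : kap e m (p + vec x) = kap e m p + vec x := by
        unfold kap
        by_cases hh : lev e p = m
        · rw [if_pos hh, if_pos (hiff.1 hh)]; abel
        · rw [if_neg hh, if_neg (fun h => hh (hiff.2 h))]
      refine ⟨x :: l', ?_, ?_, by simpa using hlen, ?_⟩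
      · rw [hd]; exact Push.keep _ _ _ _ hP
      · intro r' hr'
        cases r' with
        | nil => exact ⟨[], List.nil_prefix, by simp⟩
        | cons y r' =>
          rw [List.cons_prefix_cons] at hr'
          obtain ⟨rfl, hr'⟩ := hr'
          obtain ⟨r, hr, e1⟩ := hlift r' hr'
          exact ⟨r, hr, by rw [← e1, hk, disp_cons]; abel⟩
      · rintro ⟨r, hr, hr2⟩
        have : ∃ r, r <+: l ∧ lev e (p + vec x + disp r) = m := by
          cases r with
          | nil => exact ⟨[], List.nil_prefix, by simpa using hiff.1 (by simpa using hr2)⟩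
          | cons y r =>
            rw [List.cons_prefix_cons] at hr
            obtain ⟨rfl, hr⟩ := hr
            exact ⟨r, hr, by simpa [add_assoc] using hr2⟩
        simpa using hlt this
    have dropcase : (kap e m (p + vec x) = kap e m p) →
        Push e (decide (lev e p = m)) (x :: l) l' →
      ∃ l', Push e (decide (lev e p = m)) (x :: l) l' ∧
      (∀ r', r' <+: l' → ∃ r, r <+: x :: l ∧ kap e m p + disp r' = kap e m (p + disp r)) ∧
      l'.length ≤ (x :: l).length ∧
      ((∃ r, r <+: x :: l ∧ lev e (p + disp r) = m) → l'.length < (x :: l).length) := by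
      intro hk hP'
      refine ⟨l', hP', ?_, ?_, ?_⟩
      · rw [← hk]; exact hlift
      · simp; omega
      · intro _; simp; omega
    by_cases hiff : (lev e p = m ↔ lev e (p + vec x) = m)
    · exact keepcase hiff
    · rcases lev_cases e x with ⟨_, h0⟩ | rfl | rfl
      · exact absurd (by rw [lev_add, h0, add_zero]) hiff
      · have a1 : lev x p ≠ m := by
          intro hh
          rw [lev_add, lev_vec] at hpxm; omega
        have a2 : lev x (p + vec x) = m := by
          by_contra hh; exact hiff (iff_of_false a1 hh)
        refine dropcase ?_ ?_
        · simp [kap, a1, a2]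
        · simp only [a1, decide_false]
          simp only [a2, decide_true] at hP
          exact Push.up _ _ hP
      · have a2 : lev e (p + vec (xinv e)) ≠ m := by
          intro hh
          rw [lev_add, vec_xinv, lev_neg, lev_vec] at hh; omega
        have a1 : lev e p = m := by
          by_contra hh; exact hiff (iff_of_false hh a2)
        refine dropcase ?_ ?_
        · unfold kap
          rw [if_pos a1, if_neg a2, vec_xinv]; abel
        · simp only [a1, decide_true]
          simp only [a2, decide_false] at hP
          exact Push.down _ _ hP

theorem nsq_kap_le (e : Ltr n) (m : ℤ) {z w : Fin n → ℤ} (hz : lev e z ≤ m) (hw : lev e w ≤ m) :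
    nsq (kap e m z - kap e m w) ≤ nsq (z - w) := by
  apply nsq_le
  intro i
  by_cases hi : e.1 = i
  · subst hi
    rcases e with ⟨i, b⟩
    unfold kap
    simp only [lev] at *
    cases b <;> simp [vec] at * <;> split_ifs <;> simp <;> rw [← Int.natCast_natAbs, ← Int.natCast_natAbs] <;> omega
  · unfold kap
    split_ifs <;> simp [vec_apply_of_ne hi]

theorem exists_pair (l : List (Ltr n)) (h : ¬ Geo l) : ∃ u1 y v u2,
    l = u1 ++ y :: (v ++ xinv y :: u2) ∧ ∀ z ∈ v, z.1 ≠ y.1 := by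
  induction l with
  | nil => exact absurd (by intro x hx; simp at hx) h
  | cons z l ih =>
    by_cases hl : Geo l
    · have hz : xinv z ∈ l := by
        by_contra hz
        apply h
        intro x hx
        rw [List.mem_cons] at hx ⊢
        rcases hx with rfl | hx
        · rintro (h1 | h1)
          · have := congrArg Prod.snd h1
            simp [xinv] at this
          · exact hz h1
        · rintro (h1 | h1)
          · apply hz; rw [← h1, xinv_xinv]; exact hx
          · exact hl x hx h1
      obtain ⟨as, bs, rfl, hna⟩ := List.eq_append_cons_of_mem hz
      refine ⟨[], z, as, bs, rfl, ?_⟩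
      intro w hw hwz
      rcases eq_or_eq_xinv hwz with rfl | rfl
      · exact hl w (by simp [hw]) (by simp)
      · exact hna hw
    · obtain ⟨u1, y, v, u2, rfl, hv⟩ := ih hl
      exact ⟨z :: u1, y, v, u2, rfl, hv⟩

theorem box_diam {u u' : List (Ltr n)} {ρ : ℤ} (hu : nsq (disp u) ≤ ρ)
    (h : ∀ (e : Ltr n) r, r <+: u' → lev e (disp r) ≤ max 0 (lev e (disp u))) : Diam ρ u' := by
  intro r s hr hs
  refine le_trans (nsq_le fun i => ?_) hu
  have h1 := h (i, true) r hr
  have h2 := h (i, false) r hr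
  have h3 := h (i, true) s hs
  have h4 := h (i, false) s hs
  simp only [lev] at *
  simp at h1 h2 h3 h4
  rw [Pi.sub_apply, ← Int.natCast_natAbs, ← Int.natCast_natAbs]
  omega

theorem prefix_append_cases {α : Type*} {r a b : List α} (h : r <+: a ++ b) :
    r <+: a ∨ ∃ r1, r = a ++ r1 ∧ r1 <+: b := by
  rcases List.prefix_or_prefix_of_prefix h (List.prefix_append a b) with h1 | h1
  · exact Or.inl h1
  · obtain ⟨r1, rfl⟩ := h1
    exact Or.inr ⟨r1, rfl, (List.prefix_append_right_inj a).1 h⟩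

theorem exists_shorter {ρ : ℤ} (u : List (Ltr n)) (hu : ¬ Geo u) (hd : Diam ρ u) :
    ∃ e u', Push e false u u' ∧ u'.length < u.length ∧ Diam ρ u' := by
  by_cases hbox : ∀ (e : Ltr n) r, r <+: u → lev e (disp r) ≤ max 0 (lev e (disp u))
  · obtain ⟨u1, y, v, u2, rfl, hv⟩ := exists_pair u hu
    refine ⟨y, u1 ++ (v ++ u2), ?_, by simp, ?_⟩
    · exact (Push.up _ _ ((Push.down _ _ (Push.refl y u2)).keeps v)).keeps u1
    · refine box_diam hd.disp_le ?_
      intro e r hr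
      rcases prefix_append_cases hr with hr | ⟨r1, rfl, hr'⟩
      · exact hbox e r (hr.trans (List.prefix_append _ _))
      · rcases prefix_append_cases hr' with hr | ⟨r2, rfl, hr2⟩
        · have h0 : lev e (disp r1) = 0 ∨ e.1 ≠ y.1 := by
            by_cases he : e.1 = y.1
            · left
              have : ∀ l : List (Ltr n), l ⊆ v → lev e (disp l) = 0 := by
                intro l
                induction l with
                | nil => simp
                | cons w l ih =>
                  intro hl
                  rw [List.cons_subset] at hl
                  rw [disp_cons, lev_add, ih hl.2, add_zero]
                  simp only [lev]
                  rw [vec_apply_of_ne, zero_mul]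
                  rw [he]; exact hv w hl.1
              exact this r1 hr.subset
            · right; exact he
          rcases h0 with h0 | h0
          · have := hbox e u1 (List.prefix_append _ _)
            rw [disp_append, lev_add, h0, add_zero]; exact this
          · have := hbox e (u1 ++ y :: r1) (by
              rw [List.prefix_append_right_inj, List.cons_prefix_cons]
              exact ⟨rfl, hr.trans (List.prefix_append _ _)⟩)
            have h1 : lev e (vec y) = 0 := by
              simp only [lev]; rw [vec_apply_of_ne (Ne.symm h0), zero_mul]
            rw [disp_append, disp_cons, lev_add, lev_add, h1, zero_add] at this
            rw [disp_append, lev_add]; exact this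
        · have := hbox e (u1 ++ y :: (v ++ xinv y :: r2)) (by
            rw [List.prefix_append_right_inj, List.cons_prefix_cons, List.prefix_append_right_inj,
              List.cons_prefix_cons]
            exact ⟨rfl, rfl, hr2⟩)
          have e2 : disp (u1 ++ (v ++ r2)) = disp (u1 ++ y :: (v ++ xinv y :: r2)) := by
            simp; abel
          rw [e2]; exact this
  · push Not at hbox
    obtain ⟨e, r0, hr0, hlt⟩ := hbox
    obtain ⟨rm, hrm, hmax⟩ := (u.inits.toFinset).exists_max_image (fun r => lev e (disp r))
      ⟨r0, by simpa using hr0⟩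
    simp only [List.mem_toFinset, List.mem_inits] at hrm hmax
    have h0 := hmax r0 hr0
    set m := lev e (disp rm) with hm
    have hm0 : 0 < m := lt_of_le_of_lt (le_max_left _ _) (hlt.trans_le h0)
    have hmu : lev e (disp u) < m := lt_of_le_of_lt (le_max_right _ _) (hlt.trans_le h0)
    obtain ⟨u', hP, hpre, hlen, hl⟩ := clip e m u 0 (by simpa using hmax) (by simpa using hmu)
    have hf : lev e 0 ≠ m := by rw [lev_zero]; omega
    refine ⟨e, u', ?_, hl ⟨rm, hrm, by simp [hm]⟩, ?_⟩
    · simpa only [hf, decide_false] using hP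
    · have hk0 : kap e m 0 = 0 := by rw [kap, if_neg hf]
      intro r s hr hs
      obtain ⟨r', hr', e1⟩ := hpre r hr
      obtain ⟨s', hs', e2⟩ := hpre s hs
      rw [hk0, zero_add, zero_add] at e1 e2
      rw [e1, e2]
      exact (nsq_kap_le e m (hmax _ hr') (hmax _ hs')).trans (hd _ _ hr' hs')

variable {E : Type*} [Group E] {t : Ltr n → E} {A B : Set E} {a b : Ltr n → Ltr n → E}

theorem Cfg.all_of_geo (h : Cfg t A B a b) (ρ : ℤ)
    (H : ∀ u, Geo u → nsq (disp u) ≤ ρ →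
      (∀ v, v.length < u.length → Diam ρ v → CC A B (ev t v)) → CC A B (ev t u)) :
    ∀ u, Diam ρ u → CC A B (ev t u) := by
  have key : ∀ N : ℕ, ∀ u : List (Ltr n), u.length = N → Diam ρ u → CC A B (ev t u) := by
    intro N
    induction N using Nat.strong_induction_on with
    | _ N ih =>
      intro u hN hd
      have ih' : ∀ v : List (Ltr n), v.length < u.length → Diam ρ v → CC A B (ev t v) :=
        fun v hv hdv => ih v.length (hN ▸ hv) v rfl hdv
      by_cases hg : Geo u
      · exact H u hg hd.disp_le ih'
      · obtain ⟨e, u', hP, hlen, hd'⟩ := exists_shorter u hg hd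
        have := h.push hP 1 (fun p hp _ => by
            rw [one_mul]
            exact ih' p (lt_of_le_of_lt hp.length_le hlen) (hd'.of_pre hp))
          (fun s hs hne => by
            refine ih' s ?_ (hd.suffix hs)
            refine lt_of_le_of_ne hs.length_le ?_
            intro hl
            rcases hne with hne | hne
            · exact hne (hs.eq_of_length hl)
            · exact absurd hne (by simp))
          (by rw [one_mul]; exact ih' u' hlen hd')
        simpa using this
  exact fun u hu => key _ u rfl hu

theorem Cfg.perm (h : Cfg t A B a b) (ρ : ℤ) (N : ℕ)
    (IH : ∀ v : List (Ltr n), v.length < N → Diam ρ v → CC A B (ev t v))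
    {l l' : List (Ltr n)} (hp : l.Perm l') : ∀ p : List (Ltr n), Geo (p ++ l) →
      nsq (disp (p ++ l)) ≤ ρ → (p ++ l).length ≤ N → CC A B (ev t (p ++ l)) →
      CC A B (ev t (p ++ l')) := by
  induction hp with
  | nil => intro p _ _ _ h; exact h
  | @cons x l l' hp ih =>
    intro p h1 h2 h3 h4
    have := ih (p ++ [x]) (by simpa using h1) (by simpa using h2) (by simpa using h3)
      (by simpa [mul_assoc] using h4)
    simpa [mul_assoc] using this
  | swap x y l =>
    intro p h1 h2 h3 h4
    have hd := h1.diam.mono h2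
    have c1 : CC A B (ev t p) := IH p (by simp at h3; omega) (hd.of_pre (List.prefix_append _ _))
    have c2 : CC A B (ev t (x :: l)) := IH _ (by simp at h3 ⊢; omega)
      (hd.suffix ((List.suffix_cons _ _).trans (List.suffix_append _ _)))
    have := (h.swap_letters y x c1 (k := ev t l) (by simpa using c2)).1 (by simpa using h4)
    simpa using this
  | trans hp1 hp2 ih1 ih2 =>
    intro p h1 h2 h3 h4
    have hp1' := hp1.append_left p
    refine ih2 p (h1.perm hp1') ?_ ?_ (ih1 p h1 h2 h3 h4)
    · rw [← disp_perm hp1']; exact h2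
    · rw [← hp1'.length_eq]; exact h3

end reduce
end FPF

end partC

section partD

namespace FPF

section step
variable {n : ℕ}

/-- real inner product of a direction with an integer vector -/
noncomputable def dot (θ : Fin n → ℝ) (p : Fin n → ℤ) : ℝ := ∑ i, θ i * (p i : ℝ)

@[simp] theorem dot_zero (θ : Fin n → ℝ) : dot θ 0 = 0 := by simp [dot]
@[simp] theorem dot_add (θ : Fin n → ℝ) (p q : Fin n → ℤ) : dot θ (p + q) = dot θ p + dot θ q := by
  simp [dot, mul_add, Finset.sum_add_distrib]
@[simp] theorem dot_neg (θ : Fin n → ℝ) (p : Fin n → ℤ) : dot θ (-p) = - dot θ p := by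
  simp [dot]
@[simp] theorem dot_sub (θ : Fin n → ℝ) (p q : Fin n → ℤ) : dot θ (p - q) = dot θ p - dot θ q := by
  simp [dot, mul_sub]
@[simp] theorem neg_dot (θ : Fin n → ℝ) (p : Fin n → ℤ) : dot (-θ) p = - dot θ p := by
  simp [dot]

theorem dot_vec (θ : Fin n → ℝ) (x : Ltr n) : dot θ (vec x) = θ x.1 * (vec x x.1 : ℝ) := by
  rw [dot, Finset.sum_eq_single x.1]
  · intro i _ hi
    rw [vec_apply_of_ne hi.symm]; simp
  · simp

theorem abs_disp_le_length (u : List (Ltr n)) (i : Fin n) : |disp u i| ≤ u.length := by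
  refine (abs_disp_le u i).trans ?_
  exact_mod_cast List.countP_le_length

theorem geo_of_pos (q : Fin n → ℤ) {u : List (Ltr n)} (h : ∀ x ∈ u, 0 < vec x x.1 * q x.1) :
    Geo u := by
  intro x hx hx'
  have h1 := h x hx
  have h2 := h _ hx'
  simp at h2
  linarith

theorem exists_geo (p : Fin n → ℤ) : ∃ u : List (Ltr n), disp u = p ∧
    ∀ x ∈ u, 0 < vec x x.1 * p x.1 := by
  have key : ∀ s : Finset (Fin n), ∃ u : List (Ltr n), disp u = (fun i => if i ∈ s then p i else 0) ∧
      ∀ x ∈ u, 0 < vec x x.1 * p x.1 := by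
    intro s
    induction s using Finset.induction_on with
    | empty => exact ⟨[], by ext; simp, by simp⟩
    | insert i s hi ih =>
      obtain ⟨u, h1, h2⟩ := ih
      refine ⟨List.replicate (p i).natAbs (i, decide (0 < p i)) ++ u, ?_, ?_⟩
      · rw [disp_append, h1]
        ext j
        have : disp (List.replicate (p i).natAbs ((i, decide (0 < p i)) : Ltr n)) = Pi.single i (p i) := by
          simp only [disp, List.map_replicate, List.sum_replicate, vec]
          rw [← Pi.single_smul]
          congr 1
          by_cases h : 0 < p i
          · simp [h]; omega
          · simp [h]; rw [abs_of_nonpos (by omega)]; ring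
        rw [this]
        by_cases hj : j = i
        · subst hj; simp [hi]
        · simp [hj]
      · intro x hx
        rw [List.mem_append] at hx
        rcases hx with hx | hx
        · rw [List.mem_replicate] at hx
          obtain ⟨h0, rfl⟩ := hx
          by_cases h : 0 < p i
          · simp [h, vec]
          · simp [h, vec]; omega
        · exact h2 x hx
  obtain ⟨u, h1, h2⟩ := key Finset.univ
  exact ⟨u, by simpa using h1, h2⟩

theorem Geo.length_le {u : List (Ltr n)} (h : Geo u) : (u.length : ℤ) ≤ nsq (disp u) := by
  have key : ∀ u : List (Ltr n), (u.length : ℤ) = ∑ i, (u.countP (fun x => x.1 = i) : ℤ) := by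
    intro u
    induction u with
    | nil => simp
    | cons x u ih =>
      simp only [List.length_cons, List.countP_cons, Nat.cast_add, Finset.sum_add_distrib, ih]
      simp
  rw [key, nsq]
  apply Finset.sum_le_sum
  intro i _
  rw [← h.abs_disp, ← sq_abs]
  have : 0 ≤ |disp u i| := abs_nonneg _
  nlinarith

theorem exists_diam (u : List (Ltr n)) : ∃ k : ℕ, Diam k u := by
  refine ⟨n * (2 * u.length) ^ 2, ?_⟩
  intro r s hr hs
  have : ∀ i, ((disp r - disp s) i) ^ 2 ≤ ((2 * u.length) ^ 2 : ℤ) := by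
    intro i
    rw [sq_le_sq]
    have h1 := abs_disp_le_length r i
    have h2 := abs_disp_le_length s i
    have h3 := hr.length_le
    have h4 := hs.length_le
    have h5 := abs_sub (disp r i) (disp s i)
    rw [Pi.sub_apply, abs_of_nonneg (by positivity : (0:ℤ) ≤ 2 * u.length)]
    linarith [(by exact_mod_cast h3 : (r.length : ℤ) ≤ u.length), (by exact_mod_cast h4 : (s.length : ℤ) ≤ u.length)]
  refine (Finset.sum_le_sum fun i _ => this i).trans ?_
  simp

variable {E : Type*} [Group E] {t : Ltr n → E} {A B : Set E} {a b : Ltr n → Ltr n → E}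

def Tame (t : Ltr n → E) (A : Set E) (K : ℕ) (θ : Fin n → ℝ) : Prop :=
  ∃ w1 : List (Ltr n), (∀ x ∈ w1, 0 < dot θ (vec x)) ∧ (∀ i, |(disp w1 i : ℝ)| ≤ K * |θ i|) ∧
    ∀ α ∈ A, ev t w1 * α * (ev t w1)⁻¹ ∈ Subgroup.closure
      {g | ∃ α' ∈ A, ∃ v : List (Ltr n), v.length ≤ K ∧
        (∀ z, z <+: v → 1 ≤ dot θ (disp w1 - disp z)) ∧ g = ev t v * α' * (ev t v)⁻¹}

def rho0 (n K : ℕ) : ℕ := (5 * n * K ^ 2 + K + 1) ^ 2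

theorem between_sq {p q z : ℤ} (h1 : |p| ≤ |q|) (h2 : |q - p| ≤ |q|) :
    (p + z) ^ 2 ≤ z ^ 2 + (q + z) ^ 2 := by
  have h : |p + z| ≤ |z| ∨ |p + z| ≤ |q + z| := by
    simp only [← Int.natCast_natAbs] at *
    omega
  rcases h with h | h
  · have := sq_le_sq.2 h; nlinarith [sq_nonneg (q + z)]
  · have := sq_le_sq.2 h; nlinarith [sq_nonneg z]

theorem Cfg.step (h : Cfg t A B a b) (K : ℕ) (ρ : ℕ) (hρ : rho0 n K ≤ ρ) (u : List (Ltr n))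
    (hu : Geo u) (hq : nsq (disp u) = ρ) (θ : Fin n → ℝ)
    (hθ : ∀ i, (disp u i : ℝ) = Real.sqrt ρ * θ i)
    (IH : ∀ v : List (Ltr n), Diam ((ρ : ℤ) - 1) v → CC A B (ev t v))
    (IHl : ∀ v : List (Ltr n), v.length < u.length → Diam ρ v → CC A B (ev t v))
    (hT : Tame t A K θ) : CC A B (ev t u) := by
  obtain ⟨w1, hpos, hK, hmem⟩ := hT
  set R := Real.sqrt ρ with hR
  have hRR : R ^ 2 = ρ := Real.sq_sqrt (by positivity)
  have hR0 : (5 * n * K ^ 2 + K + 1 : ℝ) ≤ R := by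
    apply Real.le_sqrt_of_sq_le
    exact_mod_cast hρ
  have hnK : (0:ℝ) ≤ 5 * n * K ^ 2 := by positivity
  have hK0 : (0:ℝ) ≤ K := by positivity
  have hRpos : 0 < R := by linarith
  set q := disp u with hqdef
  set d := disp w1 with hd
  -- letters of `w1` point towards `q`
  have hw1 : ∀ x ∈ w1, 0 < vec x x.1 * q x.1 := by
    intro x hx
    have h1 := hpos x hx
    rw [dot_vec] at h1
    have h2 : (0:ℝ) < (vec x x.1 : ℝ) * (q x.1 : ℝ) := by
      rw [hθ]
      have := mul_pos hRpos h1
      linarith [this, mul_comm (vec x x.1 : ℝ) (R * θ x.1), mul_assoc R (θ x.1) (vec x x.1 : ℝ)]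
    exact_mod_cast h2
  have hg1 : Geo w1 := geo_of_pos q hw1
  have hdq : ∀ i, |d i| ≤ |q i| := by
    intro i
    have h1 := hK i
    have h2 : |(q i : ℝ)| = R * |θ i| := by rw [hθ, abs_mul, abs_of_pos hRpos]
    have h3 : |(d i : ℝ)| ≤ |(q i : ℝ)| := by
      rw [h2]; refine h1.trans ?_
      exact mul_le_mul_of_nonneg_right (by linarith) (abs_nonneg _)
    exact_mod_cast h3
  have hθ1 : ∀ i, |θ i| ≤ 1 := by
    intro i
    have h1 : q i ^ 2 ≤ (ρ : ℤ) := by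
      rw [← hq]
      exact Finset.single_le_sum (f := fun i => q i ^ 2) (fun i _ => sq_nonneg _) (Finset.mem_univ i)
    have h2 : (q i : ℝ) ^ 2 ≤ R ^ 2 := by rw [hRR]; exact_mod_cast h1
    rw [hθ, mul_pow] at h2
    rw [← sq_le_one_iff_abs_le_one]
    exact le_of_mul_le_mul_left (by linarith) (by positivity : 0 < R ^ 2)
  have hdK : ∀ i, |d i| ≤ K := by
    intro i
    have h1 := (hK i).trans (mul_le_mul_of_nonneg_left (hθ1 i) hK0)
    rw [mul_one] at h1
    exact_mod_cast h1
  have hdpos : ∀ i, 0 ≤ d i * q i := by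
    intro i
    by_cases hx : ∃ x ∈ w1, x.1 = i
    · obtain ⟨x, hx, rfl⟩ := hx
      rw [hd, hg1.disp_eq x hx]
      have := hw1 x hx
      have h0 : (0:ℤ) ≤ (w1.countP (fun z => z.1 = x.1) : ℕ) := by positivity
      nlinarith [mul_nonneg this.le h0]
    · push Not at hx
      have h0 := hg1.abs_disp i
      have : w1.countP (fun x => x.1 = i) = 0 := by
        rw [List.countP_eq_zero]; simpa using hx
      rw [this] at h0
      have : d i = 0 := by simpa using h0
      rw [this]; simp
  obtain ⟨w0, hw0, hw0p⟩ := exists_geo (q - d)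
  have hw0q : ∀ x ∈ w0, 0 < vec x x.1 * q x.1 := by
    intro x hx
    have h1 := hw0p x hx
    have h2 := hdq x.1
    have h3 := hdpos x.1
    rw [Pi.sub_apply] at h1
    have hv : vec x x.1 = 1 ∨ vec x x.1 = -1 := by
      rcases x with ⟨j, b⟩
      cases b <;> simp [vec]
    rcases hv with hv | hv <;> rw [hv] at h1 ⊢
    · by_contra hc
      have : q x.1 ≤ 0 := by linarith
      rw [abs_of_nonpos this] at h2
      have := neg_abs_le (d x.1)
      linarith
    · by_contra hc
      have : 0 ≤ q x.1 := by linarith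
      rw [abs_of_nonneg this] at h2
      have := le_abs_self (d x.1)
      linarith
  have hg0 : Geo w0 := geo_of_pos q hw0q
  have hg : Geo (w0 ++ w1) := by
    apply geo_of_pos q
    intro x hx
    rcases List.mem_append.1 hx with hx | hx
    · exact hw0q x hx
    · exact hw1 x hx
  have hdisp : disp (w0 ++ w1) = q := by rw [disp_append, hw0]; simp [hd]
  have hperm := hg.perm_of_disp hu hdisp
  have main : CC A B (ev t (w0 ++ w1)) := by
    intro α hα β hβ
    have h1 := hmem α hα
    have h2 : Subgroup.closure
      {g | ∃ α' ∈ A, ∃ v : List (Ltr n), v.length ≤ K ∧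
        (∀ z, z <+: v → 1 ≤ dot θ (disp w1 - disp z)) ∧ g = ev t v * α' * (ev t v)⁻¹} ≤
        (Subgroup.centralizer {β}).comap (MulAut.conj (ev t w0)).toMonoidHom := by
      rw [Subgroup.closure_le]
      rintro g ⟨α', hα', v, hvK, hvz, rfl⟩
      have hz : ∀ z, z <+: v → ∀ i, |disp z i| ≤ K := by
        intro z hzv i
        refine (abs_disp_le_length z i).trans ?_
        exact_mod_cast hzv.length_le.trans hvK
      -- key estimate
      have est : ∀ p', (∀ i, |p' i| ≤ |(q - d) i|) → (∀ i, |(q - d) i - p' i| ≤ |(q - d) i|) →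
          ∀ z, z <+: v → nsq (p' + disp z) ≤ (ρ : ℤ) - 1 := by
        intro p' hp1 hp2 z hzv
        have hco : ∀ i, (p' i + disp z i) ^ 2 ≤ q i ^ 2 - 2 * (q i * (d i - disp z i)) + 5 * K ^ 2 := by
          intro i
          have h1 := between_sq (z := disp z i) (hp1 i) (hp2 i)
          have h2 := hz z hzv i
          have h3 : (disp z i) ^ 2 ≤ (K : ℤ) ^ 2 := by
            rw [← sq_abs]; exact pow_le_pow_left₀ (abs_nonneg _) h2 2
          have h4 : (d i - disp z i) ^ 2 ≤ (2 * K : ℤ) ^ 2 := by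
            rw [← sq_abs]; refine pow_le_pow_left₀ (abs_nonneg _) ?_ 2
            have := abs_sub (d i) (disp z i)
            linarith [hdK i]
          rw [Pi.sub_apply] at h1
          nlinarith
        have hs : nsq (p' + disp z) ≤ ρ - 2 * (∑ i, q i * (d i - disp z i)) + n * (5 * K ^ 2) := by
          rw [← hq]
          refine (Finset.sum_le_sum fun i _ => hco i).trans (le_of_eq ?_)
          rw [Finset.sum_add_distrib, Finset.sum_sub_distrib, ← Finset.mul_sum]
          simp [nsq]
        have hdot : (((∑ i, q i * (d i - disp z i)) : ℤ) : ℝ) = R * dot θ (d - disp z) := by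
          rw [dot, Finset.mul_sum]
          push_cast
          refine Finset.sum_congr rfl fun i _ => ?_
          rw [hθ, Pi.sub_apply]; push_cast; ring
        have h1 := hvz z hzv
        have h2 : R ≤ ((∑ i, q i * (d i - disp z i) : ℤ) : ℝ) := by
          rw [hdot]; nlinarith
        have h3 : (5 * n * K ^ 2 + K + 1 : ℤ) ≤ ∑ i, q i * (d i - disp z i) := by
          exact_mod_cast hR0.trans h2
        have : (0:ℤ) ≤ K := by positivity
        have h5 : (0:ℤ) ≤ n * K ^ 2 := by positivity
        nlinarith
      have hDiam : Diam ((ρ : ℤ) - 1) (w0 ++ v) := by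
        have box : ∀ r, r <+: w0 → (∀ i, |(q - d) i - disp r i| ≤ |(q - d) i|) ∧
            (∀ i, |disp r i| ≤ |(q - d) i|) := by
          intro r hr
          constructor
          · obtain ⟨r', hr'⟩ := hr
            intro i
            have := hg0.abs_disp_le_of_infix (v := r') (by rw [← hr']; exact (List.suffix_append _ _).sublist) i
            rw [hw0] at this
            have e : (q - d) i - disp r i = disp r' i := by
              rw [← hw0, ← hr']; simp
            rw [e]; exact this
          · intro i
            have := hg0.abs_disp_le_of_infix hr.sublist i
            rwa [hw0] at this
        have hmix : ∀ r, r <+: w0 → ∀ z, z <+: v → nsq (disp (w0 ++ z) - disp r) ≤ (ρ : ℤ) - 1 := by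
          intro r hr z hzv
          have := est (q - d - disp r) (box r hr).1 (fun i => by simpa using (box r hr).2 i) z hzv
          have e : disp (w0 ++ z) - disp r = q - d - disp r + disp z := by
            rw [disp_append, hw0]; abel
          rwa [e]
        have hcase : ∀ r, r <+: w0 ++ v → r <+: w0 ∨ ∃ z, r = w0 ++ z ∧ z <+: v :=
          fun r hr => prefix_append_cases hr
        intro r s hr hs
        rcases hcase r hr with hr | ⟨z, rfl, hzr⟩
        · rcases hcase s hs with hs | ⟨z, rfl, hzs⟩
          · have h1 := (hg0.diam r s hr hs)
            have h2 := hmix [] List.nil_prefix [] List.nil_prefix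
            simp at h2
            linarith
          · rw [← nsq_neg, neg_sub]; exact hmix r hr z hzs
        · rcases hcase s hs with hs | ⟨z', rfl, hzs⟩
          · exact hmix s hs z hzr
          · have e : disp (w0 ++ z) - disp (w0 ++ z') = disp z - disp z' := by simp
            rw [e]
            have h1 : nsq (disp z - disp z') ≤ ∑ i : Fin n, (2 * K : ℤ) ^ 2 := by
              apply Finset.sum_le_sum
              intro i _
              rw [← sq_abs]; refine pow_le_pow_left₀ (abs_nonneg _) ?_ 2
              have := abs_sub (disp z i) (disp z' i)
              rw [Pi.sub_apply]
              linarith [hz z hzr i, hz z' hzs i]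
            simp at h1
            have h2 : ((5 * n * K ^ 2 + K + 1) ^ 2 : ℤ) ≤ ρ := by exact_mod_cast hρ
            have : (0:ℤ) ≤ K := by positivity
            have h5 : (0:ℤ) ≤ n * K ^ 2 := by positivity
            nlinarith
      have := IH _ hDiam α' hα' β hβ
      rw [SetLike.mem_coe, Subgroup.mem_comap, Subgroup.mem_centralizer_iff]
      intro b hb
      rw [Set.mem_singleton_iff] at hb
      subst hb
      have h3 := this.eq.symm
      simp only [ev_append] at h3
      simpa [MulAut.conj_apply, mul_assoc] using h3
    have h3 := h2 h1
    rw [Subgroup.mem_comap, Subgroup.mem_centralizer_iff] at h3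
    have h4 := h3 β rfl
    show _ = _
    simpa [MulAut.conj_apply, mul_assoc] using h4.symm
  have := h.perm ρ u.length IHl hperm [] (by simpa using hg)
    (by rw [List.nil_append, hdisp, hq]) (by rw [List.nil_append, hperm.length_eq]) main
  simpa using this

theorem Cfg.all (h : Cfg t A B a b) (K : ℕ)
    (hT : ∀ θ : Fin n → ℝ, ∑ i, θ i ^ 2 = 1 → Tame t A K θ ∨ Tame t B K (-θ))
    (hbase : ∀ u : List (Ltr n), u.length ≤ rho0 n K → CC A B (ev t u)) :
    ∀ u, CC A B (ev t u) := by
  have key : ∀ k : ℕ, ∀ u : List (Ltr n), Diam k u → CC A B (ev t u) := by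
    intro k
    induction k with
    | zero =>
      apply h.all_of_geo
      intro u hg hd _
      apply hbase
      have := hg.length_le
      have : (u.length : ℤ) ≤ 0 := this.trans hd
      have : u.length = 0 := by exact_mod_cast le_antisymm this (by positivity)
      omega
    | succ k ih =>
      apply h.all_of_geo
      intro u hg hd IHl
      by_cases hs : nsq (disp u) < rho0 n K
      · apply hbase
        have := hg.length_le.trans hs.le
        exact_mod_cast this
      by_cases hk : nsq (disp u) ≤ k
      · exact ih u (hg.diam.mono hk)
      have hnk : nsq (disp u) = ((k + 1 : ℕ) : ℤ) := by push_cast at hd ⊢; omega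
      have hr : rho0 n K ≤ k + 1 := by
        rw [hnk] at hs; push Not at hs; exact_mod_cast hs
      have hRpos : 0 < Real.sqrt ((k + 1 : ℕ) : ℝ) := Real.sqrt_pos.2 (by positivity)
      set R := Real.sqrt ((k + 1 : ℕ) : ℝ) with hR
      have hRR : R ^ 2 = ((k + 1 : ℕ) : ℝ) := Real.sq_sqrt (by positivity)
      set θ : Fin n → ℝ := fun i => (disp u i : ℝ) / R with hθ
      have hθ' : ∀ i, (disp u i : ℝ) = R * θ i := by
        intro i; rw [hθ]; field_simp
      have hun : ∑ i, θ i ^ 2 = 1 := by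
        have : ∑ i, θ i ^ 2 = (nsq (disp u) : ℝ) / R ^ 2 := by
          rw [nsq]; push_cast; rw [Finset.sum_div]
          exact Finset.sum_congr rfl fun i _ => by rw [hθ]; simp [div_pow]
        rw [this, hnk, hRR]; push_cast
        exact div_self (by positivity)
      have ih' : ∀ v : List (Ltr n), Diam (((k + 1 : ℕ) : ℤ) - 1) v → CC A B (ev t v) := by
        intro v hv; apply ih; simpa using hv
      rcases hT θ hun with hA | hB
      · exact h.step K (k+1) hr u hg hnk θ hθ' ih' IHl hA
      · have hw : Geo (winv u) := by
          intro x hx hx'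
          simp only [winv, List.mem_reverse, List.mem_map] at hx hx'
          obtain ⟨y, hy, rfl⟩ := hx
          obtain ⟨z, hz, hzy⟩ := hx'
          rw [xinv_xinv] at hzy
          subst hzy
          exact hg z hz hy
        have := h.swap.step K (k+1) hr (winv u) hw (by rw [disp_winv, nsq_neg]; exact hnk) (-θ)
          (by
            intro i
            rw [disp_winv, Pi.neg_apply, Pi.neg_apply, Int.cast_neg, hθ', mul_neg])
          (fun v hv => by
            have := (ih' (winv v) hv.winv).symm
            rwa [ev_winv t h.tinv, inv_inv] at this)
          (fun v hv hv' => by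
            have := (IHl (winv v) (by simpa using hv) hv'.winv).symm
            rwa [ev_winv t h.tinv, inv_inv] at this) hB
        have := this.symm
        rwa [ev_winv t h.tinv, inv_inv] at this
  intro u
  obtain ⟨k, hk⟩ := exists_diam u
  exact key k u hk

end step
end FPF

end partD

section partE

namespace FPF

section loops
variable {n : ℕ} {G : Type*} [Group G]

/-- letters from a family of elements -/
def lt (g : Fin n → G) (x : Ltr n) : G := if x.2 then g x.1 else (g x.1)⁻¹

theorem lt_xinv (g : Fin n → G) (x : Ltr n) : lt g (xinv x) = (lt g x)⁻¹ := by
  rcases x with ⟨i, b⟩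
  cases b <;> simp [lt, xinv]

theorem map_lt {G' : Type*} [Group G'] (f : G →* G') (g : Fin n → G) (x : Ltr n) :
    f (lt g x) = lt (fun i => f (g i)) x := by
  unfold lt; split_ifs <;> simp

/-- commutator of two letters -/
def cm (t : Ltr n → G) (x y : Ltr n) : G := t x * t y * (t x)⁻¹ * (t y)⁻¹

/-- The word `v` stays in the half space `θ ≤ c`. -/
def InHalf (θ : Fin n → ℝ) (c : ℝ) (v : List (Ltr n)) : Prop :=
  ∀ z, z <+: v → dot θ (disp z) ≤ c

def Lsub (t : Ltr n → G) (S : Set G) (θ : Fin n → ℝ) (c : ℝ) : Subgroup G :=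
  Subgroup.closure {g | ∃ s ∈ S, ∃ v, InHalf θ c v ∧ g = ev t v * s * (ev t v)⁻¹}

theorem InHalf.mono {θ : Fin n → ℝ} {c c' : ℝ} {v : List (Ltr n)} (h : InHalf θ c v) (hc : c ≤ c') :
    InHalf θ c' v := fun z hz => (h z hz).trans hc

theorem InHalf.of_pre {θ : Fin n → ℝ} {c : ℝ} {v w : List (Ltr n)} (h : InHalf θ c v)
    (hw : w <+: v) : InHalf θ c w := fun z hz => h z (hz.trans hw)

theorem InHalf.concat {θ : Fin n → ℝ} {c : ℝ} {v : List (Ltr n)} (h : InHalf θ c v) {x : Ltr n}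
    (hx : dot θ (disp (v ++ [x])) ≤ c) : InHalf θ c (v ++ [x]) := by
  intro z hz
  rcases prefix_append_cases hz with h1 | ⟨r, rfl, h1⟩
  · exact h z h1
  · cases r with
    | nil => simpa using h v List.prefix_rfl
    | cons y r =>
      rw [List.cons_prefix_cons, List.prefix_nil] at h1
      obtain ⟨rfl, rfl⟩ := h1
      exact hx

theorem InHalf.append {θ : Fin n → ℝ} {c : ℝ} {v w : List (Ltr n)} (h : InHalf θ c v)
    (hw : ∀ z, z <+: w → dot θ (disp v + disp z) ≤ c) : InHalf θ c (v ++ w) := by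
  intro z hz
  rcases prefix_append_cases hz with h1 | ⟨r, rfl, h1⟩
  · exact h z h1
  · simpa using hw r h1

theorem Lsub_mono (t : Ltr n → G) (S : Set G) (θ : Fin n → ℝ) {c c' : ℝ} (hc : c ≤ c') :
    Lsub t S θ c ≤ Lsub t S θ c' := by
  apply Subgroup.closure_mono
  rintro g ⟨s, hs, v, hv, rfl⟩
  exact ⟨s, hs, v, hv.mono hc, rfl⟩

theorem mem_Lsub {t : Ltr n → G} {S : Set G} {θ : Fin n → ℝ} {c : ℝ} {s : G} (hs : s ∈ S)
    {v : List (Ltr n)} (hv : InHalf θ c v) : ev t v * s * (ev t v)⁻¹ ∈ Lsub t S θ c :=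
  Subgroup.subset_closure ⟨s, hs, v, hv, rfl⟩

variable {t : Ltr n → G} {S : Set G} {θ : Fin n → ℝ} {c : ℝ}

theorem swap_mem (hS : ∀ x y, cm t x y ∈ S) {p : List (Ltr n)} (hp : InHalf θ c p) (x y : Ltr n)
    (q : List (Ltr n)) :
    ev t (p ++ x :: y :: q) * (ev t (p ++ y :: x :: q))⁻¹ ∈ Lsub t S θ c := by
  have := mem_Lsub (t := t) (hS x y) hp
  convert this using 1
  simp only [ev_append, ev_cons, cm]
  group

theorem trans_mem {L : Subgroup G} {a b d : G} (h1 : a * b⁻¹ ∈ L) (h2 : b * d⁻¹ ∈ L) :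
    a * d⁻¹ ∈ L := by
  have := L.mul_mem h1 h2
  simpa [mul_assoc] using this

theorem bubble_mem (hS : ∀ x y, cm t x y ∈ S) (x : Ltr n) : ∀ (D p q : List (Ltr n)),
    InHalf θ c p → (∀ d ∈ D, dot θ (vec d) ≤ 0) →
    ev t (p ++ x :: (D ++ q)) * (ev t (p ++ (D ++ x :: q)))⁻¹ ∈ Lsub t S θ c := by
  intro D
  induction D with
  | nil => intro p q _ _; rw [List.nil_append, List.nil_append, mul_inv_cancel]; exact one_mem _
  | cons d D ih =>
    intro p q hp hD
    have h1 := swap_mem hS hp x d (D ++ q)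
    have h2 := ih (p ++ [d]) q (hp.concat (by
      have := hp p List.prefix_rfl
      have := hD d (by simp)
      simp; linarith)) (fun e he => hD e (by simp [he]))
    simp only [List.append_assoc, List.singleton_append] at h2
    exact trans_mem h1 h2

theorem sort_mem (hS : ∀ x y, cm t x y ∈ S) (dn : Ltr n → Bool)
    (hdn : ∀ x, dn x = true → dot θ (vec x) ≤ 0) : ∀ (u p : List (Ltr n)),
    InHalf θ c (p ++ u) →
    ev t (p ++ u) * (ev t (p ++ (u.filter dn ++ u.filter (fun x => !dn x))))⁻¹ ∈ Lsub t S θ c := by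
  intro u
  induction u with
  | nil => intro p _; simp
  | cons x u ih =>
    intro p hp
    have h1 := ih (p ++ [x]) (by simpa using hp)
    simp only [List.append_assoc, List.singleton_append] at h1
    by_cases hx : dn x = true
    · simpa [List.filter_cons, hx] using h1
    · have h2 := bubble_mem (t := t) hS x (u.filter dn) p (u.filter (fun x => !dn x))
        (hp.of_pre (List.prefix_append _ _)) (fun d hd => hdn d (by simpa using (List.mem_filter.1 hd).2))
      have h3 := trans_mem h1 h2
      simpa [List.filter_cons, hx] using h3

theorem perm_mem (hS : ∀ x y, cm t x y ∈ S) {l l' : List (Ltr n)} (hl : l.Perm l') :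
    ∀ p : List (Ltr n), InHalf θ c p → (∀ x ∈ l, 0 ≤ dot θ (vec x)) → dot θ (disp (p ++ l)) ≤ c →
    ev t (p ++ l) * (ev t (p ++ l'))⁻¹ ∈ Lsub t S θ c := by
  have hnn : ∀ l : List (Ltr n), (∀ x ∈ l, 0 ≤ dot θ (vec x)) → 0 ≤ dot θ (disp l) := by
    intro l
    induction l with
    | nil => simp
    | cons x l ih =>
      intro h
      have := h x (by simp)
      have := ih (fun y hy => h y (by simp [hy]))
      simp; linarith
  induction hl with
  | nil => intro p _ _ _; simp
  | @cons x l l' hp ih =>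
    intro p h1 h2 h3
    have h4 := hnn l (fun y hy => h2 y (by simp [hy]))
    have := ih (p ++ [x]) (h1.concat (by simp at h3 ⊢; linarith)) (fun y hy => h2 y (by simp [hy]))
      (by simpa using h3)
    simpa only [List.append_assoc, List.singleton_append] using this
  | swap x y l => intro p h1 h2 h3; exact swap_mem hS h1 y x l
  | trans hp1 hp2 ih1 ih2 =>
    intro p h1 h2 h3
    refine trans_mem (ih1 p h1 h2 h3) (ih2 p h1 (fun x hx => h2 x (hp1.symm.subset hx)) ?_)
    rw [← disp_perm (hp1.append_left p)]; exact h3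

/-- closed words inside the half space are in `Lsub`. -/
theorem loop_mem (ht : ∀ x, t (xinv x) = (t x)⁻¹) (hS : ∀ x y, cm t x y ∈ S) (hc : 0 ≤ c)
    (u : List (Ltr n)) (hu : InHalf θ c u) (h0 : disp u = 0) : ev t u ∈ Lsub t S θ c := by
  classical
  set dn : Ltr n → Bool := fun x => decide (dot θ (vec x) < 0 ∨ (dot θ (vec x) = 0 ∧ x.2 = true)) with hdn
  have hd1 : ∀ x, dn x = true → dot θ (vec x) ≤ 0 := by
    intro x hx
    simp only [hdn, decide_eq_true_eq] at hx
    rcases hx with hx | hx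
    · exact hx.le
    · exact hx.1.le
  have hd2 : ∀ x, dn x = false → 0 ≤ dot θ (vec x) := by
    intro x hx
    simp only [hdn, decide_eq_false_iff_not, not_or, not_lt] at hx
    exact hx.1
  have hd3 : ∀ x, dn (xinv x) = !dn x := by
    intro x
    simp only [hdn, vec_xinv, dot_neg]
    rcases lt_trichotomy (dot θ (vec x)) 0 with h | h | h
    · have : ¬ (- dot θ (vec x) < 0) := by linarith
      have h2 : ¬ (- dot θ (vec x) = 0) := by linarith
      simp [h, this, h2]
    · rcases x with ⟨i, b⟩
      simp [h, xinv]
    · have h2 : ¬ (dot θ (vec x) = 0) := h.ne'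
      simp [h, h2, h.le]
  set D := u.filter dn with hD
  set U := u.filter (fun x => !dn x) with hU
  have hDm : ∀ x ∈ D, dn x = true := fun x hx => (List.mem_filter.1 hx).2
  have hUm : ∀ x ∈ U, dn x = false := fun x hx => by simpa using (List.mem_filter.1 hx).2
  have h1 := sort_mem (t := t) (c := c) hS dn hd1 u [] (by simpa using hu)
  simp only [List.nil_append] at h1
  have hdis : disp D + disp U = 0 := by
    rw [← disp_append, ← h0]
    exact disp_perm (List.filter_append_perm dn u)
  have hWm : ∀ x ∈ winv D, dn x = false := by
    intro x hx
    simp only [winv, List.mem_reverse, List.mem_map] at hx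
    obtain ⟨y, hy, rfl⟩ := hx
    rw [hd3, hDm y hy]; rfl
  have hgeo : ∀ l : List (Ltr n), (∀ x ∈ l, dn x = false) → Geo l := by
    intro l hl x hx hx'
    have h1 := hl x hx
    have h2 := hl _ hx'
    rw [hd3, h1] at h2
    simp at h2
  have hperm : U.Perm (winv D) := (hgeo _ hUm).perm_of_disp (hgeo _ hWm) (by
    rw [disp_winv]; exact (neg_eq_of_add_eq_zero_right hdis).symm)
  have hDin : InHalf θ c D := by
    have : ∀ l : List (Ltr n), (∀ x ∈ l, dn x = true) → dot θ (disp l) ≤ 0 := by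
      intro l
      induction l with
      | nil => simp
      | cons x l ih =>
        intro h
        have h1 := hd1 x (h x (by simp))
        have h2 := ih (fun y hy => h y (by simp [hy]))
        simp; linarith
    intro z hz
    exact (this z fun x hx => hDm x (hz.subset hx)).trans hc
  have h2 := perm_mem (t := t) hS hperm D hDin (fun x hx => hd2 x (hUm x hx)) (by
    rw [disp_append, hdis, dot_zero]; exact hc)
  have h3 := trans_mem h1 h2
  rw [ev_append, ev_winv t ht] at h3
  simpa using h3

/-- the size of a step -/
noncomputable def msz (θ : Fin n → ℝ) : ℝ := ∑ i, |θ i|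

theorem msz_nonneg (θ : Fin n → ℝ) : 0 ≤ msz θ := Finset.sum_nonneg fun _ _ => abs_nonneg _

theorem abs_dot_vec_le (θ : Fin n → ℝ) (x : Ltr n) : |dot θ (vec x)| ≤ msz θ := by
  rw [dot_vec, abs_mul]
  have : |((vec x x.1 : ℤ) : ℝ)| = 1 := by exact_mod_cast abs_vec_self x
  rw [this, mul_one]
  exact Finset.single_le_sum (f := fun i => |θ i|) (fun _ _ => abs_nonneg _) (Finset.mem_univ _)

theorem exists_order (θ : Fin n → ℝ) : ∀ (k : ℕ) (l : List (Ltr n)), l.length = k →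
    ∃ l' : List (Ltr n), disp l' = disp l ∧ l'.length = l.length ∧
      InHalf θ (max (msz θ) (dot θ (disp l))) l' ∧
      InHalf (-θ) (max (msz θ) (- dot θ (disp l))) l' := by
  intro k
  induction k with
  | zero =>
    intro l hl
    rw [List.length_eq_zero_iff] at hl
    subst hl
    refine ⟨[], rfl, rfl, ?_, ?_⟩ <;> intro z hz <;> rw [List.prefix_nil.1 hz] <;> simp [msz_nonneg]
  | succ k ih =>
    intro l hl
    have hex : ∃ x ∈ l, 0 ≤ dot θ (vec x) * dot θ (disp l) := by
      by_contra hcon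
      push Not at hcon
      have key : ∀ l' : List (Ltr n), l' ⊆ l →  l' ≠ [] → dot θ (disp l') * dot θ (disp l) < 0 := by
        intro l'
        induction l' with
        | nil => intro _ h; exact absurd rfl h
        | cons x l' ih =>
          intro hs _
          rw [List.cons_subset] at hs
          have h1 := hcon x hs.1
          rw [disp_cons, dot_add, add_mul]
          by_cases hl' : l' = []
          · subst hl'; simpa using h1
          · have := ih hs.2 hl'; linarith
      have := key l (List.Subset.refl _) (by rintro rfl; simp at hl)
      nlinarith [mul_self_nonneg (dot θ (disp l))]
    obtain ⟨x, hx, hx2⟩ := hex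
    have hp := List.perm_cons_erase hx
    have hd : disp l = vec x + disp (l.erase x) := by rw [disp_perm hp, disp_cons]
    have hlen : (l.erase x).length = k := by rw [List.length_erase_of_mem hx, hl]; rfl
    obtain ⟨l', h1, h2, h3, h4⟩ := ih (l.erase x) hlen
    have hM := abs_le.1 (abs_dot_vec_le θ x)
    have hdd : dot θ (disp l) = dot θ (vec x) + dot θ (disp (l.erase x)) := by rw [hd, dot_add]
    have hM0 := msz_nonneg θ
    have e1 : disp (l' ++ [x]) = disp l := by rw [disp_append, h1, hd]; simp; abel
    refine ⟨l' ++ [x], e1, by simp [h2, hlen, hl], ?_, ?_⟩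
    · refine InHalf.concat (h3.mono ?_) ?_
      · rcases lt_trichotomy (dot θ (disp l)) 0 with h | h | h
        · rw [max_eq_left (a := msz θ) (b := dot θ (disp l)) (by linarith)]
          have : dot θ (vec x) ≤ 0 := by nlinarith
          exact max_le le_rfl (by linarith)
        · rw [h, max_eq_left hM0]; exact max_le le_rfl (by linarith)
        · have : 0 ≤ dot θ (vec x) := by nlinarith
          exact max_le_max le_rfl (by linarith)
      · rw [e1]; exact le_max_right _ _
    · refine InHalf.concat (h4.mono ?_) ?_
      · rcases lt_trichotomy (dot θ (disp l)) 0 with h | h | h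
        · have : dot θ (vec x) ≤ 0 := by nlinarith
          exact max_le_max le_rfl (by linarith)
        · rw [h, neg_zero, max_eq_left hM0]; exact max_le le_rfl (by linarith)
        · have : 0 ≤ dot θ (vec x) := by nlinarith
          rw [max_eq_left (a := msz θ) (b := - dot θ (disp l)) (by linarith)]
          exact max_le le_rfl (by linarith)
      · rw [e1, neg_dot]; exact le_max_right _ _

theorem exists_path (θ : Fin n → ℝ) (q : Fin n → ℤ) : ∃ l : List (Ltr n), disp l = q ∧
      InHalf θ (max (msz θ) (dot θ q)) l ∧
      InHalf (-θ) (max (msz θ) (- dot θ q)) l ∧ (q = 0 → l = []) := by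
  obtain ⟨u, h1, h2⟩ := exists_geo q
  obtain ⟨l', e1, e2, e3, e4⟩ := exists_order θ _ u rfl
  refine ⟨l', by rw [e1, h1], by rwa [h1] at e3, by rwa [h1] at e4, ?_⟩
  rintro rfl
  have : u = [] := by
    rw [List.eq_nil_iff_forall_not_mem]
    intro x hx
    have := h2 x hx
    simp at this
  rw [this] at e2
  simpa using e2

end loops
end FPF

end partE

section partF

namespace FPF

section pingpong

theorem free_of_pingpong {P Ω : Type*} [Group P] [MulAction P Ω] (X : Bool → Set Ω)
    (hne : ∀ i, (X i).Nonempty) (hdisj : Disjoint (X true) (X false)) (k h h' : P)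
    (hk : ∀ w ∈ X false, k • w ∈ X true) (hk' : ∀ w ∈ X false, k⁻¹ • w ∈ X true)
    (h1 : ∀ w ∈ X true, h • w ∈ X false) (h2 : ∀ w ∈ X true, h⁻¹ • w ∈ X false)
    (h3 : ∀ w ∈ X true, h' • w ∈ X false) (h4 : ∀ w ∈ X true, h'⁻¹ • w ∈ X false)
    (h5 : ∀ w ∈ X true, (h' * h) • w ∈ X false) (h6 : ∀ w ∈ X true, (h' * h)⁻¹ • w ∈ X false) :
    ∃ f : FreeGroup (Fin 2) →* P, Function.Injective f := by
  -- powers of `h k h1`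
  set w := h * k * h' with hw
  have pos : ∀ m : ℕ, ∀ x ∈ X true, w ^ (m + 1) • x ∈ X false := by
    have aux : ∀ m : ℕ, ∀ x ∈ X true, (k * (h' * h)) ^ m • x ∈ X true := by
      intro m
      induction m with
      | zero => intro x hx; simpa using hx
      | succ m ih =>
        intro x hx
        rw [pow_succ', mul_smul, mul_smul]
        exact hk _ (h5 _ (ih x hx))
    intro m x hx
    have e : w ^ (m + 1) = h * (k * (h' * h)) ^ m * k * h' := by
      have : w = h * (k * (h' * h)) * h⁻¹ := by rw [hw]; group
      rw [this, conj_pow, pow_succ]; group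
    rw [e, mul_smul, mul_smul, mul_smul]
    exact h1 _ (aux m _ (hk _ (h3 _ hx)))
  have neg : ∀ m : ℕ, ∀ x ∈ X true, (w⁻¹) ^ (m + 1) • x ∈ X false := by
    have aux : ∀ m : ℕ, ∀ x ∈ X true, (k⁻¹ * (h' * h)⁻¹) ^ m • x ∈ X true := by
      intro m
      induction m with
      | zero => intro x hx; simpa using hx
      | succ m ih =>
        intro x hx
        rw [pow_succ', mul_smul, mul_smul]
        exact hk' _ (h6 _ (ih x hx))
    intro m x hx
    have e : (w⁻¹) ^ (m + 1) = h'⁻¹ * (k⁻¹ * (h' * h)⁻¹) ^ m * k⁻¹ * h⁻¹ := by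
      have : w⁻¹ = h'⁻¹ * (k⁻¹ * (h' * h)⁻¹) * h'⁻¹⁻¹ := by rw [hw]; group
      rw [this, conj_pow, pow_succ]; group
    rw [e, mul_smul, mul_smul, mul_smul]
    exact h4 _ (aux m _ (hk' _ (h2 _ hx)))
  have zp : ∀ m : ℤ, m ≠ 0 → ∀ x ∈ X true, w ^ m • x ∈ X false := by
    intro m hm x hx
    obtain ⟨a, rfl | rfl⟩ := m.eq_nat_or_neg
    · obtain ⟨b, rfl⟩ : ∃ b, a = b + 1 := ⟨a - 1, by omega⟩
      rw [zpow_natCast]; exact pos b x hx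
    · obtain ⟨b, rfl⟩ : ∃ b, a = b + 1 := ⟨a - 1, by omega⟩
      have := neg b x hx
      rw [zpow_neg, zpow_natCast, ← inv_pow]; exact this
  let g : Fin 2 → P := ![w, k * w * k⁻¹]
  let Y : Fin 2 → Set Ω := ![X false, X true]
  let f : ∀ i : Fin 2, FreeGroup Unit →* P := fun i => FreeGroup.lift fun _ => g i
  have hinj : Function.Injective (Monoid.CoprodI.lift f) := by
    refine Monoid.CoprodI.lift_injective_of_ping_pong f ?_ Y ?_ ?_ ?_
    · right
      refine ⟨0, ?_⟩
      have : Cardinal.mk (FreeGroup Unit) = Cardinal.aleph0 := by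
        rw [Cardinal.eq.2 ⟨FreeGroup.freeGroupUnitEquivInt⟩]; simp
      rw [this]
      exact (Cardinal.natCast_lt_aleph0 (n := 3)).le
    · intro i; fin_cases i
      · exact hne false
      · exact hne true
    · intro i j hij
      fin_cases i <;> fin_cases j <;> simp at hij
      · exact hdisj.symm
      · exact hdisj
    · intro i j hij a ha
      have hpow : ∀ i, ∃ m : ℤ, m ≠ 0 ∧ f i a = g i ^ m := by
        intro i
        refine ⟨FreeGroup.freeGroupUnitEquivInt a, ?_, ?_⟩
        · intro h0
          apply ha
          apply FreeGroup.freeGroupUnitEquivInt.injective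
          rw [h0]; rfl
        · have : a = FreeGroup.of () ^ (FreeGroup.freeGroupUnitEquivInt a) :=
            (FreeGroup.freeGroupUnitEquivInt.symm_apply_apply a).symm
          conv_lhs => rw [this]
          simp [f]
      obtain ⟨m, hm, e⟩ := hpow i
      intro y hy
      obtain ⟨x, hx, rfl⟩ := hy
      simp only [e]
      fin_cases i <;> fin_cases j <;> simp at hij
      · exact zp m hm x hx
      · change (k * w * k⁻¹) ^ m • x ∈ X true
        rw [conj_zpow, mul_smul, mul_smul]
        exact hk _ (zp m hm _ (hk' _ hx))
  exact ⟨(Monoid.CoprodI.lift f).comp freeGroupEquivCoprodI.toMonoidHom,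
    hinj.comp freeGroupEquivCoprodI.injective⟩

end pingpong

section amal
variable {G : Type*} [Group G] (L : Bool → Subgroup G)

abbrev amφ (i : Bool) : ↥(iInf L) →* ↥(L i) := Subgroup.inclusion (iInf_le L i)

abbrev Amal := Monoid.PushoutI (amφ L)

def amOf (i : Bool) : ↥(L i) →* Amal L :=
  Monoid.PushoutI.of (G := fun i => ↥(L i)) (φ := amφ L) i

theorem amOf_eq {g : G} {i j : Bool} (hi : g ∈ L i) (hj : g ∈ L j) :
    amOf L i ⟨g, hi⟩ = amOf L j ⟨g, hj⟩ := by
  have key : ∀ (h : ∀ i, g ∈ L i) (i : Bool), amOf L i ⟨g, h i⟩ =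
      Monoid.PushoutI.base (amφ L) ⟨g, Subgroup.mem_iInf.2 h⟩ := by
    intro h i
    rw [← Monoid.PushoutI.of_apply_eq_base (amφ L) i]; rfl
  by_cases hij : i = j
  · subst hij; rfl
  · have h : ∀ l, g ∈ L l := by
      intro l
      cases i <;> cases j <;> cases l <;> simp at hij <;> assumption
    exact (key h i).trans (key h j).symm

def amNat : Amal L →* G :=
  Monoid.PushoutI.lift (fun i => (L i).subtype) (iInf L).subtype (by intro i; ext x; rfl)

@[simp] theorem amNat_of (i : Bool) (l : L i) : amNat L (amOf L i l) = l := by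
  simp [amNat, amOf]

theorem amal_free {k h h' : G} (hk : k ∈ L true) (hk2 : k ∉ L false)
    (hh : h ∈ L false) (hh2 : h ∉ L true) (hh' : h' ∈ L false) (hh'2 : h' ∉ L true)
    (hhh : h' * h ∉ L true) : ∃ f : FreeGroup (Fin 2) →* Amal L, Function.Injective f := by
  classical
  obtain ⟨d⟩ := Monoid.PushoutI.NormalWord.transversal_nonempty (amφ L)
    (fun i => Subgroup.inclusion_injective _)
  let X : Bool → Set (Monoid.PushoutI.NormalWord d) := fun i => {w | w.fstIdx = some i}
  have hmove : ∀ (i : Bool) (g : G) (hg : g ∈ L i) (w : Monoid.PushoutI.NormalWord d),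
      g ∉ L (!i) → w.fstIdx ≠ some i → amOf L i ⟨g, hg⟩ • w ∈ X i := by
    intro i g hg w hg2 hw
    have hr : (⟨g, hg⟩ : L i) ∉ (amφ L i).range := by
      rintro ⟨⟨x, hx⟩, hx2⟩
      have : x = g := congrArg Subtype.val hx2
      subst this
      exact hg2 (Subgroup.mem_iInf.1 hx _)
    have := Monoid.PushoutI.NormalWord.cons_eq_smul (G := fun i => ↥(L i)) (φ := amφ L) (d := d) (i := i) (⟨g, hg⟩ : L i) w hw hr
    unfold amOf
    rw [← this]
    simp only [X, Set.mem_setOf_eq, Monoid.PushoutI.NormalWord.cons, Monoid.CoprodI.Word.fstIdx_cons]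
  have mv : ∀ (i : Bool) (g : G) (hg : g ∈ L i), g ∉ L (!i) → ∀ w ∈ X (!i),
      amOf L i ⟨g, hg⟩ • w ∈ X i := by
    intro i g hg hg2 w hw
    refine hmove i g hg w hg2 ?_
    change w.fstIdx = some (!i) at hw
    rw [hw]; cases i <;> simp
  have mv' : ∀ (i : Bool) (g : G) (hg : g ∈ L i), g ∉ L (!i) → ∀ w ∈ X (!i),
      (amOf L i ⟨g, hg⟩)⁻¹ • w ∈ X i := by
    intro i g hg hg2 w hw
    have := mv i g⁻¹ ((L i).inv_mem hg) (by simpa using hg2) w hw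
    rw [← map_inv]; exact this
  refine free_of_pingpong X ?_ ?_ (amOf L true ⟨k, hk⟩) (amOf L false ⟨h, hh⟩)
    (amOf L false ⟨h', hh'⟩) (mv true k hk hk2) (mv' true k hk hk2) (mv false h hh hh2)
    (mv' false h hh hh2) (mv false h' hh' hh'2) (mv' false h' hh' hh'2) ?_ ?_
  · intro i
    cases i
    · exact ⟨_, hmove false h hh Monoid.PushoutI.NormalWord.empty hh2 (by simp [Monoid.CoprodI.Word.fstIdx])⟩
    · exact ⟨_, hmove true k hk Monoid.PushoutI.NormalWord.empty hk2 (by simp [Monoid.CoprodI.Word.fstIdx])⟩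
  · rw [Set.disjoint_left]
    intro w h1 h2
    change w.fstIdx = _ at h1 h2
    rw [h1] at h2; simp at h2
  · rw [← map_mul]; exact mv false (h' * h) ((L false).mul_mem hh' hh) hhh
  · rw [← map_mul]; exact mv' false (h' * h) ((L false).mul_mem hh' hh) hhh

end amal
end FPF

end partF

section partG

namespace FPF

structure Pres (n m : ℕ) (G : Type*) [Group G] where
  f : FreeGroup (Fin n ⊕ Fin m) →* G
  hf : Function.Surjective f
  R : Finset (FreeGroup (Fin n ⊕ Fin m))
  hker : f.ker = Subgroup.normalClosure (R : Set (FreeGroup (Fin n ⊕ Fin m)))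
  π : G →* Multiplicative (Fin n → ℤ)
  hπt : ∀ i, π (f (FreeGroup.of (Sum.inl i))) = Multiplicative.ofAdd (Pi.single i 1)
  hπy : ∀ j, π (f (FreeGroup.of (Sum.inr j))) = 1

namespace Pres
variable {n m : ℕ} {G : Type*} [Group G] (D : Pres n m G)

def t : Ltr n → G := lt fun i => D.f (FreeGroup.of (Sum.inl i))
def y (j : Fin m) : G := D.f (FreeGroup.of (Sum.inr j))
def S : Set G := {g | ∃ x y, g = cm D.t x y} ∪ Set.range D.y
def pv (g : G) : Fin n → ℤ := (D.π g).toAdd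

@[simp] theorem pv_one : D.pv 1 = 0 := by simp [pv]
@[simp] theorem pv_mul (g h : G) : D.pv (g * h) = D.pv g + D.pv h := by simp [pv]
@[simp] theorem pv_inv (g : G) : D.pv g⁻¹ = - D.pv g := by simp [pv]

theorem pv_t (x : Ltr n) : D.pv (D.t x) = vec x := by
  rcases x with ⟨i, b⟩
  cases b <;> simp [t, lt, pv, D.hπt, vec, Pi.single_neg]

theorem pv_y (j : Fin m) : D.pv (D.y j) = 0 := by simp [y, pv, D.hπy]

theorem t_xinv (x : Ltr n) : D.t (xinv x) = (D.t x)⁻¹ := lt_xinv _ x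

theorem cm_mem (x y : Ltr n) : cm D.t x y ∈ D.S := Or.inl ⟨x, y, rfl⟩
theorem y_mem (j : Fin m) : D.y j ∈ D.S := Or.inr ⟨j, rfl⟩

theorem pv_ev (v : List (Ltr n)) : D.pv (ev D.t v) = disp v := by
  induction v with
  | nil => simp
  | cons x v ih => simp [ih, pv_t]

/-- letters in the free group -/
def tF : Ltr n → FreeGroup (Fin n ⊕ Fin m) := lt fun i => FreeGroup.of (Sum.inl i)

theorem f_tF (x : Ltr n) : D.f (tF x) = D.t x := map_lt _ _ _

theorem f_evF (v : List (Ltr n)) : D.f (ev tF v) = ev D.t v := by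
  rw [map_ev]; simp only [f_tF]

end Pres

theorem InHalf.loop {n : ℕ} {θ : Fin n → ℝ} {c : ℝ} {v w : List (Ltr n)} (hv : InHalf θ c v)
    (hw : InHalf θ c w) (h : disp v = disp w) : InHalf θ c (v ++ winv w) := by
  refine hv.append ?_
  rintro z ⟨s, hs⟩
  have : w = winv s ++ winv z := by rw [← winv_append, hs, winv_winv]
  have h2 := hw (winv s) ⟨_, this.symm⟩
  rw [h, this]
  simpa using h2

/-- a chosen path -/
noncomputable def pth {n : ℕ} (θ : Fin n → ℝ) (q : Fin n → ℤ) : List (Ltr n) :=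
  (exists_path θ q).choose

def th {n : ℕ} (θ : Fin n → ℝ) (i : Bool) : Fin n → ℝ := if i then θ else -θ

theorem pth_disp {n : ℕ} (θ : Fin n → ℝ) (q : Fin n → ℤ) : disp (pth θ q) = q :=
  (exists_path θ q).choose_spec.1

theorem pth_half {n : ℕ} {θ : Fin n → ℝ} {q : Fin n → ℤ} {c : ℝ} (hc : msz θ ≤ c) (i : Bool)
    (hq : dot (th θ i) q ≤ c) : InHalf (th θ i) c (pth θ q) := by
  cases i
  · exact (exists_path θ q).choose_spec.2.2.1.mono (max_le hc (by simpa [th] using hq))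
  · exact (exists_path θ q).choose_spec.2.1.mono (max_le hc (by simpa [th] using hq))

theorem pth_zero {n : ℕ} (θ : Fin n → ℝ) : pth θ 0 = [] :=
  (exists_path θ 0).choose_spec.2.2.2 rfl

theorem abs_dot_th {n : ℕ} (θ : Fin n → ℝ) (i : Bool) (q : Fin n → ℤ) :
    |dot (th θ i) q| = |dot θ q| := by
  cases i <;> simp [th]

namespace Pres
section action
variable {n m : ℕ} {G : Type*} [Group G] (D : Pres n m G) (θ : Fin n → ℝ) (c : ℝ)

def L (i : Bool) : Subgroup G := Lsub D.t D.S (th θ i) c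

noncomputable def wq (q : Fin n → ℤ) : G := ev D.t (pth θ q)

theorem wq_zero : D.wq θ 0 = 1 := by simp [wq, pth_zero]

/-- position of generators -/
def pz (z : Fin n ⊕ Fin m) : Fin n → ℤ := D.pv (D.f (FreeGroup.of z))

theorem abs_pz (z : Fin n ⊕ Fin m) : |dot θ (D.pz z)| ≤ msz θ := by
  rcases z with i | j
  · have : D.pz (Sum.inl i) = vec (i, true) := D.pv_t (i, true)
    rw [this]; exact abs_dot_vec_le θ _
  · have : D.pz (Sum.inr j) = 0 := D.pv_y j
    rw [this]; simpa using msz_nonneg θ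

variable {θ c}

theorem edge_mem (hc : msz θ ≤ c) (i : Bool) (q : Fin n → ℤ) (z : Fin n ⊕ Fin m)
    (h1 : dot (th θ i) q ≤ c) (h2 : dot (th θ i) (q + D.pz z) ≤ c) :
    D.wq θ q * D.f (FreeGroup.of z) * (D.wq θ (q + D.pz z))⁻¹ ∈ D.L θ c i := by
  rcases z with k | j
  · have e1 : D.pz (Sum.inl k) = vec (k, true) := D.pv_t (k, true)
    have e2 : D.f (FreeGroup.of (Sum.inl k)) = D.t (k, true) := rfl
    rw [e1] at h2 ⊢
    rw [e2]
    have hA : InHalf (th θ i) c (pth θ q ++ [(k, true)]) := by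
      refine (pth_half hc i h1).concat ?_
      rw [disp_append, pth_disp]; simpa using h2
    have hB := hA.loop (pth_half hc i h2) (by simp [pth_disp])
    have := loop_mem D.t_xinv D.cm_mem ((msz_nonneg θ).trans hc) _ hB (by simp [pth_disp])
    rw [ev_append, ev_append, ev_winv _ D.t_xinv] at this
    simpa [wq, L] using this
  · have e1 : D.pz (Sum.inr j) = 0 := D.pv_y j
    rw [e1, add_zero]
    exact mem_Lsub (D.y_mem j) (pth_half hc i h1)

open Classical in
noncomputable def ofx (θ : Fin n → ℝ) (c : ℝ) (i : Bool) (g : G) : Amal (D.L θ c) :=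
  if h : g ∈ D.L θ c i then amOf _ i ⟨g, h⟩ else 1

theorem ofx_pos {i : Bool} {g : G} (h : g ∈ D.L θ c i) : D.ofx θ c i g = amOf _ i ⟨g, h⟩ := by
  rw [ofx, dif_pos h]

theorem ofx_one (i : Bool) : D.ofx θ c i 1 = 1 := by
  rw [D.ofx_pos (one_mem _)]; exact map_one _

theorem ofx_mul {i : Bool} {g h : G} (hg : g ∈ D.L θ c i) (hh : h ∈ D.L θ c i) :
    D.ofx θ c i (g * h) = D.ofx θ c i g * D.ofx θ c i h := by
  rw [D.ofx_pos hg, D.ofx_pos hh, D.ofx_pos (mul_mem hg hh), ← map_mul]; rfl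

theorem ofx_inv {i : Bool} {g : G} (hg : g ∈ D.L θ c i) :
    D.ofx θ c i g⁻¹ = (D.ofx θ c i g)⁻¹ := by
  rw [D.ofx_pos hg, D.ofx_pos (inv_mem hg), ← map_inv]; rfl

theorem ofx_congr {i j : Bool} {g : G} (hi : g ∈ D.L θ c i) (hj : g ∈ D.L θ c j) :
    D.ofx θ c i g = D.ofx θ c j g := by
  rw [D.ofx_pos hi, D.ofx_pos hj]; exact amOf_eq _ hi hj

open Classical in
noncomputable def idx (θ : Fin n → ℝ) (q : Fin n → ℤ) : Bool := decide (dot θ q ≤ 0)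

theorem dot_idx (q : Fin n → ℤ) : dot (th θ (idx θ q)) q ≤ 0 := by
  unfold idx
  by_cases h : dot θ q ≤ 0
  · simp [h, th]
  · simp [h, th]; linarith

theorem edge_mem_idx (hc : msz θ ≤ c) (q : Fin n → ℤ) (z : Fin n ⊕ Fin m) :
    D.wq θ q * D.f (FreeGroup.of z) * (D.wq θ (q + D.pz z))⁻¹ ∈ D.L θ c (idx θ q) := by
  have h0 := dot_idx (θ := θ) q
  have h1 := D.abs_pz θ z
  rw [← abs_dot_th θ (idx θ q)] at h1
  have h2 := (abs_le.1 h1).2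
  have h3 := msz_nonneg θ
  exact D.edge_mem hc _ q z (by linarith) (by rw [dot_add]; linarith)

noncomputable def ed (θ : Fin n → ℝ) (c : ℝ) (q : Fin n → ℤ) (z : Fin n ⊕ Fin m) : Amal (D.L θ c) :=
  D.ofx θ c (idx θ q) (D.wq θ q * D.f (FreeGroup.of z) * (D.wq θ (q + D.pz z))⁻¹)

noncomputable def stp (θ : Fin n → ℝ) (c : ℝ) (z : Fin n ⊕ Fin m) :
    Equiv.Perm ((Fin n → ℤ) × Amal (D.L θ c)) where
  toFun x := (x.1 - D.pz z, D.ed θ c (x.1 - D.pz z) z * x.2)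
  invFun x := (x.1 + D.pz z, (D.ed θ c x.1 z)⁻¹ * x.2)
  left_inv x := by simp
  right_inv x := by simp

noncomputable def Ψ (θ : Fin n → ℝ) (c : ℝ) :
    FreeGroup (Fin n ⊕ Fin m) →* Equiv.Perm ((Fin n → ℤ) × Amal (D.L θ c)) :=
  FreeGroup.lift (D.stp θ c)

/-- `γ` acts at `q` in the expected way, through `L i`. -/
def Act (θ : Fin n → ℝ) (c : ℝ) (i : Bool) (γ : FreeGroup (Fin n ⊕ Fin m)) (q : Fin n → ℤ) : Prop :=
  D.wq θ (q - D.pv (D.f γ)) * D.f γ * (D.wq θ q)⁻¹ ∈ D.L θ c i ∧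
  ∀ g, D.Ψ θ c γ (q, g) = (q - D.pv (D.f γ),
    D.ofx θ c i (D.wq θ (q - D.pv (D.f γ)) * D.f γ * (D.wq θ q)⁻¹) * g)

theorem Act.one (i : Bool) (q : Fin n → ℤ) : D.Act θ c i 1 q := by
  constructor
  · simp
  · intro g; simp [ofx_one]

variable {D}

theorem Act.mul {i : Bool} {γ δ : FreeGroup (Fin n ⊕ Fin m)} {q : Fin n → ℤ}
    (h1 : D.Act θ c i γ (q - D.pv (D.f δ))) (h2 : D.Act θ c i δ q) : D.Act θ c i (γ * δ) q := by
  have e : q - D.pv (D.f (γ * δ)) = q - D.pv (D.f δ) - D.pv (D.f γ) := by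
    rw [map_mul, pv_mul]; abel
  have e2 : D.wq θ (q - D.pv (D.f δ) - D.pv (D.f γ)) * D.f (γ * δ) * (D.wq θ q)⁻¹ =
      (D.wq θ (q - D.pv (D.f δ) - D.pv (D.f γ)) * D.f γ * (D.wq θ (q - D.pv (D.f δ)))⁻¹) *
      (D.wq θ (q - D.pv (D.f δ)) * D.f δ * (D.wq θ q)⁻¹) := by
    rw [map_mul]; group
  constructor
  · rw [e, e2]; exact mul_mem h1.1 h2.1
  · intro g
    rw [map_mul, Equiv.Perm.mul_apply, h2.2, h1.2, e, e2, D.ofx_mul h1.1 h2.1]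
    exact congrArg (Prod.mk _) (mul_assoc _ _ _).symm

theorem Act.inv {i : Bool} {γ : FreeGroup (Fin n ⊕ Fin m)} {q : Fin n → ℤ}
    (h1 : D.Act θ c i γ (q + D.pv (D.f γ))) : D.Act θ c i γ⁻¹ q := by
  have e : q - D.pv (D.f γ⁻¹) = q + D.pv (D.f γ) := by
    rw [map_inv, pv_inv]; abel
  have e0 : q + D.pv (D.f γ) - D.pv (D.f γ) = q := by abel
  obtain ⟨h2, h3⟩ := h1
  rw [e0] at h2 h3
  have e2 : D.wq θ (q + D.pv (D.f γ)) * D.f γ⁻¹ * (D.wq θ q)⁻¹ =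
      (D.wq θ q * D.f γ * (D.wq θ (q + D.pv (D.f γ)))⁻¹)⁻¹ := by
    rw [map_inv]; group
  constructor
  · rw [e, e2]; exact inv_mem h2
  · intro g
    rw [e, e2, D.ofx_inv h2, map_inv, Equiv.Perm.inv_eq_iff_eq, h3]
    simp

variable (D)

theorem Act.gen (hc : msz θ ≤ c) (i : Bool) (z : Fin n ⊕ Fin m) (q : Fin n → ℤ)
    (h1 : dot (th θ i) q ≤ c) (h2 : dot (th θ i) (q - D.pz z) ≤ c) :
    D.Act θ c i (FreeGroup.of z) q := by
  have hm := D.edge_mem hc i (q - D.pz z) z h2 (by simpa using h1)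
  have hm' := D.edge_mem_idx hc (q - D.pz z) z
  have e : q - D.pz z + D.pz z = q := by abel
  have hx := D.ofx_congr hm' hm
  rw [e] at hm
  refine ⟨hm, ?_⟩
  intro g
  change D.Ψ θ c (FreeGroup.of z) (q, g) = (q - D.pz z, _)
  rw [Ψ, FreeGroup.lift_apply_of]
  change (q - D.pz z, D.ed θ c (q - D.pz z) z * g) = _
  rw [ed, hx, e]; rfl

theorem Act.letter (hc : msz θ ≤ c) (i : Bool) (x : Ltr n) (q : Fin n → ℤ)
    (h1 : dot (th θ i) q ≤ c) (h2 : dot (th θ i) (q + vec x) ≤ c) :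
    D.Act θ c i (tF x) (q + vec x) := by
  rcases x with ⟨k, b⟩
  have e1 : D.pz (Sum.inl k) = vec (k, true) := D.pv_t (k, true)
  cases b
  · have e2 : vec (k, true) = - vec (k, false) := vec_xinv (k, false)
    have := Act.gen D hc i (Sum.inl k) q h1 (by rw [e1, e2, sub_neg_eq_add]; exact h2)
    change D.Act θ c i (FreeGroup.of (Sum.inl k))⁻¹ (q + vec (k, false))
    apply Act.inv
    change D.Act θ c i (FreeGroup.of (Sum.inl k)) (q + vec (k, false) + D.pz (Sum.inl k))
    rw [e1, e2]; simpa using this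
  · exact Act.gen D hc i (Sum.inl k) _ h2 (by rw [e1]; simpa using h1)

theorem Act.word (hc : msz θ ≤ c) (i : Bool) : ∀ (v : List (Ltr n)) (q : Fin n → ℤ),
    (∀ z, z <+: v → dot (th θ i) (q + disp z) ≤ c) → D.Act θ c i (ev tF v) (q + disp v) := by
  intro v
  induction v with
  | nil => intro q _; simpa using Act.one D i q
  | cons x v ih =>
    intro q h
    have h1 := ih (q + vec x) (fun z hz => by
      have := h (x :: z) (by simpa using hz)
      simpa [add_assoc] using this)
    have h2 := Act.letter D hc i x q (by simpa using h [] List.nil_prefix) (by simpa using h [x] (by simp))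
    rw [ev_cons, disp_cons, ← add_assoc]
    refine Act.mul ?_ h1
    rw [D.f_evF, D.pv_ev, add_sub_cancel_right]
    exact h2

theorem Act.list (hc : msz θ ≤ c) (i : Bool) : ∀ (l : List ((Fin n ⊕ Fin m) × Bool)) (q : Fin n → ℤ),
    dot (th θ i) q + l.length * msz θ ≤ c →
    D.Act θ c i (FreeGroup.mk l) q ∧
      dot (th θ i) (q - D.pv (D.f (FreeGroup.mk l))) ≤ dot (th θ i) q + l.length * msz θ := by
  intro l
  induction l with
  | nil => intro q _; exact ⟨Act.one D i q, by simp [← FreeGroup.one_eq_mk]⟩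
  | cons x l ih =>
    intro q h
    have hM := msz_nonneg θ
    have hlen : ((x :: l).length : ℝ) = l.length + 1 := by simp
    rw [hlen] at h ⊢
    obtain ⟨h1, h2⟩ := ih q (by nlinarith)
    have e : FreeGroup.mk (x :: l) = FreeGroup.mk [x] * FreeGroup.mk l := by
      rw [FreeGroup.mul_mk]; rfl
    rcases x with ⟨z, b⟩
    have hz := D.abs_pz θ z
    rw [← abs_dot_th θ i] at hz
    have hz' := abs_le.1 hz
    rw [e]
    set q1 := q - D.pv (D.f (FreeGroup.mk l)) with hq1
    cases b
    · have e2 : FreeGroup.mk [(z, false)] = (FreeGroup.of z)⁻¹ := rfl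
      rw [e2]
      have hp : D.pv (D.f (FreeGroup.of z)⁻¹) = - D.pz z := by rw [map_inv, pv_inv]; rfl
      constructor
      · refine Act.mul (Act.inv ?_) h1
        change D.Act θ c i (FreeGroup.of z) (q1 + D.pz z)
        refine Act.gen D hc i z _ ?_ ?_
        · rw [dot_add]; nlinarith
        · rw [add_sub_cancel_right]; nlinarith
      · have : q - D.pv (D.f ((FreeGroup.of z)⁻¹ * FreeGroup.mk l)) = q1 + D.pz z := by
          rw [map_mul, pv_mul, hp, hq1]; abel
        rw [this, dot_add]; nlinarith
    · have e2 : FreeGroup.mk [(z, true)] = FreeGroup.of z := rfl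
      rw [e2]
      have hp : D.pv (D.f (FreeGroup.of z)) = D.pz z := rfl
      constructor
      · refine Act.mul (Act.gen D hc i z _ ?_ ?_) h1
        · change dot (th θ i) q1 ≤ c; nlinarith
        · change dot (th θ i) (q1 - D.pz z) ≤ c; rw [dot_sub]; nlinarith
      · have : q - D.pv (D.f ((FreeGroup.of z) * FreeGroup.mk l)) = q1 - D.pz z := by
          rw [map_mul, pv_mul, hp, hq1]; abel
        rw [this, dot_sub]; nlinarith

theorem Ψ_ker (hc : msz θ ≤ c) (hR : ∀ r ∈ D.R, (r.toWord.length : ℝ) * msz θ ≤ c) :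
    D.f.ker ≤ (D.Ψ θ c).ker := by
  rw [D.hker]
  apply Subgroup.normalClosure_le_normal
  intro r hr
  have hr1 : D.f r = 1 := by
    have : r ∈ D.f.ker := by rw [D.hker]; exact Subgroup.subset_normalClosure hr
    exact this
  rw [SetLike.mem_coe, MonoidHom.mem_ker]
  ext1 ⟨q, g⟩
  have h0 := dot_idx (θ := θ) q
  have := (Act.list D hc (idx θ q) r.toWord q (by linarith [hR r hr])).1.2 g
  rw [FreeGroup.mk_toWord, hr1] at this
  rw [this]
  simp [ofx_one]

theorem act_amal (hc : 2 * msz θ ≤ c) (α : Amal (D.L θ c)) :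
    ∃ γ, D.f γ = amNat _ α ∧ ∀ g, D.Ψ θ c γ (0, g) = (0, α * g) := by
  have hM := msz_nonneg θ
  have hc' : msz θ ≤ c := by linarith
  have hof : ∀ (i : Bool) (l : D.L θ c i), ∃ γ, D.f γ = l ∧
      ∀ g, D.Ψ θ c γ (0, g) = (0, amOf _ i l * g) := by
    rintro i ⟨l, hl⟩
    have key : ∃ γ, D.f γ = l ∧ D.Act θ c i γ 0 ∧ D.pv l = 0 := by
      refine Subgroup.closure_induction (p := fun l _ => ∃ γ, D.f γ = l ∧ D.Act θ c i γ 0 ∧ D.pv l = 0)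
        ?_ ?_ ?_ ?_ hl
      · rintro l ⟨s, hs, v, hv, rfl⟩
        have hvd := hv v List.prefix_rfl
        have hA := Act.word D hc' i v 0 (fun z hz => by simpa using hv z hz)
        rw [zero_add] at hA
        have hAi : D.Act θ c i (ev tF v)⁻¹ 0 := by
          apply Act.inv
          rw [D.f_evF, D.pv_ev, zero_add]; exact hA
        have hS : ∃ σ, D.f σ = s ∧ D.pv s = 0 ∧ D.Act θ c (idx θ (disp v)) σ (disp v) := by
          have h0 := dot_idx (θ := θ) (disp v)
          rcases hs with ⟨x, y, rfl⟩ | ⟨j, rfl⟩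
          · refine ⟨ev tF [x, y, xinv x, xinv y], ?_, ?_, ?_⟩
            · rw [D.f_evF]; simp [cm, D.t_xinv, mul_assoc]
            · simp [cm]
            · have hx := abs_dot_vec_le θ x
              have hy := abs_dot_vec_le θ y
              rw [← abs_dot_th θ (idx θ (disp v))] at hx hy
              have hx := abs_le.1 hx
              have hy := abs_le.1 hy
              have := Act.word D hc' (idx θ (disp v)) [x, y, xinv x, xinv y] (disp v) (by
                intro z hz
                rw [← List.mem_inits] at hz
                simp only [List.inits, List.map_cons, List.map_nil, List.mem_cons,
                  List.not_mem_nil, or_false] at hz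
                rcases hz with rfl | rfl | rfl | rfl | rfl <;> simp <;> linarith)
              simpa using this
          · refine ⟨FreeGroup.of (Sum.inr j), rfl, D.pv_y j, ?_⟩
            have e1 : D.pz (Sum.inr j) = 0 := D.pv_y j
            exact Act.gen D hc' _ _ _ (by linarith) (by rw [e1, sub_zero]; linarith)
        obtain ⟨σ, hσ, hσ0, hact⟩ := hS
        have hmem : D.wq θ (disp v) * s * (D.wq θ (disp v))⁻¹ ∈ D.L θ c i :=
          mem_Lsub hs (pth_half hc' i hvd)
        have hact' : D.Act θ c i σ (disp v) := by
          obtain ⟨a1, a2⟩ := hact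
          unfold Act
          rw [hσ, hσ0, sub_zero] at a1 a2 ⊢
          refine ⟨hmem, fun g => ?_⟩
          rw [a2 g, D.ofx_congr a1 hmem]
        refine ⟨ev tF v * σ * (ev tF v)⁻¹, ?_, ?_, ?_⟩
        · rw [map_mul, map_mul, map_inv, hσ, D.f_evF]
        · refine Act.mul ?_ hAi
          have e : (0 : Fin n → ℤ) - D.pv (D.f (ev tF v)⁻¹) = disp v := by
            rw [map_inv, pv_inv, D.f_evF, D.pv_ev]; simp
          rw [e]
          refine Act.mul ?_ hact'
          rw [hσ, hσ0, sub_zero]; exact hA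
        · simp [hσ0]
      · exact ⟨1, map_one _, Act.one D i 0, D.pv_one⟩
      · rintro x y _ _ ⟨γ, h1, h2, h3⟩ ⟨δ, h4, h5, h6⟩
        refine ⟨γ * δ, by rw [map_mul, h1, h4], Act.mul ?_ h5, by simp [h3, h6]⟩
        rw [h4, h6, sub_zero]; exact h2
      · rintro x _ ⟨γ, h1, h2, h3⟩
        refine ⟨γ⁻¹, by rw [map_inv, h1], Act.inv ?_, by simp [h3]⟩
        rw [h1, h3, add_zero]; exact h2
    obtain ⟨γ, h1, h2, h3⟩ := key
    refine ⟨γ, h1, fun g => ?_⟩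
    have := h2.2 g
    rw [h1, h3, sub_zero, D.wq_zero, one_mul, inv_one, mul_one, D.ofx_pos hl] at this
    exact this
  induction α using Monoid.PushoutI.induction_on with
  | of i l =>
    obtain ⟨γ, h1, h2⟩ := hof i l
    exact ⟨γ, by rw [h1]; exact (amNat_of _ i l).symm, h2⟩
  | base h =>
    obtain ⟨γ, h1, h2⟩ := hof true (amφ (D.L θ c) true h)
    have e : Monoid.PushoutI.base (amφ (D.L θ c)) h = amOf _ true (amφ (D.L θ c) true h) :=
      (Monoid.PushoutI.of_apply_eq_base (amφ (D.L θ c)) true h).symm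
    rw [e]
    exact ⟨γ, by rw [h1, amNat_of], h2⟩
  | mul x y hx hy =>
    obtain ⟨γ, h1, h2⟩ := hx
    obtain ⟨δ, h3, h4⟩ := hy
    refine ⟨γ * δ, by rw [map_mul, map_mul, h1, h3], fun g => ?_⟩
    rw [map_mul, Equiv.Perm.mul_apply, h4, h2, mul_assoc]

theorem le_sup (hc : msz θ ≤ c) {g : G} (hg : D.π g = 1) : g ∈ D.L θ c true ⊔ D.L θ c false := by
  have hle : ∀ i, D.L θ c i ≤ D.L θ c true ⊔ D.L θ c false := by
    intro i; cases i
    · exact le_sup_right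
    · exact le_sup_left
  have key : ∀ γ : FreeGroup (Fin n ⊕ Fin m), ∀ q,
      D.wq θ q * D.f γ * (D.wq θ (q + D.pv (D.f γ)))⁻¹ ∈ D.L θ c true ⊔ D.L θ c false := by
    intro γ
    induction γ using FreeGroup.induction_on with
    | C1 => intro q; simp
    | of z => intro q; exact hle _ (D.edge_mem_idx hc q z)
    | inv_of z hz =>
      intro q
      have := inv_mem (hz (q - D.pv (D.f (FreeGroup.of z))))
      rw [sub_add_cancel] at this
      rw [map_inv, pv_inv, ← sub_eq_add_neg]
      simpa [mul_assoc] using this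
    | mul x y hx hy =>
      intro q
      have := mul_mem (hx q) (hy (q + D.pv (D.f x)))
      rw [map_mul, pv_mul, ← add_assoc]
      simpa [mul_assoc] using this
  obtain ⟨γ, rfl⟩ := D.hf g
  have := key γ 0
  have e : D.pv (D.f γ) = 0 := by rw [pv, hg]; rfl
  rw [e, add_zero, D.wq_zero] at this
  simpa using this

end action

section sigma
variable {n m : ℕ} {G : Type*} [Group G] (D : Pres n m G)

theorem exists_half {n : ℕ} (θ : Fin n → ℝ) (v : List (Ltr n)) : InHalf θ (v.length * msz θ) v := by
  have : ∀ z : List (Ltr n), dot θ (disp z) ≤ z.length * msz θ := by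
    intro z
    induction z with
    | nil => simp
    | cons x z ih =>
      have := (abs_le.1 (abs_dot_vec_le θ x)).2
      rw [disp_cons, dot_add, List.length_cons]; push_cast; linarith
  intro z hz
  refine (this z).trans ?_
  exact mul_le_mul_of_nonneg_right (by exact_mod_cast hz.length_le) (msz_nonneg θ)

theorem exists_mem (θ : Fin n → ℝ) (c : ℝ) {θ' : Fin n → ℝ} {g : G}
    (hg : g ∈ Lsub D.t D.S θ' c) : ∃ c', c ≤ c' ∧ g ∈ Lsub D.t D.S θ c' := by
  refine Subgroup.closure_induction (p := fun g _ => ∃ c', c ≤ c' ∧ g ∈ Lsub D.t D.S θ c')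
    ?_ ?_ ?_ ?_ hg
  · rintro g ⟨s, hs, v, hv, rfl⟩
    exact ⟨_, le_max_left _ _, mem_Lsub hs ((exists_half θ v).mono (le_max_right c _))⟩
  · exact ⟨c, le_rfl, one_mem _⟩
  · rintro x y _ _ ⟨a, h1, h2⟩ ⟨b, h3, h4⟩
    exact ⟨max a b, h1.trans (le_max_left _ _), mul_mem (Lsub_mono _ _ _ (le_max_left _ _) h2)
      (Lsub_mono _ _ _ (le_max_right _ _) h4)⟩
  · rintro x _ ⟨a, h1, h2⟩
    exact ⟨a, h1, inv_mem h2⟩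

theorem sigma (hfree : ∀ f : FreeGroup (Fin 2) →* G, ¬ Function.Injective f) (θ : Fin n → ℝ) :
    ∃ c : ℝ, 0 ≤ c ∧ ((∀ g, D.π g = 1 → g ∈ Lsub D.t D.S θ c) ∨
      (∀ g, D.π g = 1 → g ∈ Lsub D.t D.S (-θ) c)) := by
  have hM := msz_nonneg θ
  obtain ⟨c, hc, hR⟩ : ∃ c : ℝ, 2 * msz θ ≤ c ∧ ∀ r ∈ D.R, (r.toWord.length : ℝ) * msz θ ≤ c := by
    refine ⟨(2 + ∑ r ∈ D.R, (r.toWord.length : ℝ)) * msz θ, ?_, ?_⟩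
    · refine mul_le_mul_of_nonneg_right ?_ hM
      have : 0 ≤ ∑ r ∈ D.R, (r.toWord.length : ℝ) := Finset.sum_nonneg fun _ _ => by positivity
      linarith
    · intro r hr
      refine mul_le_mul_of_nonneg_right ?_ hM
      have := Finset.single_le_sum (f := fun r : FreeGroup (Fin n ⊕ Fin m) => (r.toWord.length : ℝ))
        (fun _ _ => by positivity) hr
      linarith
  have hc1 : msz θ ≤ c := by linarith
  have hc0 : 0 ≤ c := by linarith
  have hT : D.L θ c true = Lsub D.t D.S θ c := rfl
  have hF : D.L θ c false = Lsub D.t D.S (-θ) c := rfl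
  by_cases h1 : D.L θ c true ≤ D.L θ c false
  · refine ⟨c, hc0, Or.inr fun g hg => ?_⟩
    have := D.le_sup hc1 hg
    rwa [sup_eq_right.2 h1] at this
  by_cases h2 : D.L θ c false ≤ D.L θ c true
  · refine ⟨c, hc0, Or.inl fun g hg => ?_⟩
    have := D.le_sup hc1 hg
    rwa [sup_eq_left.2 h2] at this
  obtain ⟨k, hk1, hk2⟩ := SetLike.not_le_iff_exists.1 h1
  obtain ⟨h0, hh1, hh2⟩ := SetLike.not_le_iff_exists.1 h2
  by_cases h3 : ∀ h ∈ D.L θ c false, h ∉ D.L θ c true → h0⁻¹ * h ∈ D.L θ c true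
  · obtain ⟨c', hcc, hc'⟩ := D.exists_mem θ c hh1
    have hle : D.L θ c true ≤ Lsub D.t D.S θ c' := Lsub_mono _ _ _ hcc
    have hle2 : D.L θ c false ≤ Lsub D.t D.S θ c' := by
      intro h hh
      by_cases hht : h ∈ D.L θ c true
      · exact hle hht
      · have := mul_mem hc' (hle (h3 h hh hht))
        simpa using this
    exact ⟨c', hc0.trans hcc, Or.inl fun g hg => sup_le hle hle2 (D.le_sup hc1 hg)⟩
  · push Not at h3
    obtain ⟨h, hh3, hh4, hh5⟩ := h3
    exfalso
    obtain ⟨φ, hφ⟩ := amal_free (D.L θ c) hk1 hk2 hh3 hh4 (inv_mem hh1)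
      (fun hx => hh2 (by simpa using inv_mem hx)) hh5
    refine hfree ((amNat _).comp φ) ?_
    rw [injective_iff_map_eq_one]
    intro w hw
    obtain ⟨γ, e1, e2⟩ := D.act_amal hc (φ w)
    have hγ : γ ∈ D.f.ker := by rw [MonoidHom.mem_ker, e1]; exact hw
    have hΨ := D.Ψ_ker hc1 hR hγ
    rw [MonoidHom.mem_ker] at hΨ
    have := e2 1
    rw [hΨ] at this
    simp at this
    exact hφ (by rw [map_one]; exact this.symm)

end sigma
end Pres
end FPF

end partG

section partH

namespace FPF
open scoped commutatorElement

section hall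
variable {Γ : Type*} [Group Γ]

/-- Philip Hall: normal subgroups of a finitely generated metabelian group are finitely
normally generated. -/
theorem hall_aux (S : Set Γ) (hSf : S.Finite) (hS : Subgroup.closure S = ⊤)
    (V : Subgroup Γ) [V.Normal] [hV : IsMulCommutative V] (hcV : commutator Γ ≤ V)
    (X : Set Γ) (hXf : X.Finite) (hX : V = Subgroup.normalClosure X)
    (K : Subgroup Γ) [hK : K.Normal] (hKV : K ≤ V) :
    ∃ T : Set Γ, T.Finite ∧ T ⊆ K ∧ K ≤ Subgroup.normalClosure T := by
  let _ : CommGroup V := { (inferInstance : Group V) with mul_comm := hV.1.1 }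
  let W := Additive V
  let c : Γ → Module.End ℤ W := fun g =>
    (MonoidHom.toAdditive ((MulAut.conjNormal g : MulAut V) : V →* V)).toIntLinearMap
  have hc : ∀ g (v : V), ((c g (Additive.ofMul v)).toMul : Γ) = g * v * g⁻¹ := fun g v => by
    exact MulAut.conjNormal_apply g v
  have hcc : ∀ g h, c g * c h = c h * c g := by
    intro g h
    refine LinearMap.ext fun v => ?_
    have e1 : (((c g * c h) v).toMul : Γ) = g * (h * v.toMul * h⁻¹) * g⁻¹ := by
      change ((c g (c h v)).toMul : Γ) = _
      rw [← ofMul_toMul (c h v), hc, ← ofMul_toMul v, hc]; rfl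
    have e2 : (((c h * c g) v).toMul : Γ) = h * (g * v.toMul * g⁻¹) * h⁻¹ := by
      change ((c h (c g v)).toMul : Γ) = _
      rw [← ofMul_toMul (c g v), hc, ← ofMul_toMul v, hc]; rfl
    apply Additive.toMul.injective
    apply Subtype.ext
    rw [e1, e2]
    have hm : h⁻¹ * g⁻¹ * h * g ∈ V := by
      apply hcV
      rw [commutator_def]
      have := Subgroup.commutator_mem_commutator (Subgroup.mem_top h⁻¹) (Subgroup.mem_top g⁻¹)
      simpa [commutatorElement_def] using this
    have hcomm : (h⁻¹ * g⁻¹ * h * g) * (v.toMul : Γ) = v.toMul * (h⁻¹ * g⁻¹ * h * g) :=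
      congrArg Subtype.val (hV.1.1 ⟨_, hm⟩ v.toMul)
    calc g * (h * (v.toMul : Γ) * h⁻¹) * g⁻¹
        = g * h * ((v.toMul : Γ) * (h⁻¹ * g⁻¹ * h * g)) * g⁻¹ * h⁻¹ := by group
      _ = g * h * ((h⁻¹ * g⁻¹ * h * g) * (v.toMul : Γ)) * g⁻¹ * h⁻¹ := by rw [hcomm]
      _ = _ := by group
  let s : Set (Module.End ℤ W) := c '' (S ∪ S⁻¹)
  have hs : s.Finite := (hSf.union hSf.inv).image _
  let R := Algebra.adjoin ℤ s
  let iR : CommRing R := Algebra.adjoinCommRingOfComm ℤ (by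
    rintro _ ⟨g, _, rfl⟩ _ ⟨h, _, rfl⟩; exact hcc g h)
  have : Algebra.FiniteType ℤ R := (Subalgebra.fg_iff_finiteType _).1 (Subalgebra.fg_def.2 ⟨s, hs, rfl⟩)
  have : IsNoetherianRing R := Algebra.FiniteType.isNoetherianRing ℤ R
  -- normal subgroups as submodules
  let sub : ∀ (L : Subgroup Γ) [L.Normal], Submodule R W := fun L _ =>
    { carrier := {v | (v.toMul : Γ) ∈ L}
      add_mem' := fun {a b} ha hb => L.mul_mem ha hb
      zero_mem' := L.one_mem
      smul_mem' := by
        rintro ⟨r, hr⟩ v hv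
        refine Algebra.adjoin_induction (p := fun (r : Module.End ℤ W) _ => ∀ v : W, (v.toMul : Γ) ∈ L → ((r v).toMul : Γ) ∈ L)
          ?_ ?_ ?_ ?_ hr v hv
        · rintro _ ⟨g, _, rfl⟩ v hv
          rw [← ofMul_toMul v, hc]
          exact Subgroup.Normal.conj_mem inferInstance _ hv g
        · intro k v hv
          have : ((algebraMap ℤ (Module.End ℤ W) k) v) = k • v := rfl
          rw [this]
          exact L.zpow_mem hv k
        · intro x y _ _ hx hy v hv
          exact L.mul_mem (hx v hv) (hy v hv)
        · intro x y _ _ hx hy v hv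
          exact hx _ (hy v hv) }
  have hsub : ∀ (L : Subgroup Γ) [L.Normal] (v : W), v ∈ sub L ↔ (v.toMul : Γ) ∈ L := fun L _ v => Iff.rfl
  -- finiteness
  have hXV : X ⊆ V := by rw [hX]; exact Subgroup.subset_normalClosure
  let XW : Set W := {v | (v.toMul : Γ) ∈ X}
  have hXW : XW.Finite := by
    refine Set.Finite.preimage (f := fun v : W => (v.toMul : Γ)) ?_ hXf
    intro a _ b _ h
    exact Additive.toMul.injective (Subtype.ext h)
  have hspan : Submodule.span R XW = ⊤ := by
    rw [eq_top_iff]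
    let P : Subgroup Γ := ((Submodule.span R XW).toAddSubgroup.toSubgroup').map V.subtype
    have hP : ∀ v : V, (v : Γ) ∈ P ↔ Additive.ofMul v ∈ Submodule.span R XW := by
      intro v
      constructor
      · rintro ⟨w, hw, he⟩
        have : w = v := Subtype.ext he
        subst this; exact hw
      · intro h; exact ⟨v, h, rfl⟩
    have hPV : P ≤ V := by rintro _ ⟨w, _, rfl⟩; exact w.2
    have hgen : ∀ g ∈ S ∪ S⁻¹, ∀ x ∈ P, g * x * g⁻¹ ∈ P := by
      intro g hg x hx
      have hxV := hPV hx
      have h1 := (hP ⟨x, hxV⟩).1 hx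
      have h2 := (Submodule.span R XW).smul_mem (⟨c g, Algebra.subset_adjoin ⟨g, hg, rfl⟩⟩ : R) h1
      have h3 : g * x * g⁻¹ ∈ V := Subgroup.Normal.conj_mem inferInstance _ hxV g
      refine (hP ⟨_, h3⟩).2 ?_
      convert h2 using 1
      apply Additive.toMul.injective
      apply Subtype.ext
      exact (hc g ⟨x, hxV⟩).symm
    have hall : ∀ g : Γ, ∀ x ∈ P, g * x * g⁻¹ ∈ P := by
      intro g
      have hg : g ∈ Subgroup.closure S := by rw [hS]; trivial
      induction hg using Subgroup.closure_induction'' with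
      | mem x hx => exact hgen x (Or.inl hx)
      | inv_mem x hx => exact hgen x⁻¹ (Or.inr (by simpa using hx))
      | one => simp
      | mul x y _ _ h1 h2 =>
        intro z hz
        have := h1 _ (h2 z hz)
        simpa [mul_assoc] using this
    have : P.Normal := ⟨fun x hx g => hall g x hx⟩
    have hXP : X ⊆ P := fun x hx => (hP ⟨x, hXV hx⟩).2 (Submodule.subset_span hx)
    have hVP : V ≤ P := by rw [hX]; exact Subgroup.normalClosure_le_normal hXP
    intro v _
    exact (hP v.toMul).1 (hVP v.toMul.2)
  have : Module.Finite R W := ⟨⟨hXW.toFinset, by rw [Set.Finite.coe_toFinset]; exact hspan⟩⟩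
  have : IsNoetherian R W := isNoetherian_of_isNoetherianRing_of_finite R W
  obtain ⟨T, hT⟩ := IsNoetherian.noetherian (sub K)
  refine ⟨(fun v : W => (v.toMul : Γ)) '' (T : Set W), T.finite_toSet.image _, ?_, ?_⟩
  · rintro _ ⟨v, hv, rfl⟩
    have : v ∈ sub K := by rw [← hT]; exact Submodule.subset_span hv
    exact this
  · intro k hk
    have h1 : Additive.ofMul (⟨k, hKV hk⟩ : V) ∈ sub K := hk
    rw [← hT] at h1
    have h2 : Submodule.span R (T : Set W) ≤
        sub (Subgroup.normalClosure ((fun v : W => (v.toMul : Γ)) '' (T : Set W))) := by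
      rw [Submodule.span_le]
      intro v hv
      exact Subgroup.subset_normalClosure ⟨v, hv, rfl⟩
    exact h2 h1

theorem hall (S : Set Γ) (hSf : S.Finite) (hS : Subgroup.closure S = ⊤)
    (M : Subgroup Γ) [M.Normal] (hcM : commutator Γ ≤ M)
    (X : Set Γ) (hXf : X.Finite) (hX : M = Subgroup.normalClosure X)
    (K : Subgroup Γ) [hK : K.Normal] (hKM : K ≤ M) :
    ∃ T : Set Γ, T.Finite ∧ T ⊆ K ∧ K ≤ Subgroup.normalClosure T ⊔ ⁅M, M⁆ := by
  let q := QuotientGroup.mk' ⁅M, M⁆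
  have hq : Function.Surjective q := QuotientGroup.mk'_surjective _
  have : (M.map q).Normal := Subgroup.Normal.map inferInstance q hq
  have : (K.map q).Normal := Subgroup.Normal.map inferInstance q hq
  have : IsMulCommutative (M.map q) := ⟨⟨by
    rintro ⟨_, a, ha, rfl⟩ ⟨_, b, hb, rfl⟩
    apply Subtype.ext
    change q a * q b = q b * q a
    rw [← map_mul, ← map_mul]
    apply (QuotientGroup.eq).2
    have := Subgroup.commutator_mem_commutator (inv_mem hb) (inv_mem ha)
    simpa [commutatorElement_def, mul_assoc] using this⟩⟩
  obtain ⟨T, hTf, hTK, hT⟩ := hall_aux (q '' S) (hSf.image _)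
    (by rw [← MonoidHom.map_closure, hS, ← MonoidHom.range_eq_map, MonoidHom.range_eq_top.2 hq])
    (M.map q) (by
      rw [commutator_def, ← MonoidHom.range_eq_top.2 hq, MonoidHom.range_eq_map,
        ← Subgroup.map_commutator, ← commutator_def]
      exact Subgroup.map_mono hcM) (q '' X) (hXf.image _)
    (by rw [← Subgroup.map_normalClosure _ _ hq, ← hX]) (K.map q) (Subgroup.map_mono hKM)
  choose! g hg1 hg2 using (fun x hx => hTK hx : ∀ x ∈ T, ∃ k ∈ (K : Set Γ), q k = x)
  refine ⟨g '' T, hTf.image _, ?_, ?_⟩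
  · rintro _ ⟨x, hx, rfl⟩; exact hg1 x hx
  · intro k hk
    have h1 := hT ⟨k, hk, rfl⟩
    have e : T = q '' (g '' T) := by
      ext x; constructor
      · intro hx; exact ⟨g x, ⟨x, hx, rfl⟩, hg2 x hx⟩
      · rintro ⟨_, ⟨y, hy, rfl⟩, rfl⟩; rwa [hg2 y hy]
    rw [e, ← Subgroup.map_normalClosure _ _ hq] at h1
    obtain ⟨w, hw, he⟩ := h1
    have h2 : w⁻¹ * k ∈ ⁅M, M⁆ := (QuotientGroup.eq).1 he
    have := Subgroup.mul_mem_sup hw h2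
    simpa using this

end hall

/-- free quotient lemma -/
theorem comm_inf_ker {Φ F : Type*} [Group Φ] [Group F] [IsFreeGroup F] (p : Φ →* F) (N : Subgroup Φ)
    [N.Normal] : ⁅N, N⁆ ⊓ p.ker ≤ ⁅N, p.ker⁆ := by
  let P := N.map p
  choose s hs1 hs2 using (fun x => (IsFreeGroup.of x : P).2 : ∀ x : IsFreeGroup.Generators P,
    ∃ n ∈ N, p n = (IsFreeGroup.of x : P))
  let sec : P →* Φ := IsFreeGroup.lift s
  have hps : ∀ x : P, p (sec x) = x := by
    intro x
    have : (p.comp sec) = P.subtype := by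
      apply IsFreeGroup.ext_hom
      intro a
      simp only [MonoidHom.comp_apply, sec, IsFreeGroup.lift_of]
      exact hs2 a
    exact DFunLike.congr_fun this x
  have hsN : ∀ x : P, sec x ∈ N := by
    intro x
    have : (QuotientGroup.mk' N).comp sec = 1 := by
      apply IsFreeGroup.ext_hom
      intro a
      simp only [MonoidHom.comp_apply, sec, IsFreeGroup.lift_of, MonoidHom.one_apply]
      exact (QuotientGroup.eq_one_iff _).2 (hs1 a)
    exact (QuotientGroup.eq_one_iff _).1 (DFunLike.congr_fun this x)
  let pn : N → P := fun n => ⟨p n, n, n.2, rfl⟩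
  have hpn : ∀ a b, pn (a * b) = pn a * pn b := fun a b => Subtype.ext (by simp [pn])
  let κ : N → Φ := fun n => (sec (pn n))⁻¹ * n
  have hκN : ∀ n, κ n ∈ N := fun n => N.mul_mem (N.inv_mem (hsN _)) n.2
  have hκk : ∀ n, κ n ∈ p.ker := fun n => by
    rw [MonoidHom.mem_ker, map_mul, map_inv, hps]; simp [pn]
  have hcomm : ∀ a ∈ N, ∀ b ∈ p.ker, (a : Φ ⧸ ⁅N, p.ker⁆) * b = b * a := by
    intro a ha b hb
    rw [← QuotientGroup.mk_mul, ← QuotientGroup.mk_mul]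
    apply Eq.symm
    apply (QuotientGroup.eq).2
    have := Subgroup.commutator_mem_commutator (inv_mem ha) (inv_mem hb)
    simpa [commutatorElement_def, mul_assoc] using this
  let κh : N →* Φ ⧸ ⁅N, p.ker⁆ := MonoidHom.mk' (fun n => (κ n : Φ ⧸ ⁅N, p.ker⁆)) (by
    intro a b
    have e : κ (a * b) = (sec (pn b))⁻¹ * (κ a * b) := by
      simp only [κ, hpn, map_mul, mul_inv_rev, Subgroup.coe_mul, mul_assoc]
    have e2 : κ b = (sec (pn b))⁻¹ * b := rfl
    have e3 := hcomm _ (N.inv_mem (hsN (pn b))) _ (hκk a)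
    change ((κ (a * b) : Φ) : Φ ⧸ ⁅N, p.ker⁆) = (κ a : Φ ⧸ ⁅N, p.ker⁆) * (κ b : Φ ⧸ ⁅N, p.ker⁆)
    rw [e, e2]
    generalize κ a = k at e3 ⊢
    rw [QuotientGroup.mk_mul, QuotientGroup.mk_mul, QuotientGroup.mk_mul, ← mul_assoc,
      e3, mul_assoc])
  rintro x ⟨hx1, hx2⟩
  have hle : ⁅N, N⁆ ≤ κh.ker.map N.subtype := by
    rw [Subgroup.commutator_le]
    intro a ha b hb
    refine ⟨⁅(⟨a, ha⟩ : N), (⟨b, hb⟩ : N)⁆, ?_, rfl⟩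
    rw [SetLike.mem_coe, MonoidHom.mem_ker, map_commutatorElement, commutatorElement_eq_one_iff_mul_comm]
    exact hcomm _ (hκN _) _ (hκk _)
  obtain ⟨y, hy, rfl⟩ := hle hx1
  have hy' : (κ y : Φ ⧸ ⁅N, p.ker⁆) = 1 := hy
  rw [QuotientGroup.eq_one_iff] at hy'
  have e : pn y = 1 := Subtype.ext hx2
  have : κ y = y := by simp [κ, e]
  rw [this] at hy'
  exact hy'

theorem comm_sup_inf {Φ F : Type*} [Group Φ] [Group F] [IsFreeGroup F] (p1 p2 : Φ →* F) :
    ⁅p2.ker ⊔ p1.ker, p2.ker ⊔ p1.ker⁆ ⊓ (p2.ker ⊓ p1.ker) ≤ ⁅p2.ker, p1.ker⁆ := by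
  set N1 := p2.ker
  set N2 := p1.ker
  have hle : ⁅N1 ⊔ N2, N1 ⊔ N2⁆ ≤ ⁅N1, N1⁆ ⊔ (⁅N2, N2⁆ ⊔ ⁅N1, N2⁆) := by
    set C := ⁅N1, N1⁆ ⊔ (⁅N2, N2⁆ ⊔ ⁅N1, N2⁆)
    have key : ∀ (A : Subgroup Φ), ⁅A, N1⁆ ≤ C → ⁅A, N2⁆ ≤ C → ⁅A, N1 ⊔ N2⁆ ≤ C := by
      intro A h1 h2
      rw [Subgroup.commutator_le]
      intro a ha b hb
      obtain ⟨u, hu, v, hv, rfl⟩ := Subgroup.mem_sup_of_normal_right.1 hb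
      have e : ⁅a, u * v⁆ = ⁅a, u⁆ * (u * ⁅a, v⁆ * u⁻¹) := by
        simp only [commutatorElement_def]; group
      rw [e]
      exact C.mul_mem (h1 (Subgroup.commutator_mem_commutator ha hu))
        (Subgroup.Normal.conj_mem inferInstance _ (h2 (Subgroup.commutator_mem_commutator ha hv)) u)
    have h11 : ⁅N1, N1⁆ ≤ C := le_sup_left
    have h22 : ⁅N2, N2⁆ ≤ C := le_sup_left.trans le_sup_right
    have h12 : ⁅N1, N2⁆ ≤ C := le_sup_right.trans le_sup_right
    have h21 : ⁅N2, N1⁆ ≤ C := by rw [Subgroup.commutator_comm]; exact h12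
    apply key
    · rw [Subgroup.commutator_comm]; exact key N1 h11 h12
    · rw [Subgroup.commutator_comm]; exact key N2 h21 h22
  rintro x ⟨hx, hx1, hx2⟩
  obtain ⟨u, hu, w, hw, rfl⟩ := Subgroup.mem_sup_of_normal_right.1 (hle hx)
  obtain ⟨v, hv, z, hz, rfl⟩ := Subgroup.mem_sup_of_normal_right.1 hw
  have hu1 : u ∈ N1 := Subgroup.commutator_le_left N1 N1 hu
  have hv2 : v ∈ N2 := Subgroup.commutator_le_left N2 N2 hv
  have hz1 : z ∈ N1 := Subgroup.commutator_le_left N1 N2 hz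
  have hz2 : z ∈ N2 := Subgroup.commutator_le_right N1 N2 hz
  have hv1 : v ∈ N1 := by
    have := N1.mul_mem (N1.mul_mem (N1.inv_mem hu1) hx1) (N1.inv_mem hz1)
    simpa [mul_assoc] using this
  have hu2 : u ∈ N2 := by
    have := N2.mul_mem hx2 (N2.inv_mem (N2.mul_mem hv2 hz2))
    simpa [mul_assoc] using this
  refine Subgroup.mul_mem _ (comm_inf_ker p1 N1 ⟨hu, hu2⟩) (Subgroup.mul_mem _ ?_ hz)
  rw [Subgroup.commutator_comm]
  exact comm_inf_ker p2 N2 ⟨hv, hv1⟩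

end FPF

end partH

section partI

namespace FPF
namespace Pres

abbrev Ix (n m : ℕ) := (Ltr n × Ltr n) ⊕ Fin m
abbrev Ph (n m : ℕ) := FreeGroup ((Fin n ⊕ Fin m) ⊕ Ix n m)

section setup
variable {n m : ℕ}

def sw : Ix n m → FreeGroup (Fin n ⊕ Fin m)
  | Sum.inl p => cm tF p.1 p.2
  | Sum.inr j => FreeGroup.of (Sum.inr j)

def io : FreeGroup (Fin n ⊕ Fin m) →* Ph n m := FreeGroup.lift fun z => FreeGroup.of (Sum.inl z)
def pr1 : Ph n m →* FreeGroup (Fin n ⊕ Fin m) := FreeGroup.lift (Sum.elim FreeGroup.of sw)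
def pr2 : Ph n m →* FreeGroup (Fin n ⊕ Fin m) :=
  FreeGroup.lift (Sum.elim FreeGroup.of fun _ => 1)
def ga (σ : Ix n m) : Ph n m := FreeGroup.of (Sum.inr σ)
def gb (σ : Ix n m) : Ph n m := (ga σ)⁻¹ * io (sw σ)

@[simp] theorem pr1_io (γ : FreeGroup (Fin n ⊕ Fin m)) : pr1 (io γ) = γ := by
  have : (pr1 (n := n) (m := m)).comp io = MonoidHom.id _ := by
    ext z; simp [pr1, io]
  exact DFunLike.congr_fun this γ
@[simp] theorem pr2_io (γ : FreeGroup (Fin n ⊕ Fin m)) : pr2 (io γ) = γ := by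
  have : (pr2 (n := n) (m := m)).comp io = MonoidHom.id _ := by
    ext z; simp [pr2, io]
  exact DFunLike.congr_fun this γ
@[simp] theorem pr1_ga (σ : Ix n m) : pr1 (ga σ) = sw σ := by simp [pr1, ga]
@[simp] theorem pr2_ga (σ : Ix n m) : pr2 (ga σ) = 1 := by simp [pr2, ga]
@[simp] theorem pr1_gb (σ : Ix n m) : pr1 (gb σ) = 1 := by simp [gb]
@[simp] theorem pr2_gb (σ : Ix n m) : pr2 (gb σ) = sw σ := by simp [gb]
theorem ga_mul_gb (σ : Ix n m) : ga σ * gb σ = io (sw σ) := by simp [gb]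

def tP (x : Ltr n) : Ph n m := io (tF x)

theorem tP_xinv (x : Ltr n) : (tP (xinv x) : Ph n m) = (tP x)⁻¹ := by
  rw [tP, tF, lt_xinv, map_inv]; rfl

theorem pr2_ker : (pr2 (n := n) (m := m)).ker = Subgroup.normalClosure (Set.range ga) := by
  apply le_antisymm
  · intro g hg
    let q := QuotientGroup.mk' (Subgroup.normalClosure (Set.range (ga (n := n) (m := m))))
    have : (q.comp io).comp pr2 = q := by
      ext z
      rcases z with z | σ
      · simp [pr2, io]
      · have h1 : q (ga σ) = 1 := (QuotientGroup.eq_one_iff _).2 (Subgroup.subset_normalClosure ⟨σ, rfl⟩)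
        change q (io (pr2 (ga σ))) = q (ga σ)
        simp [h1]
    have h2 := DFunLike.congr_fun this g
    rw [MonoidHom.comp_apply, hg, map_one] at h2
    exact (QuotientGroup.eq_one_iff _).1 h2.symm
  · apply Subgroup.normalClosure_le_normal
    rintro _ ⟨σ, rfl⟩
    exact pr2_ga σ

theorem pr1_ker : (pr1 (n := n) (m := m)).ker = Subgroup.normalClosure (Set.range gb) := by
  apply le_antisymm
  · intro g hg
    let q := QuotientGroup.mk' (Subgroup.normalClosure (Set.range (gb (n := n) (m := m))))
    have : (q.comp io).comp pr1 = q := by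
      ext z
      rcases z with z | σ
      · simp [pr1, io]
      · have h1 : q (gb σ) = 1 := (QuotientGroup.eq_one_iff _).2 (Subgroup.subset_normalClosure ⟨σ, rfl⟩)
        change q (io (pr1 (ga σ))) = q (ga σ)
        rw [pr1_ga, ← ga_mul_gb, map_mul, h1, mul_one]
    have h2 := DFunLike.congr_fun this g
    rw [MonoidHom.comp_apply, hg, map_one] at h2
    exact (QuotientGroup.eq_one_iff _).1 h2.symm
  · apply Subgroup.normalClosure_le_normal
    rintro _ ⟨σ, rfl⟩
    exact pr1_gb σ

end setup

section tame
variable {n m : ℕ} {G : Type*} [Group G] (D : Pres n m G)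

theorem f_sw_mem (σ : Ix n m) : D.f (sw σ) ∈ D.S := by
  rcases σ with ⟨x, y⟩ | j
  · left; exact ⟨x, y, by simp [sw, cm, f_tF]⟩
  · exact Or.inr ⟨j, rfl⟩

theorem mem_S {s : G} (hs : s ∈ D.S) : ∃ σ, D.f (sw σ) = s := by
  rcases hs with ⟨x, y, rfl⟩ | ⟨j, rfl⟩
  · exact ⟨Sum.inl (x, y), by simp [sw, cm, f_tF]⟩
  · exact ⟨Sum.inr j, rfl⟩

theorem pi_S {s : G} (hs : s ∈ D.S) : D.π s = 1 := by
  have : D.pv s = 0 := by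
    rcases hs with ⟨x, y, rfl⟩ | ⟨j, rfl⟩
    · simp [cm]
    · exact D.pv_y j
  exact Multiplicative.toAdd.injective this

theorem lift_lasso (q : Ph n m →* G) (c : Ix n m → Ph n m) (hq : ∀ σ, q (c σ) = D.f (sw σ))
    (hqt : ∀ x, q (tP x) = D.t x) (θ : Fin n → ℝ) (c0 : ℝ) {g : G} (hg : g ∈ Lsub D.t D.S θ c0) :
    ∃ V : Set (List (Ltr n)), V.Finite ∧ (∀ v ∈ V, InHalf θ c0 v) ∧ ∃ κ ∈ Subgroup.closure
      {h | ∃ σ, ∃ v ∈ V, h = ev tP v * c σ * (ev tP v)⁻¹}, q κ = g := by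
  refine Subgroup.closure_induction (p := fun g _ => ∃ V : Set (List (Ltr n)), V.Finite ∧
      (∀ v ∈ V, InHalf θ c0 v) ∧ ∃ κ ∈ Subgroup.closure
      {h | ∃ σ, ∃ v ∈ V, h = ev tP v * c σ * (ev tP v)⁻¹}, q κ = g) ?_ ?_ ?_ ?_ hg
  · rintro _ ⟨s, hs, v, hv, rfl⟩
    obtain ⟨σ, rfl⟩ := D.mem_S hs
    refine ⟨{v}, Set.finite_singleton v, by simpa using hv, _,
      Subgroup.subset_closure ⟨σ, v, rfl, rfl⟩, ?_⟩
    rw [map_mul, map_mul, map_inv, map_ev, hq]; simp only [hqt]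
  · exact ⟨∅, Set.finite_empty, by simp, 1, one_mem _, map_one _⟩
  · rintro x y _ _ ⟨V, h1, h2, κ, h3, rfl⟩ ⟨V', h1', h2', κ', h3', rfl⟩
    refine ⟨V ∪ V', h1.union h1', ?_, κ * κ', mul_mem (Subgroup.closure_mono ?_ h3)
      (Subgroup.closure_mono ?_ h3'), map_mul _ _ _⟩
    · rintro v (hv | hv)
      · exact h2 v hv
      · exact h2' v hv
    · rintro _ ⟨σ, v, hv, rfl⟩; exact ⟨σ, v, Or.inl hv, rfl⟩
    · rintro _ ⟨σ, v, hv, rfl⟩; exact ⟨σ, v, Or.inr hv, rfl⟩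
  · rintro x _ ⟨V, h1, h2, κ, h3, rfl⟩
    exact ⟨V, h1, h2, κ⁻¹, inv_mem h3, map_inv _ _⟩

theorem continuous_dot (p : Fin n → ℤ) : Continuous fun θ : Fin n → ℝ => dot θ p := by
  unfold dot; fun_prop

theorem local_tame (q q' : Ph n m →* G) (c : Ix n m → Ph n m) (hq : ∀ σ, q (c σ) = D.f (sw σ))
    (hq' : ∀ σ, q' (c σ) = 1)
    (hqt : ∀ x, q (tP x) = D.t x) (θ0 : Fin n → ℝ) (hθ : ∑ i, θ0 i ^ 2 = 1) (c0 : ℝ)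
    (hL : ∀ g, D.π g = 1 → g ∈ Lsub D.t D.S θ0 c0) :
    ∃ K : ℕ, ∃ T : Set (Ph n m), T.Finite ∧ (∀ x ∈ T, q x = 1 ∧ q' x = 1) ∧
      ∃ U ∈ nhds θ0, ∀ θ ∈ U, ∀ (E : Type) [Group E] (φ : Ph n m →* E), (∀ x ∈ T, φ x = 1) →
        Tame (fun x => φ (tP x)) (φ '' Set.range c) K θ := by
  obtain ⟨i, hi⟩ : ∃ i, θ0 i ≠ 0 := by
    by_contra! h
    simp [h] at hθ
  obtain ⟨x, hx0, hx⟩ : ∃ x : Ltr n, x.1 = i ∧ 0 < dot θ0 (vec x) := by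
    rcases lt_or_gt_of_ne hi with h | h
    · exact ⟨(i, false), rfl, by rw [dot_vec]; simpa [vec] using h⟩
    · exact ⟨(i, true), rfl, by rw [dot_vec]; simpa [vec] using h⟩
  obtain ⟨k, hk⟩ := exists_nat_gt ((c0 + 1) / dot θ0 (vec x))
  rw [div_lt_iff₀ hx] at hk
  let w1 : List (Ltr n) := List.replicate k x
  have hw1 : ∀ z ∈ w1, z = x := fun z hz => List.eq_of_mem_replicate hz
  have hdisp : disp w1 = k • vec x := by simp [w1, disp, List.map_replicate, List.sum_replicate]
  have hdw : dot θ0 (disp w1) = k * dot θ0 (vec x) := by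
    rw [hdisp]; simp only [dot, Finset.mul_sum]
    refine Finset.sum_congr rfl fun j _ => ?_
    simp; ring
  have hmem : ∀ σ : Ix n m, ev D.t w1 * D.f (sw σ) * (ev D.t w1)⁻¹ ∈ Lsub D.t D.S θ0 c0 := by
    intro σ
    apply hL
    rw [map_mul, map_mul, map_inv, D.pi_S (D.f_sw_mem σ)]; simp
  choose V hVf hVh κ hκ hqκ using fun σ => D.lift_lasso q c hq hqt θ0 c0 (hmem σ)
  let VV : Set (List (Ltr n)) := ⋃ σ, V σ
  have hVV : VV.Finite := Set.finite_iUnion hVf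
  let ZZ : Set (List (Ltr n)) := ⋃ v ∈ VV, {z | z <+: v}
  have hZZ : ZZ.Finite := hVV.biUnion fun v _ => by
    refine (List.finite_toSet v.inits).subset fun z hz => ?_
    exact (List.mem_inits z v).2 hz
  obtain ⟨K1, hK1⟩ : ∃ K1 : ℕ, ∀ v ∈ VV, v.length ≤ K1 := by
    obtain ⟨K1, h⟩ := (hVV.image List.length).bddAbove
    exact ⟨K1, fun v hv => h ⟨v, hv, rfl⟩⟩
  obtain ⟨K2, hK2⟩ := exists_nat_gt ((k : ℝ) / |θ0 i|)
  rw [div_lt_iff₀ (abs_pos.2 hi)] at hK2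
  refine ⟨max K1 K2, Set.range fun σ => (κ σ)⁻¹ * (ev tP w1 * c σ * (ev tP w1)⁻¹),
    Set.finite_range _, ?_, {θ | 0 < dot θ (vec x) ∧ (k : ℝ) < K2 * |θ i|} ∩
      ⋂ z ∈ ZZ, {θ | 1 < dot θ (disp w1 - disp z)}, ?_, ?_⟩
  · rintro _ ⟨σ, rfl⟩
    constructor
    · rw [map_mul, map_inv, hqκ, map_mul, map_mul, map_inv, map_ev, hq]
      simp only [hqt]
      exact inv_mul_cancel _
    · have h1 : q' (κ σ) = 1 := by
        have : Subgroup.closure {h | ∃ τ, ∃ v ∈ V σ, h = ev tP v * c τ * (ev tP v)⁻¹} ≤ q'.ker := by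
          rw [Subgroup.closure_le]
          rintro _ ⟨τ, v, _, rfl⟩
          rw [SetLike.mem_coe, MonoidHom.mem_ker, map_mul, map_mul, map_inv, hq']; simp
        exact this (hκ σ)
      rw [map_mul, map_inv, h1, map_mul, map_mul, map_inv, hq']; simp
  · refine Filter.inter_mem (IsOpen.mem_nhds ?_ ⟨hx, hK2⟩) ?_
    · have h2 : IsOpen {θ : Fin n → ℝ | (k : ℝ) < K2 * |θ i|} :=
        isOpen_lt continuous_const (by fun_prop)
      exact IsOpen.inter (isOpen_lt continuous_const (continuous_dot _)) h2
    · rw [Filter.biInter_mem hZZ]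
      intro z hz
      refine IsOpen.mem_nhds (isOpen_lt continuous_const (continuous_dot _)) ?_
      change 1 < dot θ0 (disp w1 - disp z)
      obtain ⟨v, hv, hzv⟩ := Set.mem_iUnion₂.1 hz
      obtain ⟨σ, hσ⟩ := Set.mem_iUnion.1 hv
      have := hVh σ v hσ z hzv
      rw [dot_sub, hdw]; linarith
  · rintro θ ⟨⟨hθ1, hθ2⟩, hθ3⟩ E _ φ hφ
    refine ⟨w1, ?_, ?_, ?_⟩
    · intro z hz; rw [hw1 z hz]; exact hθ1
    · intro j
      by_cases hj : j = i
      · subst hj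
        have hb : |(disp w1 j : ℝ)| ≤ k := by
          rw [hdisp, ← hx0]
          rcases x with ⟨x, b⟩
          cases b <;> simp [vec]
        have : (K2 : ℝ) * |θ j| ≤ ((max K1 K2 : ℕ) : ℝ) * |θ j| :=
          mul_le_mul_of_nonneg_right (by exact_mod_cast le_max_right _ _) (abs_nonneg _)
        linarith
      · have : disp w1 j = 0 := by
          rw [hdisp]
          simp [vec, hx0, Pi.single_apply, hj]
        rw [this]; simp; positivity
    · rintro _ ⟨_, ⟨σ, rfl⟩, rfl⟩
      have h1 := hφ _ ⟨σ, rfl⟩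
      simp only [map_mul, map_inv] at h1
      rw [inv_mul_eq_one, map_ev] at h1
      rw [← h1]
      have h2 := Subgroup.mem_map_of_mem φ (hκ σ)
      rw [MonoidHom.map_closure] at h2
      refine Subgroup.closure_mono ?_ h2
      rintro _ ⟨_, ⟨τ, v, hv, rfl⟩, rfl⟩
      have hv' : v ∈ VV := Set.mem_iUnion.2 ⟨σ, hv⟩
      refine ⟨φ (c τ), ⟨_, ⟨τ, rfl⟩, rfl⟩, v, (hK1 v hv').trans (le_max_left _ _), ?_, ?_⟩
      · intro z hz
        have := Set.mem_iInter₂.1 hθ3 z (Set.mem_iUnion₂.2 ⟨v, hv', hz⟩)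
        exact le_of_lt this
      · rw [map_mul, map_mul, map_inv, map_ev]

end tame
end Pres
end FPF

end partI

section partJ

namespace FPF
open scoped commutatorElement

theorem Tame.mono {n : ℕ} {E : Type*} [Group E] {t : Ltr n → E} {A : Set E} {K K' : ℕ}
    {θ : Fin n → ℝ} (h : Tame t A K θ) (hK : K ≤ K') : Tame t A K' θ := by
  obtain ⟨w, h1, h2, h3⟩ := h
  refine ⟨w, h1, fun i => (h2 i).trans (mul_le_mul_of_nonneg_right (by exact_mod_cast hK) (abs_nonneg _)),
    fun α hα => Subgroup.closure_mono ?_ (h3 α hα)⟩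
  rintro _ ⟨α', hα', v, hv, hz, rfl⟩
  exact ⟨α', hα', v, hv.trans hK, hz, rfl⟩

namespace Pres
variable {n m : ℕ} {G : Type*} [Group G] (D : Pres n m G)

theorem pr1_tP (x : Ltr n) : (pr1 (tP x : Ph n m)) = tF x := pr1_io _
theorem pr2_tP (x : Ltr n) : (pr2 (tP x : Ph n m)) = tF x := pr2_io _

theorem unif_tame (hfree : ∀ f : FreeGroup (Fin 2) →* G, ¬ Function.Injective f) :
    ∃ K : ℕ, ∃ T : Set (Ph n m), T.Finite ∧ (∀ x ∈ T, D.f (pr1 x) = 1 ∧ D.f (pr2 x) = 1) ∧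
      ∀ θ : Fin n → ℝ, ∑ i, θ i ^ 2 = 1 → ∀ (E : Type) [Group E] (φ : Ph n m →* E),
        (∀ x ∈ T, φ x = 1) → Tame (fun x => φ (tP x)) (φ '' Set.range ga) K θ ∨
          Tame (fun x => φ (tP x)) (φ '' Set.range gb) K (-θ) := by
  have hcpt : IsCompact {θ : Fin n → ℝ | ∑ i, θ i ^ 2 = 1} := by
    refine IsCompact.of_isClosed_subset (isCompact_univ_pi (s := fun _ => Set.Icc (-1 : ℝ) 1)
      fun _ => isCompact_Icc) (isClosed_eq (by fun_prop) continuous_const) ?_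
    intro θ hθ i _
    have h1 : θ i ^ 2 ≤ 1 := by
      have hθ' : ∑ i, θ i ^ 2 = 1 := hθ
      rw [← hθ']
      exact Finset.single_le_sum (f := fun i => θ i ^ 2) (fun _ _ => sq_nonneg _) (Finset.mem_univ i)
    exact abs_le.1 (abs_le_one_iff_mul_self_le_one.2 (by nlinarith))
  refine hcpt.induction_on (p := fun U => ∃ K : ℕ, ∃ T : Set (Ph n m), T.Finite ∧
      (∀ x ∈ T, D.f (pr1 x) = 1 ∧ D.f (pr2 x) = 1) ∧
      ∀ θ ∈ U, ∀ (E : Type) [Group E] (φ : Ph n m →* E),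
        (∀ x ∈ T, φ x = 1) → Tame (fun x => φ (tP x)) (φ '' Set.range ga) K θ ∨
          Tame (fun x => φ (tP x)) (φ '' Set.range gb) K (-θ)) ?_ ?_ ?_ ?_
  · exact ⟨0, ∅, Set.finite_empty, by simp, by simp⟩
  · rintro s t hst ⟨K, T, h1, h2, h3⟩
    exact ⟨K, T, h1, h2, fun θ hθ => h3 θ (hst hθ)⟩
  · rintro s t ⟨K, T, h1, h2, h3⟩ ⟨K', T', h1', h2', h3'⟩
    refine ⟨max K K', T ∪ T', h1.union h1', ?_, ?_⟩
    · rintro x (hx | hx)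
      · exact h2 x hx
      · exact h2' x hx
    · rintro θ (hθ | hθ) E _ φ hφ
      · exact (h3 θ hθ E φ fun x hx => hφ x (Or.inl hx)).imp (fun h => h.mono (le_max_left _ _))
          (fun h => h.mono (le_max_left _ _))
      · exact (h3' θ hθ E φ fun x hx => hφ x (Or.inr hx)).imp (fun h => h.mono (le_max_right _ _))
          (fun h => h.mono (le_max_right _ _))
  · intro θ0 hθ0
    obtain ⟨c, _, h | h⟩ := D.sigma hfree θ0
    · obtain ⟨K, T, h1, h2, U, hU, h3⟩ := D.local_tame (D.f.comp pr1) (D.f.comp pr2) ga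
        (fun σ => by simp) (fun σ => by simp) (fun x => by rw [MonoidHom.comp_apply, pr1_tP, f_tF])
        θ0 hθ0 c h
      exact ⟨U, mem_nhdsWithin_of_mem_nhds hU, K, T, h1, h2,
        fun θ hθ E _ φ hφ => Or.inl (h3 θ hθ E φ hφ)⟩
    · obtain ⟨K, T, h1, h2, U, hU, h3⟩ := D.local_tame (D.f.comp pr2) (D.f.comp pr1) gb
        (fun σ => by simp) (fun σ => by simp) (fun x => by rw [MonoidHom.comp_apply, pr2_tP, f_tF])
        (-θ0) (by simpa using hθ0) c h
      refine ⟨(fun θ => -θ) ⁻¹' U, mem_nhdsWithin_of_mem_nhds (continuous_neg.continuousAt.preimage_mem_nhds hU),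
        K, T, h1, fun x hx => (h2 x hx).symm, fun θ hθ E _ φ hφ => Or.inr (h3 (-θ) hθ E φ hφ)⟩

theorem comm_ncl (hfree : ∀ f : FreeGroup (Fin 2) →* G, ¬ Function.Injective f) :
    ∃ T : Set (Ph n m), T.Finite ∧ (∀ x ∈ T, D.f (pr1 x) = 1 ∧ D.f (pr2 x) = 1) ∧
      ⁅(pr2 (n := n) (m := m)).ker, (pr1 (n := n) (m := m)).ker⁆ ≤ Subgroup.normalClosure T := by
  obtain ⟨K, T, hTf, hT, hTame⟩ := D.unif_tame hfree
  let T1 : Set (Ph n m) := Set.range fun p : Ltr n × Ltr n =>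
    (tP p.1)⁻¹ * ga (Sum.inl (p.1, p.2)) * tP p.1 * (ga (Sum.inl (p.2, xinv p.1)))⁻¹
  let T2 : Set (Ph n m) := Set.range fun p : Ltr n × Ltr n =>
    (tP p.1)⁻¹ * gb (Sum.inl (p.1, p.2)) * tP p.1 * (gb (Sum.inl (p.2, xinv p.1)))⁻¹
  let cr : List (Ltr n) × Ix n m × Ix n m → Ph n m := fun p =>
    (ev tP p.1 * ga p.2.1 * (ev tP p.1)⁻¹) * gb p.2.2 *
      (gb p.2.2 * (ev tP p.1 * ga p.2.1 * (ev tP p.1)⁻¹))⁻¹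
  let T3 : Set (Ph n m) := cr '' ({u | u.length ≤ rho0 n K} ×ˢ Set.univ)
  have hsw : ∀ x y : Ltr n, (tF x)⁻¹ * sw (Sum.inl (x, y)) * tF x *
      (sw (Sum.inl (y, xinv x)) : FreeGroup (Fin n ⊕ Fin m))⁻¹ = 1 := by
    intro x y
    have : (tF (xinv x) : FreeGroup (Fin n ⊕ Fin m)) = (tF x)⁻¹ := lt_xinv _ _
    simp only [sw, cm, this]; group
  refine ⟨T ∪ (T1 ∪ (T2 ∪ T3)), ?_, ?_, ?_⟩
  · refine hTf.union ((Set.finite_range _).union ((Set.finite_range _).union (Set.Finite.image _ ?_)))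
    exact (List.finite_length_le _ _).prod Set.finite_univ
  · rintro x (hx | ⟨p, rfl⟩ | ⟨p, rfl⟩ | ⟨p, _, rfl⟩)
    · exact hT x hx
    · constructor
      · simp only [map_mul, map_inv, pr1_tP, pr1_ga]
        simp only [← map_mul, ← map_inv, hsw, map_one]
      · simp
    · constructor
      · simp
      · simp only [map_mul, map_inv, pr2_tP, pr2_gb]
        simp only [← map_mul, ← map_inv, hsw, map_one]
    · constructor <;> simp [cr]
  · set T0 := T ∪ (T1 ∪ (T2 ∪ T3)) with hT0
    let φ : Ph n m →* Ph n m ⧸ Subgroup.normalClosure T0 := QuotientGroup.mk' _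
    have hφ : ∀ x ∈ T0, φ x = 1 := fun x hx =>
      (QuotientGroup.eq_one_iff _).2 (Subgroup.subset_normalClosure hx)
    let t := fun x => φ (tP x)
    have tinv : ∀ x, t (xinv x) = (t x)⁻¹ := fun x => by simp only [t, tP_xinv, map_inv]
    have hshort : ∀ u : List (Ltr n), u.length ≤ rho0 n K →
        CC (φ '' Set.range ga) (φ '' Set.range gb) (ev t u) := by
      rintro u hu _ ⟨_, ⟨σ, rfl⟩, rfl⟩ _ ⟨_, ⟨τ, rfl⟩, rfl⟩
      have h1 := hφ (cr (u, σ, τ)) (Or.inr (Or.inr (Or.inr ⟨(u, σ, τ), ⟨hu, trivial⟩, rfl⟩)))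
      simp only [cr] at h1
      rw [map_mul, map_inv, mul_inv_eq_one] at h1
      simp only [map_mul, map_inv, map_ev] at h1
      exact h1
    have hcfg : Cfg t (φ '' Set.range ga) (φ '' Set.range gb) (fun x y => φ (ga (Sum.inl (x, y))))
        (fun x y => φ (gb (Sum.inl (x, y)))) :=
      { tinv := tinv
        amem := fun x y => ⟨_, ⟨_, rfl⟩, rfl⟩
        bmem := fun x y => ⟨_, ⟨_, rfl⟩, rfl⟩
        aconj := fun x y => by
          have h1 := hφ _ (Or.inr (Or.inl ⟨(x, y), rfl⟩))
          rw [map_mul, map_inv, mul_inv_eq_one] at h1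
          simp only [map_mul, map_inv] at h1
          refine ⟨ga (Sum.inl (y, xinv x)), ⟨_, rfl⟩, h1.symm⟩
        bconj := fun x y => by
          have h1 := hφ _ (Or.inr (Or.inr (Or.inl ⟨(x, y), rfl⟩)))
          rw [map_mul, map_inv, mul_inv_eq_one] at h1
          simp only [map_mul, map_inv] at h1
          refine ⟨gb (Sum.inl (y, xinv x)), ⟨_, rfl⟩, h1.symm⟩
        comm := fun x y => by
          have h1 : ga (Sum.inl (x, y)) * gb (Sum.inl (x, y)) * (tP y * tP x) = (tP x * tP y : Ph n m) := by
            rw [ga_mul_gb]; simp [sw, cm, tP]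
          simp only [t, ← map_mul, h1]
        base := by
          have := hshort [] (by simp)
          simpa using this }
    have hall := hcfg.all K (fun θ hθ => hTame θ hθ _ φ fun x hx => hφ x (Or.inl hx)) hshort
    -- the normal closure of the images of the `a`
    let Ab : Subgroup (Ph n m ⧸ Subgroup.normalClosure T0) :=
      Subgroup.closure {g | ∃ σ u, g = ev t u * φ (ga σ) * (ev t u)⁻¹}
    have hAg : ∀ σ u, ev t u * φ (ga σ) * (ev t u)⁻¹ ∈ Ab := fun σ u =>
      Subgroup.subset_closure ⟨σ, u, rfl⟩
    have hcomm : ∀ u σ τ, Commute (ev t u * φ (ga σ) * (ev t u)⁻¹) (φ (gb τ)) := fun u σ τ =>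
      hall u _ ⟨_, ⟨σ, rfl⟩, rfl⟩ _ ⟨_, ⟨τ, rfl⟩, rfl⟩
    have hcommA : ∀ x ∈ Ab, ∀ τ, Commute x (φ (gb τ)) := by
      intro x hx τ
      have : Ab ≤ Subgroup.centralizer {φ (gb τ)} := by
        rw [Subgroup.closure_le]
        rintro _ ⟨σ, u, rfl⟩
        rw [SetLike.mem_coe, Subgroup.mem_centralizer_singleton_iff]
        exact (hcomm u σ τ).eq
      exact Subgroup.mem_centralizer_singleton_iff.1 (this hx)
    have hPt : ∀ z : Ltr n, ∀ x ∈ Ab, t z * x * (t z)⁻¹ ∈ Ab := by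
      intro z x hx
      have h1 := Subgroup.mem_map_of_mem (MulAut.conj (t z)).toMonoidHom hx
      rw [MonoidHom.map_closure] at h1
      refine Subgroup.closure_mono ?_ h1
      rintro _ ⟨_, ⟨σ, u, rfl⟩, rfl⟩
      exact ⟨σ, z :: u, by simp [mul_assoc]⟩
    have hAa : ∀ σ, φ (ga σ) ∈ Ab := fun σ => by simpa using hAg σ []
    have hPa : ∀ σ, ∀ x ∈ Ab, φ (ga σ) * x * (φ (ga σ))⁻¹ ∈ Ab := fun σ x hx =>
      Ab.mul_mem (Ab.mul_mem (hAa σ) hx) (Ab.inv_mem (hAa σ))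
    have hPa' : ∀ σ, ∀ x ∈ Ab, (φ (ga σ))⁻¹ * x * (φ (ga σ))⁻¹⁻¹ ∈ Ab := fun σ x hx =>
      Ab.mul_mem (Ab.mul_mem (Ab.inv_mem (hAa σ)) hx) (by simpa using (hAa σ))
    have hPg : ∀ γ : Ph n m, ∀ x ∈ Ab, φ γ * x * (φ γ)⁻¹ ∈ Ab := by
      intro γ
      have hof : ∀ j, (FreeGroup.of (Sum.inl (Sum.inr j)) : Ph n m) = ga (Sum.inr j) * gb (Sum.inr j) := by
        intro j; rw [ga_mul_gb]; simp [sw, io]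
      induction γ using FreeGroup.induction_on with
      | C1 => intro x hx; simpa using hx
      | of z =>
        rcases z with (i | j) | σ
        · intro x hx
          have := hPt (i, true) x hx
          simpa [t, tP, tF, lt, io] using this
        · intro x hx
          rw [hof, map_mul]
          have h1 := (hcommA x hx (Sum.inr j)).eq
          have h2 : φ (ga (Sum.inr j)) * φ (gb (Sum.inr j)) * x * (φ (ga (Sum.inr j)) * φ (gb (Sum.inr j)))⁻¹
              = φ (ga (Sum.inr j)) * (φ (gb (Sum.inr j)) * x) * (φ (gb (Sum.inr j)))⁻¹ * (φ (ga (Sum.inr j)))⁻¹ := by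
            group
          rw [h2, ← h1]
          have := hPa (Sum.inr j) x hx
          simpa [mul_assoc] using this
        · exact hPa σ
      | inv_of z _ =>
        rw [map_inv]
        rcases z with (i | j) | σ
        · intro x hx
          have := hPt (i, false) x hx
          simpa [t, tP, tF, lt, io] using this
        · intro x hx
          rw [hof, map_mul]
          have h0 := hPa' (Sum.inr j) x hx
          have h1 := (hcommA _ h0 (Sum.inr j)).eq
          have h2 : (φ (ga (Sum.inr j)) * φ (gb (Sum.inr j)))⁻¹ * x * (φ (ga (Sum.inr j)) * φ (gb (Sum.inr j)))⁻¹⁻¹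
              = (φ (gb (Sum.inr j)))⁻¹ * ((φ (ga (Sum.inr j)))⁻¹ * x * (φ (ga (Sum.inr j)))⁻¹⁻¹ * (φ (gb (Sum.inr j)))) := by
            group
          rw [h2, h1]
          simpa [mul_assoc] using h0
        · exact hPa' σ
      | mul a b ha hb =>
        intro x hx
        have := ha _ (hb x hx)
        simpa [mul_assoc] using this
    have hφs : Function.Surjective φ := QuotientGroup.mk'_surjective _
    have hN : Ab.Normal := ⟨fun x hx g => by
      obtain ⟨γ, rfl⟩ := hφs g
      exact hPg γ x hx⟩
    have h1 : (pr2 (n := n) (m := m)).ker ≤ Ab.comap φ := by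
      rw [pr2_ker]
      apply Subgroup.normalClosure_le_normal
      rintro _ ⟨σ, rfl⟩
      exact hAa σ
    have h2 : (pr1 (n := n) (m := m)).ker ≤ (Subgroup.centralizer (Ab : Set _)).comap φ := by
      rw [pr1_ker]
      apply Subgroup.normalClosure_le_normal
      rintro _ ⟨σ, rfl⟩
      rw [SetLike.mem_coe, Subgroup.mem_comap, Subgroup.mem_centralizer_iff]
      intro x hx
      exact (hcommA x hx σ).eq
    rw [Subgroup.commutator_le]
    intro a ha b hb
    have h3 := Subgroup.mem_centralizer_iff.1 (h2 hb) _ (h1 ha)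
    apply (QuotientGroup.eq_one_iff _).1
    change φ ⁅a, b⁆ = 1
    rw [map_commutatorElement, commutatorElement_eq_one_iff_mul_comm]
    exact h3

end Pres
end FPF

end partJ

section partK

namespace FPF
namespace Pres
open scoped commutatorElement
variable {n m : ℕ} {G : Type*} [Group G] (D : Pres n m G)

theorem tF_xinv (x : Ltr n) : (tF (xinv x) : FreeGroup (Fin n ⊕ Fin m)) = (tF x)⁻¹ := lt_xinv _ x

theorem ker_pi_le {γ : FreeGroup (Fin n ⊕ Fin m)} (h : D.π (D.f γ) = 1) :
    γ ∈ Subgroup.normalClosure (Set.range (sw (n := n) (m := m))) := by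
  set q := QuotientGroup.mk' (Subgroup.normalClosure (Set.range (sw (n := n) (m := m)))) with hq
  have hs : ∀ σ, q (sw σ) = 1 := fun σ =>
    (QuotientGroup.eq_one_iff _).2 (Subgroup.subset_normalClosure ⟨σ, rfl⟩)
  have key : ∀ γ : FreeGroup (Fin n ⊕ Fin m), ∃ v : List (Ltr n), q γ = q (ev tF v) ∧
      disp v = D.pv (D.f γ) := by
    intro γ
    induction γ using FreeGroup.induction_on with
    | C1 => exact ⟨[], by simp, by simp⟩
    | of z =>
      rcases z with i | j
      · refine ⟨[(i, true)], by simp [tF, lt], ?_⟩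
        have := D.pv_t (i, true)
        simp only [disp_cons, disp_nil, add_zero]
        exact this.symm
      · refine ⟨[], ?_, ?_⟩
        · have := hs (Sum.inr j)
          rw [ev_nil, map_one]; exact this
        · have := D.pv_y j
          simp only [disp_nil]; exact this.symm
    | inv_of z hz =>
      obtain ⟨v, h1, h2⟩ := hz
      exact ⟨winv v, by rw [ev_winv _ tF_xinv, map_inv, map_inv, h1], by rw [disp_winv, h2]; simp⟩
    | mul x y hx hy =>
      obtain ⟨v, h1, h2⟩ := hx
      obtain ⟨w, h3, h4⟩ := hy
      exact ⟨v ++ w, by rw [ev_append, map_mul, map_mul, h1, h3], by simp [h2, h4]⟩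
  obtain ⟨v, h1, h2⟩ := key γ
  have h0 : disp v = 0 := by rw [h2, pv, h]; rfl
  have hl := loop_mem (t := tF (n := n) (m := m)) (S := Set.range sw) (θ := 0) (c := 0) tF_xinv
    (fun x y => ⟨Sum.inl (x, y), rfl⟩) le_rfl v (fun z _ => by simp [dot]) h0
  have hle : Lsub (tF (n := n) (m := m)) (Set.range sw) 0 0 ≤
      Subgroup.normalClosure (Set.range (sw (n := n) (m := m))) := by
    refine (Subgroup.closure_le _).2 ?_
    rintro _ ⟨s, hs, v, _, rfl⟩
    exact Subgroup.normalClosure_normal.conj_mem _ (Subgroup.subset_normalClosure hs) _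
  have : q (ev tF v) = 1 := (QuotientGroup.eq_one_iff _).2 (hle hl)
  exact (QuotientGroup.eq_one_iff _).1 (h1.trans this)

theorem pr1_surj : Function.Surjective (pr1 (n := n) (m := m)) := fun x => ⟨io x, pr1_io x⟩
theorem pr2_surj : Function.Surjective (pr2 (n := n) (m := m)) := fun x => ⟨io x, pr2_io x⟩

theorem lift1 {γ : FreeGroup (Fin n ⊕ Fin m)} (h : D.π (D.f γ) = 1) :
    ∃ ν : Ph n m, pr2 ν = 1 ∧ pr1 ν = γ := by
  have h1 : Subgroup.map pr1 (pr2 (n := n) (m := m)).ker =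
      Subgroup.normalClosure (Set.range (sw (n := n) (m := m))) := by
    rw [pr2_ker, Subgroup.map_normalClosure _ _ pr1_surj, ← Set.range_comp]
    congr 2; ext1 σ; exact pr1_ga σ
  have := D.ker_pi_le h
  rw [← h1] at this
  obtain ⟨ν, a, b⟩ := this
  exact ⟨ν, a, b⟩

theorem lift2 {γ : FreeGroup (Fin n ⊕ Fin m)} (h : D.π (D.f γ) = 1) :
    ∃ ν : Ph n m, pr1 ν = 1 ∧ pr2 ν = γ := by
  obtain ⟨ν, a, b⟩ := D.lift1 h
  exact ⟨ν⁻¹ * io γ, by simp [b], by simp [a]⟩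

theorem ker_ncl (hfree : ∀ f : FreeGroup (Fin 2) →* G, ¬ Function.Injective f) :
    ∃ T : Set (Ph n m), T.Finite ∧
      ((D.f.comp pr1).prod (D.f.comp pr2)).ker = Subgroup.normalClosure T := by
  obtain ⟨T0, hT0f, hT0, hcomm⟩ := D.comm_ncl hfree
  set M : Subgroup (Ph n m) := pr2.ker ⊔ pr1.ker with hM
  have hcM : commutator (Ph n m) ≤ M := by
    intro x hx
    have h1 : D.π (D.f (pr2 x)) = 1 := by
      have : commutator (Ph n m) ≤ (D.π.comp (D.f.comp pr2)).ker :=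
        Abelianization.commutator_subset_ker _
      exact this hx
    obtain ⟨ν, a, b⟩ := D.lift2 h1
    have : x = (x * ν⁻¹) * ν := by group
    rw [this]
    refine mul_mem (Subgroup.mem_sup_left ?_) (Subgroup.mem_sup_right a)
    rw [MonoidHom.mem_ker]; simp [b]
  obtain ⟨T1, hT1f, hT1, hK⟩ := hall (Set.range FreeGroup.of) (Set.finite_range _)
    (by rw [FreeGroup.closure_range_of]) M hcM (Set.range ga ∪ Set.range gb)
    ((Set.finite_range _).union (Set.finite_range _))
    (by rw [hM, pr2_ker, pr1_ker, Subgroup.normalClosure_union]) (pr2.ker ⊓ pr1.ker)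
    (inf_le_left.trans le_sup_left)
  have hr : ∀ r : FreeGroup (Fin n ⊕ Fin m), r ∈ D.R → D.f r = 1 := fun r hr => by
    have : r ∈ D.f.ker := by rw [D.hker]; exact Subgroup.subset_normalClosure hr
    exact this
  have c1 : ∀ r : D.R, ∃ ν : Ph n m, pr2 ν = 1 ∧ pr1 ν = r := fun r =>
    D.lift1 (by rw [hr r r.2, map_one])
  have c2 : ∀ r : D.R, ∃ ν : Ph n m, pr1 ν = 1 ∧ pr2 ν = r := fun r =>
    D.lift2 (by rw [hr r r.2, map_one])
  choose a ha1 ha2 using c1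
  choose b hb1 hb2 using c2
  refine ⟨T0 ∪ T1 ∪ Set.range a ∪ Set.range b,
    ((hT0f.union hT1f).union (Set.finite_range _)).union (Set.finite_range _), le_antisymm ?_ ?_⟩
  · set T := T0 ∪ T1 ∪ Set.range a ∪ Set.range b with hT
    intro φ hφ
    have hφ1 : D.f (pr1 φ) = 1 := congrArg Prod.fst hφ
    have hφ2 : D.f (pr2 φ) = 1 := congrArg Prod.snd hφ
    have e1 : D.f.ker = Subgroup.map pr1 (Subgroup.normalClosure (Set.range a)) := by
      rw [Subgroup.map_normalClosure _ _ pr1_surj, ← Set.range_comp, D.hker]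
      congr 1; ext x; simp [ha2]
    have e2 : D.f.ker = Subgroup.map pr2 (Subgroup.normalClosure (Set.range b)) := by
      rw [Subgroup.map_normalClosure _ _ pr2_surj, ← Set.range_comp, D.hker]
      congr 1; ext x; simp [hb2]
    have hφ1 : pr1 φ ∈ D.f.ker := hφ1
    have hφ2 : pr2 φ ∈ D.f.ker := hφ2
    rw [e1] at hφ1
    rw [e2] at hφ2
    obtain ⟨ψ1, p1, q1⟩ := hφ1
    obtain ⟨ψ2, p2, q2⟩ := hφ2
    have s1 : pr2 ψ1 = 1 := by
      have : Subgroup.normalClosure (Set.range a) ≤ (pr2 (n := n) (m := m)).ker := by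
        apply Subgroup.normalClosure_le_normal; rintro _ ⟨r, rfl⟩; exact ha1 r
      exact this p1
    have s2 : pr1 ψ2 = 1 := by
      have : Subgroup.normalClosure (Set.range b) ≤ (pr1 (n := n) (m := m)).ker := by
        apply Subgroup.normalClosure_le_normal; rintro _ ⟨r, rfl⟩; exact hb1 r
      exact this p2
    have hk : φ * ψ1⁻¹ * ψ2⁻¹ ∈ (pr2 (n := n) (m := m)).ker ⊓ pr1.ker := by
      constructor
      · change pr2 _ = 1; simp [s1, q2]
      · change pr1 _ = 1; simp [s2, q1]
    have hin : φ * ψ1⁻¹ * ψ2⁻¹ ∈ Subgroup.normalClosure T := by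
      obtain ⟨x, hx, y, hy, hxy⟩ := Subgroup.mem_sup_of_normal_right.1 (hK hk)
      have hxK : x ∈ (pr2 (n := n) (m := m)).ker ⊓ pr1.ker :=
        Subgroup.normalClosure_le_normal hT1 hx
      have hyK : y ∈ (pr2 (n := n) (m := m)).ker ⊓ pr1.ker := by
        have : y = x⁻¹ * (φ * ψ1⁻¹ * ψ2⁻¹) := by rw [← hxy]; group
        rw [this]; exact mul_mem (inv_mem hxK) hk
      have hy2 := hcomm (comm_sup_inf pr1 pr2 ⟨hy, hyK⟩)
      rw [← hxy]
      refine mul_mem (Subgroup.normalClosure_mono ?_ hx) (Subgroup.normalClosure_mono ?_ hy2)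
      · intro z hz; simp [hT, hz]
      · intro z hz; simp [hT, hz]
    have : φ = (φ * ψ1⁻¹ * ψ2⁻¹) * ψ2 * ψ1 := by group
    rw [this]
    refine mul_mem (mul_mem hin (Subgroup.normalClosure_mono ?_ p2))
      (Subgroup.normalClosure_mono ?_ p1)
    · exact Set.subset_union_right
    · exact fun z hz => Or.inl (Or.inr hz)
  · apply Subgroup.normalClosure_le_normal
    have hmk : ∀ x : Ph n m, D.f (pr1 x) = 1 → D.f (pr2 x) = 1 →
        x ∈ ((D.f.comp pr1).prod (D.f.comp pr2)).ker := fun x h1 h2 => Prod.ext h1 h2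
    rintro x (((hx | hx) | ⟨r, rfl⟩) | ⟨r, rfl⟩)
    · exact hmk x (hT0 x hx).1 (hT0 x hx).2
    · have h1 : pr2 x = 1 := (hT1 hx).1
      have h2 : pr1 x = 1 := (hT1 hx).2
      exact hmk x (by rw [h2, map_one]) (by rw [h1, map_one])
    · exact hmk _ (by rw [ha2, hr r r.2]) (by rw [ha1, map_one])
    · exact hmk _ (by rw [hb1, map_one]) (by rw [hb2, hr r r.2])

theorem range_Q (g1 g2 : G) : (g1, g2) ∈ ((D.f.comp pr1).prod (D.f.comp pr2)).range ↔
    D.π g1 = D.π g2 := by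
  constructor
  · rintro ⟨φ, hφ⟩
    have h1 : D.f (pr1 φ) = g1 := congrArg Prod.fst hφ
    have h2 : D.f (pr2 φ) = g2 := congrArg Prod.snd hφ
    have : D.π.comp (D.f.comp pr1) = D.π.comp (D.f.comp pr2) := by
      ext1 z
      rcases z with z | σ
      · simp [pr1, pr2]
      · change D.π (D.f (pr1 (ga σ))) = D.π (D.f (pr2 (ga σ)))
        rw [pr1_ga, pr2_ga, D.pi_S (D.f_sw_mem σ), map_one, map_one]
    rw [← h1, ← h2]
    exact DFunLike.congr_fun this φ
  · intro h
    obtain ⟨γ1, rfl⟩ := D.hf g1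
    obtain ⟨γ2, rfl⟩ := D.hf g2
    obtain ⟨ν, a, b⟩ := D.lift1 (γ := γ1 * γ2⁻¹) (by simp [h])
    exact ⟨ν * io γ2, Prod.ext (by simp [b]) (by simp [a])⟩

theorem fp_fibre (hfree : ∀ f : FreeGroup (Fin 2) →* G, ¬ Function.Injective f)
    (H : Subgroup (G × G)) (hH : ∀ p, p ∈ H ↔ D.π p.1 = D.π p.2) :
    Group.IsFinitelyPresented H := by
  obtain ⟨T, hTf, hT⟩ := D.ker_ncl hfree
  have hr : ((D.f.comp pr1).prod (D.f.comp pr2)).range = H := by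
    ext ⟨g1, g2⟩; rw [D.range_Q, hH]
  subst hr
  refine Group.IsFinitelyPresented.of_surjective
    ((D.f.comp pr1).prod (D.f.comp pr2)).rangeRestrict (MonoidHom.rangeRestrict_surjective _) ?_
  rw [MonoidHom.ker_rangeRestrict, hT]
  exact ⟨T, hTf, rfl⟩

end Pres
end FPF

end partK

section partL

namespace FPF

theorem ncl_of_retract {α : Type*} {E Γ : Type*} [Group E] [Group Γ] (p : FreeGroup α →* Γ)
    (s : E →* FreeGroup α) (r : FreeGroup α →* E) (S : Set E)
    (hS : ∀ x, p x = 1 → r x ∈ Subgroup.normalClosure S) (h1 : ∀ e ∈ S, p (s e) = 1)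
    (h2 : ∀ a, p (s (r (FreeGroup.of a))) = p (FreeGroup.of a)) :
    p.ker = Subgroup.normalClosure (s '' S ∪
      Set.range fun a => FreeGroup.of a * (s (r (FreeGroup.of a)))⁻¹) := by
  set T := s '' S ∪ Set.range fun a => FreeGroup.of a * (s (r (FreeGroup.of a)))⁻¹ with hT
  apply le_antisymm
  · intro x hx
    set q := QuotientGroup.mk' (Subgroup.normalClosure T)
    have e : (q.comp s).comp r = q := by
      ext a
      have : q (FreeGroup.of a * (s (r (FreeGroup.of a)))⁻¹) = 1 :=
        (QuotientGroup.eq_one_iff _).2 (Subgroup.subset_normalClosure (Or.inr ⟨a, rfl⟩))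
      rw [map_mul, map_inv, mul_inv_eq_one] at this
      exact this.symm
    have hle : Subgroup.normalClosure S ≤ (q.comp s).ker := by
      apply Subgroup.normalClosure_le_normal
      intro z hz
      exact (QuotientGroup.eq_one_iff _).2
        (Subgroup.subset_normalClosure (Or.inl (Set.mem_image_of_mem _ hz)))
    have h3 : q.comp s (r x) = 1 := hle (hS x hx)
    have h4 := DFunLike.congr_fun e x
    rw [MonoidHom.comp_apply, h3] at h4
    exact (QuotientGroup.eq_one_iff _).1 h4.symm
  · apply Subgroup.normalClosure_le_normal
    rintro _ (⟨e, he, rfl⟩ | ⟨a, rfl⟩)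
    · exact h1 e he
    · change p _ = 1
      simp [h2]

theorem exists_lift {α : Type*} {E Γ : Type*} [Group E] [Group Γ] (p : FreeGroup α →* Γ)
    (φ : E →* Γ) (hφ : Function.Surjective φ) : ∃ r : FreeGroup α →* E, φ.comp r = p := by
  choose g hg using hφ
  refine ⟨FreeGroup.lift fun a => g (p (FreeGroup.of a)), ?_⟩
  ext a; simp [hg]

theorem ker_fng {α : Type*} [Finite α] {Γ : Type*} [Group Γ] [h : Group.IsFinitelyPresented Γ]
    (p : FreeGroup α →* Γ) (hp : Function.Surjective p) : p.ker.IsFinitelyNormallyGenerated := by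
  obtain ⟨n, φ, hφ, S, hS, hSk⟩ := h.out
  obtain ⟨r, hr⟩ := exists_lift p φ hφ
  obtain ⟨s, hs⟩ := exists_lift φ p hp
  have hr' : ∀ x, φ (r x) = p x := fun x => DFunLike.congr_fun hr x
  have hs' : ∀ x, p (s x) = φ x := fun x => DFunLike.congr_fun hs x
  refine ⟨_, ?_, (ncl_of_retract p s r S ?_ ?_ ?_).symm⟩
  · exact (hS.image _).union (Set.finite_range _)
  · intro x hx; rw [hSk, MonoidHom.mem_ker, hr', hx]
  · intro e he
    rw [hs']
    have : e ∈ φ.ker := by rw [← hSk]; exact Subgroup.subset_normalClosure he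
    exact this
  · intro a; rw [hs', hr']

theorem fp_of_free (E : Type*) [Group E] [IsFreeGroup E] [hE : Group.FG E] :
    Group.IsFinitelyPresented E := by
  obtain ⟨S, hS⟩ := Group.fg_def.1 hE
  let p : FreeGroup S →* E := FreeGroup.lift (fun x => (x : E))
  have hp : Function.Surjective p := by
    rw [← MonoidHom.range_eq_top, FreeGroup.range_lift_eq_closure]
    simpa using hS
  choose g hg using id hp
  let s : E →* FreeGroup S := IsFreeGroup.lift (fun a => g (IsFreeGroup.of a))
  have hs : p.comp s = MonoidHom.id E := by
    apply IsFreeGroup.ext_hom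
    intro a
    simp [s, hg]
  have hs' : ∀ x, p (s x) = x := fun x => DFunLike.congr_fun hs x
  refine Group.IsFinitelyPresented.of_surjective p hp ⟨_, ?_, (ncl_of_retract p s p ∅ ?_ ?_ ?_).symm⟩
  · exact (Set.finite_empty.image _).union (Set.finite_range _)
  · intro x hx; rw [hx]; exact one_mem _
  · simp
  · intro a; rw [hs']

theorem fp_finiteIndex {Γ : Type*} [Group Γ] [h : Group.IsFinitelyPresented Γ] (H : Subgroup Γ)
    [H.FiniteIndex] : Group.IsFinitelyPresented H := by
  obtain ⟨n, φ, hφ, S, hS, hSk⟩ := h.out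
  let Φ0 := H.comap φ
  have hfi : Φ0.FiniteIndex := ⟨by
    rw [Subgroup.index_comap_of_surjective H hφ]; exact Subgroup.FiniteIndex.index_ne_zero⟩
  have : Group.FG Φ0 := Subgroup.fg_of_index_ne_zero Φ0
  have : IsFreeGroup Φ0 := subgroupIsFreeOfIsFree Φ0
  have : Group.IsFinitelyPresented Φ0 := fp_of_free Φ0
  have hmem : ∀ x ∈ Subgroup.normalClosure S, x ∈ Φ0 := by
    intro x hx
    rw [hSk] at hx
    change φ x ∈ H
    rw [hx]; exact one_mem _
  have hconj : ∀ (c : FreeGroup (Fin n)) (s : S), c⁻¹ * s * c ∈ Subgroup.normalClosure S := by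
    intro c s
    simpa using Subgroup.normalClosure_normal.conj_mem _ (Subgroup.subset_normalClosure s.2) c⁻¹
  have : Finite S := hS
  have : Finite (FreeGroup (Fin n) ⧸ Φ0) := Subgroup.finite_quotient_of_finiteIndex
  let T : Set Φ0 := Set.range fun p : (FreeGroup (Fin n) ⧸ Φ0) × S =>
    ⟨(p.1.out)⁻¹ * p.2 * p.1.out, hmem _ (hconj _ _)⟩
  refine Group.IsFinitelyPresented.of_surjective (φ.subgroupComap H)
    (φ.subgroupComap_surjective_of_surjective H hφ) ⟨T, Set.finite_range _, le_antisymm ?_ ?_⟩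
  · apply Subgroup.normalClosure_le_normal
    rintro _ ⟨⟨c, s⟩, rfl⟩
    apply Subtype.ext
    have := hconj c.out s
    rw [hSk] at this
    exact this
  · intro x hx
    have hx1 : (x : FreeGroup (Fin n)) ∈ Subgroup.normalClosure S := by
      rw [hSk]; exact congrArg Subtype.val hx
    have hle : Subgroup.normalClosure S ≤ (Subgroup.normalClosure T).map Φ0.subtype := by
      refine (Subgroup.closure_le _).2 ?_
      intro z hz
      obtain ⟨s, hs, hz⟩ := Group.mem_conjugatesOfSet_iff.1 hz
      obtain ⟨c, rfl⟩ := isConj_iff.1 hz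
      set d := (QuotientGroup.mk c⁻¹ : FreeGroup (Fin n) ⧸ Φ0).out with hd
      have hcd : c * d ∈ Φ0 := by
        have : (QuotientGroup.mk c⁻¹ : FreeGroup (Fin n) ⧸ Φ0) = QuotientGroup.mk d :=
          (QuotientGroup.out_eq' _).symm
        rw [QuotientGroup.eq] at this
        simpa using this
      have hT : (⟨d⁻¹ * s * d, hmem _ (hconj d ⟨s, hs⟩)⟩ : Φ0) ∈ T :=
        ⟨(QuotientGroup.mk c⁻¹, ⟨s, hs⟩), rfl⟩
      refine ⟨(⟨c * d, hcd⟩ : Φ0) * ⟨d⁻¹ * s * d, hmem _ (hconj d ⟨s, hs⟩)⟩ * (⟨c * d, hcd⟩ : Φ0)⁻¹,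
        Subgroup.normalClosure_normal.conj_mem _ (Subgroup.subset_normalClosure hT) _, ?_⟩
      simp only [map_mul, map_inv, Subgroup.coe_subtype]
      group
    obtain ⟨y, hy, hxy⟩ := hle hx1
    rwa [← Subtype.ext hxy]

end FPF

end partL

section partM

namespace FPF
open scoped commutatorElement

theorem free_to_Zn (n : ℕ) : Function.Surjective (FreeGroup.lift (fun i : Fin n =>
    Multiplicative.ofAdd (Pi.single i (1 : ℤ) : Fin n → ℤ))) := by
  intro v
  refine ⟨(List.ofFn fun i => FreeGroup.of i ^ (v.toAdd i)).prod, ?_⟩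
  rw [map_list_prod, List.map_ofFn, List.prod_ofFn]
  apply Multiplicative.toAdd.injective
  rw [toAdd_prod]
  ext j
  simp [Finset.sum_apply, Pi.single_apply]

theorem exists_pres {n : ℕ} {G : Type*} [Group G] [h : Group.IsFinitelyPresented G]
    (π : G →* Multiplicative (Fin n → ℤ)) (hπ : Function.Surjective π) :
    ∃ m, ∃ D : Pres n m G, D.π = π := by
  obtain ⟨m, φ, hφ, -⟩ := h.out
  choose t ht using fun i : Fin n => hπ (Multiplicative.ofAdd (Pi.single i 1))
  choose w hw using fun j : Fin m => free_to_Zn n (π (φ (FreeGroup.of j)))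
  have hlt : ∀ x, π (FreeGroup.lift t x) = FreeGroup.lift (fun i : Fin n =>
    Multiplicative.ofAdd (Pi.single i (1 : ℤ) : Fin n → ℤ)) x := by
    intro x
    have : π.comp (FreeGroup.lift t) = FreeGroup.lift (fun i : Fin n =>
      Multiplicative.ofAdd (Pi.single i (1 : ℤ) : Fin n → ℤ)) := by
      ext1 i; simp [ht]
    exact DFunLike.congr_fun this x
  let y : Fin m → G := fun j => φ (FreeGroup.of j) * (FreeGroup.lift t (w j))⁻¹
  let f : FreeGroup (Fin n ⊕ Fin m) →* G := FreeGroup.lift (Sum.elim t y)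
  have hf : Function.Surjective f := by
    have e1 : ∀ x, f (FreeGroup.lift (fun i => FreeGroup.of (Sum.inl i)) x) = FreeGroup.lift t x := by
      intro x
      have : f.comp (FreeGroup.lift (fun i => FreeGroup.of (Sum.inl i))) = FreeGroup.lift t := by
        ext1 i; simp [f]
      exact DFunLike.congr_fun this x
    rw [← MonoidHom.range_eq_top, eq_top_iff]
    rintro g -
    obtain ⟨x, rfl⟩ := hφ g
    induction x using FreeGroup.induction_on with
    | C1 => simp
    | of j =>
      refine ⟨FreeGroup.of (Sum.inr j) * FreeGroup.lift (fun i => FreeGroup.of (Sum.inl i)) (w j), ?_⟩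
      rw [map_mul, e1]
      simp [f, y]
    | inv_of z hz => rw [map_inv]; exact inv_mem hz
    | mul a b ha hb => rw [map_mul]; exact mul_mem ha hb
  obtain ⟨R, hR, hRk⟩ := ker_fng f hf
  refine ⟨m, ⟨f, hf, hR.toFinset, by simp [hRk], π, ?_, ?_⟩, rfl⟩
  · intro i; simp [f, ht]
  · intro j; simp [f, y, hlt, hw]

theorem exists_split {G : Type*} [Group G] [h : Group.IsFinitelyPresented G]
    (N : Subgroup G) [N.Normal] (hc : commutator G ≤ N) :
    ∃ (n : ℕ) (π : G →* Multiplicative (Fin n → ℤ)) (A : Type) (_ : CommGroup A) (_ : Finite A)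
      (τ : G →* A), Function.Surjective π ∧ ∀ g, g ∈ N ↔ π g = 1 ∧ τ g = 1 := by
  let _ : CommGroup (G ⧸ N) := { (inferInstance : Group (G ⧸ N)) with
    mul_comm := by
      intro a b
      obtain ⟨a, rfl⟩ := QuotientGroup.mk_surjective a
      obtain ⟨b, rfl⟩ := QuotientGroup.mk_surjective b
      rw [← QuotientGroup.mk_mul, ← QuotientGroup.mk_mul, QuotientGroup.eq]
      apply hc
      have : (a * b)⁻¹ * (b * a) = ⁅b⁻¹, a⁻¹⁆ := by rw [commutatorElement_def]; group
      rw [this]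
      exact Subgroup.commutator_mem_commutator (Subgroup.mem_top _) (Subgroup.mem_top _) }
  have hGfg : Group.FG G := by
    obtain ⟨m, φ, hφ, -⟩ := h.out
    exact Group.fg_of_surjective hφ
  have : Group.FG (G ⧸ N) := Group.fg_of_surjective (QuotientGroup.mk'_surjective N)
  obtain ⟨ι, j, _, _, p, hp, e, ⟨ε⟩⟩ := CommGroup.equiv_free_prod_prod_multiplicative_zmod (G ⧸ N)
  have hne : ∀ i, NeZero (p i ^ e i) := fun i => ⟨pow_ne_zero _ (hp i).ne_zero⟩
  have hfin : ∀ i, Finite (Multiplicative (ZMod (p i ^ e i))) := fun i =>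
    inferInstanceAs (Finite (ZMod (p i ^ e i)))
  let c := Fintype.equivFin j
  let κ : (j → Multiplicative ℤ) →* Multiplicative (Fin (Fintype.card j) → ℤ) :=
    { toFun := fun v => Multiplicative.ofAdd fun i => (v (c.symm i)).toAdd
      map_one' := rfl
      map_mul' := fun _ _ => rfl }
  have hκ : Function.Bijective κ := by
    constructor
    · intro v w hvw
      funext i
      have := congrFun (congrArg Multiplicative.toAdd hvw) (c i)
      simpa [κ] using this
    · intro v
      exact ⟨fun i => Multiplicative.ofAdd (v.toAdd (c i)), by simp [κ]⟩
  let E : G →* (j → Multiplicative ℤ) × ((i : ι) → Multiplicative (ZMod (p i ^ e i))) :=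
    ε.toMonoidHom.comp (QuotientGroup.mk' N)
  have hE : Function.Surjective E := ε.surjective.comp (QuotientGroup.mk'_surjective N)
  refine ⟨Fintype.card j, κ.comp ((MonoidHom.fst _ _).comp E), _, inferInstance, inferInstance,
    (MonoidHom.snd _ _).comp E, ?_, ?_⟩
  · exact hκ.2.comp (Prod.fst_surjective.comp hE)
  · intro g
    have h1 : g ∈ N ↔ E g = 1 := by
      change _ ↔ ε (QuotientGroup.mk g) = 1
      rw [EmbeddingLike.map_eq_one_iff, QuotientGroup.eq_one_iff]
    rw [h1, Prod.ext_iff]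
    refine and_congr ?_ Iff.rfl
    constructor
    · intro h; change κ (E g).1 = 1; rw [h]; exact map_one κ
    · intro h; exact hκ.1 (h.trans (map_one κ).symm)

theorem main {G : Type*} [Group G] [h : Group.IsFinitelyPresented G]
    (hfree : ∀ f : FreeGroup (Fin 2) →* G, ¬ Function.Injective f)
    (N : Subgroup G) [N.Normal] (hc : commutator G ≤ N) (H : Subgroup (G × G))
    (hH : ∀ p, p ∈ H ↔ p.1 * p.2⁻¹ ∈ N) : Group.IsFinitelyPresented H := by
  obtain ⟨n, π, A, _, _, τ, hπ, hN⟩ := exists_split N hc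
  obtain ⟨m, D, rfl⟩ := exists_pres π hπ
  let d1 : G × G →* Multiplicative (Fin n → ℤ) :=
    (D.π.comp (MonoidHom.fst G G)) / (D.π.comp (MonoidHom.snd G G))
  let d2 : G × G →* A := (τ.comp (MonoidHom.fst G G)) / (τ.comp (MonoidHom.snd G G))
  have : Group.IsFinitelyPresented d1.ker := D.fp_fibre hfree d1.ker (fun p => by
    rw [MonoidHom.mem_ker]; simp [d1, div_eq_one])
  have hHe : H = d1.ker ⊓ d2.ker := by
    ext p
    rw [hH, hN, Subgroup.mem_inf, MonoidHom.mem_ker, MonoidHom.mem_ker]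
    simp [d1, d2, div_eq_mul_inv]
  have hle : H ≤ d1.ker := hHe ▸ inf_le_left
  have he : H.subgroupOf d1.ker = (d2.comp d1.ker.subtype).ker := by
    ext ⟨p, hp⟩
    rw [Subgroup.mem_subgroupOf, hHe]
    simp only [Subgroup.mem_inf, hp, true_and]
    rfl
  have : (H.subgroupOf d1.ker).FiniteIndex := by rw [he]; infer_instance
  have := fp_finiteIndex (H.subgroupOf d1.ker)
  exact Group.IsFinitelyPresented.equiv (Subgroup.subgroupOfEquivOfLe hle)

end FPF

end partM

/-- If the finitely presented group `G` contains no free subgroup of rank 2 and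
`G' ≤ N ⊴ G`, then the untwisted `N`-fibre product
`{(g₁,g₂) : g₁N = g₂N} ≤ G × G` is finitely presented. -/
theorem untwisted_fibre_product_fp_of_no_free_subgroup {G : Type*} [Group G]
    (hfp : FinitelyPresentedGroup G)
    (hfree : ∀ f : FreeGroup (Fin 2) →* G, ¬ Function.Injective f)
    (N : Subgroup G) [N.Normal] (hc : commutator G ≤ N) :
    FinitelyPresentedGroup ↥(fibreProduct N N (MulEquiv.refl (G ⧸ N))) := by
  have h : Group.IsFinitelyPresented G := by
    obtain ⟨n, f, S, hf, hk⟩ := hfp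
    exact ⟨n, f, hf, S, S.finite_toSet, hk.symm⟩
  obtain ⟨n, f, hf, S, hS, hk⟩ := (FPF.main hfree N hc
    (fibreProduct N N (MulEquiv.refl (G ⧸ N))) (fun p => by
      change (QuotientGroup.mk p.1 : G ⧸ N) = QuotientGroup.mk p.2 ↔ _
      rw [← mul_inv_eq_one, ← QuotientGroup.mk_inv, ← QuotientGroup.mk_mul,
        QuotientGroup.eq_one_iff])).out
  exact ⟨n, f, hS.toFinset, hf, by rw [Set.Finite.coe_toFinset, hk]⟩
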